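/- The pairs of natural numbers (n, m) with n ≥ 6 and m ≥ 4 satisfying C(m, 2) = C(n, 3) + 1 are exactly (n, m) ∈ {(6, 7), (7, 9), (16, 34), (27, 77), (29, 86), (260, 2407), (665, 9879), (19630, 1587767)}, and the pairs of natural numbers (n, m) with n ≥ 4 and m ≥ 6 satisfying C(m, 3) = C(n, 2) + 1 are exactly (n, m) ∈ {(11, 8), (60, 23), (160403633, 425779)}, where C denotes the binomial coefficient. -/

import Mathlib

/-- The order with basis `1, α, δ, αδ` where `α² = 3δ` and `δ² = 6Nδ + 4Yα + 3N² - 4`. -/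
@[ext]
structure QuarticOrder (N Y : ℤ) where
  c0 : ℤ
  c1 : ℤ
  c2 : ℤ
  c3 : ℤ

namespace QuarticOrder

variable {N Y : ℤ}

instance : Zero (QuarticOrder N Y) := ⟨⟨0, 0, 0, 0⟩⟩
instance : One (QuarticOrder N Y) := ⟨⟨1, 0, 0, 0⟩⟩
instance : Add (QuarticOrder N Y) :=
  ⟨fun x y => ⟨x.c0 + y.c0, x.c1 + y.c1, x.c2 + y.c2, x.c3 + y.c3⟩⟩
instance : Neg (QuarticOrder N Y) := ⟨fun x => ⟨-x.c0, -x.c1, -x.c2, -x.c3⟩⟩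
instance : Sub (QuarticOrder N Y) :=
  ⟨fun x y => ⟨x.c0 - y.c0, x.c1 - y.c1, x.c2 - y.c2, x.c3 - y.c3⟩⟩
instance : Mul (QuarticOrder N Y) :=
  ⟨fun x y =>
    let s := 3 * (x.c1 * y.c3 + x.c3 * y.c1) + x.c2 * y.c2 + 18 * N * (x.c3 * y.c3)
    let t := x.c2 * y.c3 + x.c3 * y.c2
    let w := 3 * (x.c3 * y.c3)
    ⟨x.c0 * y.c0 + (3 * N ^ 2 - 4) * s,
     x.c0 * y.c1 + x.c1 * y.c0 + 4 * Y * s + (3 * N ^ 2 - 4) * t,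
     3 * (x.c1 * y.c1) + x.c0 * y.c2 + x.c2 * y.c0 + 6 * N * s + 12 * Y * t
       + (3 * N ^ 2 - 4) * w,
     x.c0 * y.c3 + x.c1 * y.c2 + x.c2 * y.c1 + x.c3 * y.c0 + 6 * N * t + 4 * Y * w⟩⟩

@[simp] lemma c0_zero : (0 : QuarticOrder N Y).c0 = 0 := rfl
@[simp] lemma c1_zero : (0 : QuarticOrder N Y).c1 = 0 := rfl
@[simp] lemma c2_zero : (0 : QuarticOrder N Y).c2 = 0 := rfl
@[simp] lemma c3_zero : (0 : QuarticOrder N Y).c3 = 0 := rfl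
@[simp] lemma c0_one : (1 : QuarticOrder N Y).c0 = 1 := rfl
@[simp] lemma c1_one : (1 : QuarticOrder N Y).c1 = 0 := rfl
@[simp] lemma c2_one : (1 : QuarticOrder N Y).c2 = 0 := rfl
@[simp] lemma c3_one : (1 : QuarticOrder N Y).c3 = 0 := rfl
@[simp] lemma c0_add (x y : QuarticOrder N Y) : (x + y).c0 = x.c0 + y.c0 := rfl
@[simp] lemma c1_add (x y : QuarticOrder N Y) : (x + y).c1 = x.c1 + y.c1 := rfl
@[simp] lemma c2_add (x y : QuarticOrder N Y) : (x + y).c2 = x.c2 + y.c2 := rfl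
@[simp] lemma c3_add (x y : QuarticOrder N Y) : (x + y).c3 = x.c3 + y.c3 := rfl
@[simp] lemma c0_neg (x : QuarticOrder N Y) : (-x).c0 = -x.c0 := rfl
@[simp] lemma c1_neg (x : QuarticOrder N Y) : (-x).c1 = -x.c1 := rfl
@[simp] lemma c2_neg (x : QuarticOrder N Y) : (-x).c2 = -x.c2 := rfl
@[simp] lemma c3_neg (x : QuarticOrder N Y) : (-x).c3 = -x.c3 := rfl
@[simp] lemma c0_sub (x y : QuarticOrder N Y) : (x - y).c0 = x.c0 - y.c0 := rfl
@[simp] lemma c1_sub (x y : QuarticOrder N Y) : (x - y).c1 = x.c1 - y.c1 := rfl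
@[simp] lemma c2_sub (x y : QuarticOrder N Y) : (x - y).c2 = x.c2 - y.c2 := rfl
@[simp] lemma c3_sub (x y : QuarticOrder N Y) : (x - y).c3 = x.c3 - y.c3 := rfl
lemma c0_mul (x y : QuarticOrder N Y) : (x * y).c0 = x.c0 * y.c0 + (3 * N ^ 2 - 4) *
    (3 * (x.c1 * y.c3 + x.c3 * y.c1) + x.c2 * y.c2 + 18 * N * (x.c3 * y.c3)) := rfl
lemma c1_mul (x y : QuarticOrder N Y) : (x * y).c1 = x.c0 * y.c1 + x.c1 * y.c0 + 4 * Y *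
    (3 * (x.c1 * y.c3 + x.c3 * y.c1) + x.c2 * y.c2 + 18 * N * (x.c3 * y.c3))
    + (3 * N ^ 2 - 4) * (x.c2 * y.c3 + x.c3 * y.c2) := rfl
lemma c2_mul (x y : QuarticOrder N Y) : (x * y).c2 =
    3 * (x.c1 * y.c1) + x.c0 * y.c2 + x.c2 * y.c0 + 6 * N *
    (3 * (x.c1 * y.c3 + x.c3 * y.c1) + x.c2 * y.c2 + 18 * N * (x.c3 * y.c3))
    + 12 * Y * (x.c2 * y.c3 + x.c3 * y.c2)
    + (3 * N ^ 2 - 4) * (3 * (x.c3 * y.c3)) := rfl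
lemma c3_mul (x y : QuarticOrder N Y) : (x * y).c3 =
    x.c0 * y.c3 + x.c1 * y.c2 + x.c2 * y.c1 + x.c3 * y.c0
    + 6 * N * (x.c2 * y.c3 + x.c3 * y.c2) + 4 * Y * (3 * (x.c3 * y.c3)) := rfl

instance : CommRing (QuarticOrder N Y) where
  add_assoc _ _ _ := by ext <;> simp [add_assoc]
  zero_add _ := by ext <;> simp
  add_zero _ := by ext <;> simp
  add_comm _ _ := by ext <;> simp [add_comm]
  neg_add_cancel _ := by ext <;> simp
  sub_eq_add_neg _ _ := by ext <;> simp [sub_eq_add_neg]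
  nsmul := nsmulRec
  zsmul := zsmulRec
  mul_assoc _ _ _ := by ext <;> simp only [c0_mul, c1_mul, c2_mul, c3_mul] <;> ring
  mul_comm _ _ := by ext <;> simp only [c0_mul, c1_mul, c2_mul, c3_mul] <;> ring
  one_mul _ := by ext <;> simp [c0_mul, c1_mul, c2_mul, c3_mul]
  mul_one _ := by ext <;> simp [c0_mul, c1_mul, c2_mul, c3_mul]
  zero_mul _ := by ext <;> simp [c0_mul, c1_mul, c2_mul, c3_mul]
  mul_zero _ := by ext <;> simp [c0_mul, c1_mul, c2_mul, c3_mul]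
  left_distrib _ _ _ := by
    ext <;> simp only [c0_mul, c1_mul, c2_mul, c3_mul, c0_add, c1_add, c2_add, c3_add] <;> ring
  right_distrib _ _ _ := by
    ext <;> simp only [c0_mul, c1_mul, c2_mul, c3_mul, c0_add, c1_add, c2_add, c3_add] <;> ring

/-- The additive equivalence given by the coordinates. -/
def coords (N Y : ℤ) : QuarticOrder N Y ≃+ (Fin 4 → ℤ) where
  toFun x := ![x.c0, x.c1, x.c2, x.c3]
  invFun v := ⟨v 0, v 1, v 2, v 3⟩
  left_inv _ := rfl
  right_inv v := by ext i; fin_cases i <;> rfl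
  map_add' x y := by ext i; fin_cases i <;> rfl

instance : Module.Finite ℤ (QuarticOrder N Y) :=
  Module.Finite.equiv (coords N Y).symm.toIntLinearEquiv

/-- The ring homomorphism sending the basis `1, α, δ, αδ` to `1, a, d, a * d`. -/
def lift {S : Type*} [CommRing S] (a d : S) (h1 : a ^ 2 = 3 * d)
    (h2 : d ^ 2 = 6 * N * d + 4 * Y * a + (3 * N ^ 2 - 4)) : QuarticOrder N Y →+* S where
  toFun x := x.c0 + x.c1 * a + x.c2 * d + x.c3 * (a * d)
  map_zero' := by simp
  map_one' := by simp
  map_add' x y := by simp only [c0_add, c1_add, c2_add, c3_add]; push_cast; ring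
  map_mul' x y := by
    simp only [c0_mul, c1_mul, c2_mul, c3_mul]; push_cast
    have h3 : d ^ 3 = 6 * N * d ^ 2 + 4 * Y * (a * d) + (3 * N ^ 2 - 4) * d := by
      linear_combination d * h2
    have h4 : a * d ^ 2 = 6 * N * (a * d) + 4 * Y * (3 * d) + (3 * N ^ 2 - 4) * a := by
      linear_combination a * h2 + 4 * Y * h1
    generalize (x.c0 : S) = x0, (x.c1 : S) = x1, (x.c2 : S) = x2, (x.c3 : S) = x3,
      (y.c0 : S) = y0, (y.c1 : S) = y1, (y.c2 : S) = y2, (y.c3 : S) = y3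
    linear_combination (-(x1 * y1) - (x1 * y3 + x3 * y1) * d - x3 * y3 * d ^ 2) * h1
      - (3 * (x1 * y3 + x3 * y1) + x2 * y2 + 18 * N * (x3 * y3)) * h2
      - (3 * (x3 * y3)) * h3
      - (x2 * y3 + x3 * y2) * h4

lemma lift_apply {S : Type*} [CommRing S] (a d : S) (h1 : a ^ 2 = 3 * d)
    (h2 : d ^ 2 = 6 * N * d + 4 * Y * a + (3 * N ^ 2 - 4)) (x : QuarticOrder N Y) :
    lift a d h1 h2 x = x.c0 + x.c1 * a + x.c2 * d + x.c3 * (a * d) := rfl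

end QuarticOrder

open Polynomial

/-- A depressed quartic over a field without roots and without quadratic factors is irreducible. -/
lemma irreducible_depressed_quartic {k : Type*} [Field k] (P Q S : k)
    (hroot : ∀ x, x ^ 4 + P * x ^ 2 + Q * x + S ≠ 0)
    (hquad : ∀ a b, ¬ (a * (P + a ^ 2 - b - b) = Q ∧ b * (P + a ^ 2 - b) = S)) :
    Irreducible (X ^ 4 + C P * X ^ 2 + C Q * X + C S : k[X]) := by
  have hdeg : (X ^ 4 + C P * X ^ 2 + C Q * X + C S : k[X]).natDegree = 4 := by compute_degree!
  have hmon : (X ^ 4 + C P * X ^ 2 + C Q * X + C S : k[X]).Monic := by monicity!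
  have hne : (X ^ 4 + C P * X ^ 2 + C Q * X + C S : k[X]) ≠ 1 := by
    intro h; rw [h] at hdeg; simp at hdeg
  rw [hmon.irreducible_iff_lt_natDegree_lt hne]
  intro g hg hgd hdvd
  rw [hdeg, Finset.mem_Ioc] at hgd
  obtain ⟨h1, h2⟩ := hgd
  have h3 : g.natDegree = 1 ∨ g.natDegree = 2 := by omega
  obtain ⟨r, hr⟩ := hdvd
  rcases h3 with h3 | h3
  · have hgx : g = X + C (g.coeff 0) := by
      have := hg.as_sum
      rw [h3] at this
      simpa using this
    apply hroot (-g.coeff 0)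
    have := congrArg (eval (-g.coeff 0)) hr
    rw [hgx] at this
    simpa using this
  · have hgx : g = X ^ 2 + C (g.coeff 1) * X + C (g.coeff 0) := by
      have := hg.as_sum
      rw [h3] at this
      simp only [Finset.sum_range_succ, Finset.range_zero, Finset.sum_empty] at this
      rw [zero_add] at this
      rw [this]
      simp
      ring
    have hrm : r.Monic := Monic.of_mul_monic_left hg (hr ▸ hmon)
    have hrd : r.natDegree = 2 := by
      have := hg.natDegree_mul hrm
      rw [← hr, hdeg, h3] at this; omega
    have hrx : r = X ^ 2 + C (r.coeff 1) * X + C (r.coeff 0) := by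
      have := hrm.as_sum
      rw [hrd] at this
      simp only [Finset.sum_range_succ, Finset.range_zero, Finset.sum_empty] at this
      rw [zero_add] at this
      rw [this]
      simp
      ring
    generalize g.coeff 1 = a, g.coeff 0 = b at hgx
    generalize r.coeff 1 = c, r.coeff 0 = d at hrx
    have key : (X ^ 4 + C P * X ^ 2 + C Q * X + C S : k[X]) =
        X ^ 4 + C (a + c) * X ^ 3 + C (b + d + a * c) * X ^ 2 + C (a * d + b * c) * X
          + C (b * d) := by
      rw [hr, hgx, hrx]; simp only [C_add, C_mul]; ring
    have e3 := congrArg (fun p => coeff p 3) key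
    have e2 := congrArg (fun p => coeff p 2) key
    have e1 := congrArg (fun p => coeff p 1) key
    have e0 := congrArg (fun p => coeff p 0) key
    simp only [coeff_add, coeff_C_mul, coeff_X_pow, coeff_X, coeff_C] at e0 e1 e2 e3
    norm_num at e0 e1 e2 e3
    have hc : c = -a := by linear_combination (-1 : k) * e3
    subst hc
    apply hquad a b
    constructor
    · linear_combination (-1 : k) * e1 + a * e2
    · linear_combination (-1 : k) * e0 + b * e2

/-- A real depressed quartic with negative discriminant has a non-real complex root. -/
lemma exists_nonreal_root (P Q S : ℝ)
    (hdisc : 16 * P ^ 4 * S - 4 * P ^ 3 * Q ^ 2 - 128 * P ^ 2 * S ^ 2 + 144 * P * Q ^ 2 * S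
      - 27 * Q ^ 4 + 256 * S ^ 3 < 0) :
    ∃ z : ℂ, z ^ 4 + P * z ^ 2 + Q * z + S = 0 ∧ z.im ≠ 0 := by
  set f : ℂ[X] := X ^ 4 + C (P : ℂ) * X ^ 2 + C (Q : ℂ) * X + C (S : ℂ) with hf
  have hdeg : f.natDegree = 4 := by rw [hf]; compute_degree!
  have hmon : f.Monic := by rw [hf]; monicity!
  have hsplit : f.Splits := IsAlgClosed.splits f
  have hcard : Multiset.card f.roots = 4 := by
    rw [← hdeg]; exact hsplit.natDegree_eq_card_roots.symm
  obtain ⟨a, b, c, d, hr⟩ : ∃ a b c d, f.roots = {a, b, c, d} := by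
    obtain ⟨a, ha⟩ := Multiset.card_pos_iff_exists_mem.1 (by omega : 0 < Multiset.card f.roots)
    obtain ⟨s, hs⟩ := Multiset.exists_cons_of_mem ha
    rw [hs, Multiset.card_cons] at hcard
    obtain ⟨b, c, d, h⟩ := Multiset.card_eq_three.1 (Nat.succ.inj hcard)
    exact ⟨a, b, c, d, by rw [hs, h]; rfl⟩
  have hprod : f = (X - C a) * ((X - C b) * ((X - C c) * (X - C d))) := by
    have := hsplit.eq_prod_roots
    rw [hmon.leadingCoeff, hr] at this
    simpa using this
  have hroot : ∀ z, z ∈ f.roots → z ^ 4 + P * z ^ 2 + Q * z + S = 0 := by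
    intro z hz
    have := (mem_roots hmon.ne_zero).1 hz
    simpa [hf, IsRoot] using this
  by_contra hcon
  push Not at hcon
  have hre : ∀ z, z ∈ f.roots → z = (z.re : ℂ) := fun z hz =>
    Complex.ext rfl (by simpa using hcon z (hroot z hz))
  have ha := hre a (by simp [hr])
  have hb := hre b (by simp [hr])
  have hc := hre c (by simp [hr])
  have hd := hre d (by simp [hr])
  generalize a.re = a' at ha
  generalize b.re = b' at hb
  generalize c.re = c' at hc
  generalize d.re = d' at hd
  subst ha hb hc hd
  have key : f = X ^ 4 + C (-(a' + b' + c' + d') : ℂ) * X ^ 3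
      + C (a' * b' + a' * c' + a' * d' + b' * c' + b' * d' + c' * d' : ℂ) * X ^ 2
      + C (-(a' * b' * c' + a' * b' * d' + a' * c' * d' + b' * c' * d') : ℂ) * X
      + C (a' * b' * c' * d' : ℂ) := by
    rw [hprod]; simp only [C_add, C_mul, C_neg]; ring
  rw [hf] at key
  have e3 := congrArg (fun p => coeff p 3) key
  have e2 := congrArg (fun p => coeff p 2) key
  have e1 := congrArg (fun p => coeff p 1) key
  have e0 := congrArg (fun p => coeff p 0) key
  simp only [coeff_add, coeff_C_mul, coeff_X_pow, coeff_X, coeff_C] at e0 e1 e2 e3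
  norm_num at e0 e1 e2 e3
  norm_cast at e0 e1 e2 e3
  have hd' : d' = -(a' + b' + c') := by linarith
  subst hd'
  subst e0 e1 e2
  have : 0 ≤ ((a' - b') * (a' - c') * (a' + (a' + b' + c')) * (b' - c') * (b' + (a' + b' + c'))
    * (c' + (a' + b' + c'))) ^ 2 := sq_nonneg _
  revert hdisc
  rw [imp_false, not_lt]
  refine this.trans (le_of_eq ?_)
  ring

namespace QuarticOrder

variable {N Y : ℤ}

/-- The minimal polynomial of `α`. -/
noncomputable def genPoly (N Y : ℤ) : ℚ[X] :=
  X ^ 4 + C (-18 * N : ℚ) * X ^ 2 + C (-36 * Y : ℚ) * X + C (36 - 27 * N ^ 2 : ℚ)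

/-- The ring homomorphism to a field of characteristic zero given by a root of `genPoly`. -/
noncomputable def liftRoot {L : Type*} [Field L] [CharZero L] (z : L)
    (hz : z ^ 4 - 18 * N * z ^ 2 - 36 * Y * z + (36 - 27 * N ^ 2) = 0) : QuarticOrder N Y →+* L :=
  lift z (z ^ 2 / 3) (by ring) (by linear_combination hz / 9)

lemma liftRoot_injective (hirr : Irreducible (genPoly N Y)) {L : Type*} [Field L] [CharZero L]
    (z : L) (hz : z ^ 4 - 18 * N * z ^ 2 - 36 * Y * z + (36 - 27 * N ^ 2) = 0) :
    Function.Injective (liftRoot (N := N) (Y := Y) z hz) := by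
  rw [injective_iff_map_eq_zero]
  intro x hx
  have hdeg : (genPoly N Y).natDegree = 4 := by rw [genPoly]; compute_degree!
  have hmon : (genPoly N Y).Monic := by rw [genPoly]; monicity!
  set g : ℚ[X] := C (x.c3 / 3 : ℚ) * X ^ 3 + C (x.c2 / 3 : ℚ) * X ^ 2 + C (x.c1 : ℚ) * X
    + C (x.c0 : ℚ) with hg
  have hroot : aeval z (genPoly N Y) = 0 := by
    simp only [genPoly, map_add, map_mul, map_pow, aeval_X, aeval_C, eq_ratCast]
    push_cast
    linear_combination hz
  have hmin := minpoly.eq_of_irreducible_of_monic hirr hroot hmon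
  have hgz : aeval z g = 0 := by
    rw [liftRoot, lift_apply] at hx
    simp only [hg, map_add, map_mul, map_pow, aeval_X, aeval_C, eq_ratCast]
    push_cast
    linear_combination hx
  have hdvd : genPoly N Y ∣ g := hmin ▸ minpoly.dvd ℚ z hgz
  have hg0 : g = 0 := by
    apply eq_zero_of_dvd_of_natDegree_lt hdvd
    rw [hdeg, hg]
    exact lt_of_le_of_lt (natDegree_cubic_le) (by norm_num)
  have e (n : ℕ) : g.coeff n = 0 := by rw [hg0, coeff_zero]
  have e0 := e 0
  have e1 := e 1
  have e2 := e 2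
  have e3 := e 3
  simp only [hg, coeff_add, coeff_C_mul, coeff_X_pow, coeff_X, coeff_C] at e0 e1 e2 e3
  norm_num at e0 e1 e2 e3
  ext <;> assumption

/-- Any three units of the order are multiplicatively dependent when the order has a
non-real embedding. -/
lemma exists_zpow_eq_one (hirr : Irreducible (genPoly N Y))
    (hz : ∃ z : ℂ, z ^ 4 - 18 * N * z ^ 2 - 36 * Y * z + (36 - 27 * N ^ 2) = 0 ∧ z.im ≠ 0)
    (u : Fin 3 → (QuarticOrder N Y)ˣ) :
    ∃ k : Fin 3 → ℤ, k ≠ 0 ∧ u 0 ^ k 0 * u 1 ^ k 1 * u 2 ^ k 2 = 1 := by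
  have : Fact (Irreducible (genPoly N Y)) := ⟨hirr⟩
  have hne := hirr.ne_zero
  have hdeg : (genPoly N Y).natDegree = 4 := by rw [genPoly]; compute_degree!
  let K := AdjoinRoot (genPoly N Y)
  have : CharZero K := charZero_of_injective_algebraMap (algebraMap ℚ K).injective
  have hfr : Module.finrank ℚ K = 4 := by
    rw [(AdjoinRoot.powerBasis hne).finrank, AdjoinRoot.powerBasis_dim, hdeg]
  have : FiniteDimensional ℚ K := Module.finite_of_finrank_pos (by omega)
  have : NumberField K := ⟨⟩
  obtain ⟨z, hz, him⟩ := hz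
  have hzf : eval₂ (algebraMap ℚ ℂ) z (genPoly N Y) = 0 := by
    simp only [genPoly, eval₂_add, eval₂_mul, eval₂_pow, eval₂_X, eval₂_C, eq_ratCast]
    push_cast
    linear_combination hz
  let φ : K →+* ℂ := AdjoinRoot.lift (algebraMap ℚ ℂ) z hzf
  have hφ : φ (AdjoinRoot.root _) = z := AdjoinRoot.lift_root hzf
  have hcomplex : (NumberField.InfinitePlace.mk φ).IsComplex := by
    rw [NumberField.InfinitePlace.isComplex_mk_iff]
    intro hreal
    rw [NumberField.ComplexEmbedding.isReal_iff] at hreal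
    have := RingHom.congr_fun hreal (AdjoinRoot.root _)
    rw [NumberField.ComplexEmbedding.conjugate_coe_eq, hφ] at this
    exact him (Complex.conj_eq_iff_im.1 this)
  have hpos : 0 < NumberField.InfinitePlace.nrComplexPlaces K := by
    classical
    exact Fintype.card_pos_iff.2 ⟨⟨_, hcomplex⟩⟩
  have hrank : NumberField.Units.rank K ≤ 2 := by
    have h1 := NumberField.InfinitePlace.card_add_two_mul_card_eq_rank K
    have h2 := NumberField.InfinitePlace.card_eq_nrRealPlaces_add_nrComplexPlaces K
    rw [hfr] at h1
    rw [NumberField.Units.rank, h2]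
    omega
  have hα : (AdjoinRoot.root (genPoly N Y) : K) ^ 4 - 18 * N * (AdjoinRoot.root (genPoly N Y)) ^ 2
      - 36 * Y * (AdjoinRoot.root (genPoly N Y)) + (36 - 27 * N ^ 2) = 0 := by
    have key {L : Type} [Field L] [CharZero L] (i : ℚ →+* L) (y : L)
        (h : eval₂ i y (genPoly N Y) = 0) :
        y ^ 4 - 18 * N * y ^ 2 - 36 * Y * y + (36 - 27 * N ^ 2) = 0 := by
      simp only [genPoly, eval₂_add, eval₂_mul, eval₂_pow, eval₂_X, eval₂_C] at h
      simp only [map_mul, map_sub, map_neg, map_ofNat, map_intCast, map_pow] at h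
      linear_combination h
    exact key _ _ (AdjoinRoot.eval₂_root (genPoly N Y))
  let ι : QuarticOrder N Y →+* K := liftRoot _ hα
  have hι : Function.Injective ι := liftRoot_injective hirr _ hα
  let ι' : QuarticOrder N Y →+* NumberField.RingOfIntegers K :=
    ι.codRestrict _ fun x => by
      have : IsIntegral ℤ x := Algebra.IsIntegral.isIntegral x
      exact this.map (ι.toIntAlgHom)
  have hι' : Function.Injective ι' := fun x y h => hι (congrArg Subtype.val h)
  let U := Units.map (ι' : QuarticOrder N Y →* NumberField.RingOfIntegers K)
  have hU : Function.Injective U := Units.map_injective hι'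
  have hdep : ¬ LinearIndependent ℤ (fun i => Additive.ofMul (U (u i))) := by
    intro h
    have := h.fintype_card_le_finrank
    rw [NumberField.Units.finrank_eq, Fintype.card_fin] at this
    omega
  rw [Fintype.not_linearIndependent_iff] at hdep
  obtain ⟨k, hk, i, hi⟩ := hdep
  refine ⟨k, fun h => hi (by simp [h]), ?_⟩
  apply hU
  rw [Fin.sum_univ_three] at hk
  have hk' := congrArg Additive.toMul hk
  simp only [toMul_add, toMul_zsmul, toMul_ofMul, toMul_zero] at hk'
  simpa only [map_mul, map_zpow, map_one] using hk'

/-- Torsion units are `±1`, since the order has a real embedding. -/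
lemma eq_one_or_neg_one_of_pow (hirr : Irreducible (genPoly N Y))
    (hneg : 1 - 18 * N - 36 * Y + (36 - 27 * N ^ 2) < 0)
    {x : QuarticOrder N Y} {n : ℕ} (hn : n ≠ 0) (hx : x ^ n = 1) : x = 1 ∨ x = -1 := by
  obtain ⟨r, hr⟩ : ∃ r : ℝ, r ^ 4 - 18 * N * r ^ 2 - 36 * Y * r + (36 - 27 * N ^ 2) = 0 := by
    have hcont : Continuous fun r : ℝ => r ^ 4 - 18 * N * r ^ 2 - 36 * Y * r + (36 - 27 * N ^ 2) :=
      by fun_prop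
    set b : ℝ := 1 + 18 * |(N : ℝ)| + 36 * |(Y : ℝ)| + 27 * N ^ 2 with hb
    have hN := abs_nonneg (N : ℝ)
    have hY := abs_nonneg (Y : ℝ)
    have hb1 : 1 ≤ b := by nlinarith [sq_nonneg (N : ℝ)]
    have h1 : (1 : ℝ) ^ 4 - 18 * N * 1 ^ 2 - 36 * Y * 1 + (36 - 27 * N ^ 2) ≤ 0 := by
      have : ((1 - 18 * N - 36 * Y + (36 - 27 * N ^ 2) : ℤ) : ℝ) ≤ 0 := by exact_mod_cast hneg.le
      push_cast at this
      linarith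
    have h2 : 0 ≤ b ^ 4 - 18 * N * b ^ 2 - 36 * Y * b + (36 - 27 * N ^ 2) := by
      have hb2 : 1 ≤ b ^ 2 := one_le_pow₀ hb1
      have hb3 : b ≤ b ^ 2 := by nlinarith
      have hb4 : b * b ^ 2 ≤ b ^ 4 := by nlinarith [sq_nonneg b]
      have k1 : N * b ^ 2 ≤ |(N : ℝ)| * b ^ 2 :=
        mul_le_mul_of_nonneg_right (le_abs_self _) (by positivity)
      have k2 : Y * b ≤ |(Y : ℝ)| * b ^ 2 :=
        (mul_le_mul_of_nonneg_right (le_abs_self _) (by positivity)).trans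
          (mul_le_mul_of_nonneg_left hb3 hY)
      have k3 : (N : ℝ) ^ 2 ≤ N ^ 2 * b ^ 2 := by nlinarith [sq_nonneg (N : ℝ)]
      have k4 : b * b ^ 2 = b ^ 2 + 18 * (|(N : ℝ)| * b ^ 2) + 36 * (|(Y : ℝ)| * b ^ 2)
          + 27 * (N ^ 2 * b ^ 2) := by rw [hb]; ring
      nlinarith
    obtain ⟨r, -, hr⟩ := intermediate_value_Icc hb1 hcont.continuousOn ⟨h1, h2⟩
    exact ⟨r, hr⟩
  have hinj := liftRoot_injective hirr r hr
  have h := congrArg (liftRoot r hr) hx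
  rw [map_pow, map_one] at h
  have h1 : |liftRoot r hr x| = 1 := by
    rw [← abs_pow_eq_one _ hn, h, abs_one]
  rcases abs_eq zero_le_one |>.1 h1 with h2 | h2
  · left; apply hinj; rw [h2, map_one]
  · right; apply hinj; rw [h2, map_neg, map_one]

lemma genPoly_irreducible (q : ℕ) [Fact q.Prime]
    (hroot : ∀ x : ZMod q, x ^ 4 + (-18 * N : ℤ) * x ^ 2 + (-36 * Y : ℤ) * x
      + (36 - 27 * N ^ 2 : ℤ) ≠ 0)
    (hquad : ∀ a b : ZMod q, ¬ (a * ((-18 * N : ℤ) + a ^ 2 - b - b) = (-36 * Y : ℤ) ∧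
      b * ((-18 * N : ℤ) + a ^ 2 - b) = (36 - 27 * N ^ 2 : ℤ))) :
    Irreducible (genPoly N Y) := by
  set g : ℤ[X] := X ^ 4 + C (-18 * N) * X ^ 2 + C (-36 * Y) * X + C (36 - 27 * N ^ 2) with hg
  have hmon : g.Monic := by rw [hg]; monicity!
  have h1 : Irreducible (g.map (Int.castRingHom (ZMod q))) := by
    have := irreducible_depressed_quartic _ _ _ hroot hquad
    simp only [hg, Polynomial.map_add, Polynomial.map_mul, Polynomial.map_pow, map_X, map_C]
    exact this
  have h2 : Irreducible g := hmon.irreducible_of_irreducible_map (Int.castRingHom (ZMod q)) g h1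
  have h3 := (hmon.irreducible_iff_irreducible_map_fraction_map (K := ℚ)).1 h2
  convert h3 using 1
  simp only [hg, genPoly, Polynomial.map_add, Polynomial.map_mul, Polynomial.map_pow, map_X, map_C]
  norm_num

end QuarticOrder

/-- If any three units of a commutative ring are multiplicatively dependent, `±1` are the only
torsion units, and `e₁`, `e₂` are independent modulo `ℓ`-th powers for every prime `ℓ ∣ Q`, then
`±1`, `e₁`, `e₂` generate the units modulo `Q`-th powers. -/
lemma exists_eq_mul_pow_of_saturated {R : Type*} [CommRing R] {Q : ℕ} (hQ : 0 < Q) (e₁ e₂ : Rˣ)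
    (hdep : ∀ u : Fin 3 → Rˣ, ∃ k : Fin 3 → ℤ, k ≠ 0 ∧ u 0 ^ k 0 * u 1 ^ k 1 * u 2 ^ k 2 = 1)
    (htor : ∀ (x : Rˣ) (n : ℕ), n ≠ 0 → x ^ n = 1 → x = 1 ∨ x = -1)
    (hsat : ∀ ℓ : ℕ, ℓ.Prime → ℓ ∣ Q → ∀ (v : Rˣ) (a b : ℤ),
      (v ^ ℓ = e₁ ^ a * e₂ ^ b ∨ v ^ ℓ = -(e₁ ^ a * e₂ ^ b)) → (ℓ : ℤ) ∣ a ∧ (ℓ : ℤ) ∣ b)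
    (u : Rˣ) :
    ∃ (i j : ℕ) (v : Rˣ), i < Q ∧ j < Q ∧
      (u = e₁ ^ i * e₂ ^ j * v ^ Q ∨ u = -(e₁ ^ i * e₂ ^ j * v ^ Q)) := by
  obtain ⟨k', a', b', hcop, hrel⟩ : ∃ k a b : ℤ, (∀ ℓ : ℕ, ℓ.Prime → (ℓ : ℤ) ∣ k → (ℓ : ℤ) ∣ a →
      (ℓ : ℤ) ∣ b → False) ∧ (u ^ k = e₁ ^ a * e₂ ^ b ∨ u ^ k = -(e₁ ^ a * e₂ ^ b)) := by
    obtain ⟨k, hk, hrel⟩ := hdep ![u, e₁⁻¹, e₂⁻¹]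
    simp only [Matrix.cons_val_zero, Matrix.cons_val_one, Matrix.cons_val] at hrel
    set g := Int.gcd (k 0) (Int.gcd (k 1) (k 2)) with hg
    have hg0 : g ≠ 0 := by
      intro h
      rw [hg, Int.gcd_eq_zero_iff] at h
      have h2 := Int.gcd_eq_zero_iff.1 (Int.ofNat_eq_zero.1 h.2)
      apply hk
      ext i
      fin_cases i
      · exact h.1
      · exact h2.1
      · exact h2.2
    have d0 : (g : ℤ) ∣ k 0 := Int.gcd_dvd_left _ _
    have d12 : (g : ℤ) ∣ Int.gcd (k 1) (k 2) := Int.gcd_dvd_right _ _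
    have d1 : (g : ℤ) ∣ k 1 := d12.trans (Int.gcd_dvd_left _ _)
    have d2 : (g : ℤ) ∣ k 2 := d12.trans (Int.gcd_dvd_right _ _)
    obtain ⟨k0, h0⟩ := d0
    obtain ⟨k1, h1⟩ := d1
    obtain ⟨k2, h2⟩ := d2
    refine ⟨k0, k1, k2, ?_, ?_⟩
    · intro ℓ hℓ l0 l1 l2
      have h12 : ((g * ℓ : ℕ) : ℤ) ∣ Int.gcd (k 1) (k 2) := by
        rw [h1, h2]
        push_cast
        exact Int.dvd_coe_gcd (mul_dvd_mul_left _ l1) (mul_dvd_mul_left _ l2)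
      have h00 : ((g * ℓ : ℕ) : ℤ) ∣ k 0 := by
        rw [h0]
        push_cast
        exact mul_dvd_mul_left _ l0
      have h3 : ((g * ℓ : ℕ) : ℤ) ∣ g := Int.dvd_coe_gcd h00 h12
      have h4 := Nat.le_of_dvd (Nat.pos_of_ne_zero hg0) (Int.natCast_dvd_natCast.1 h3)
      have := hℓ.two_le
      nlinarith [Nat.pos_of_ne_zero hg0]
    · have h5 : (u ^ k0 * (e₁ ^ k1 * e₂ ^ k2)⁻¹) ^ g = 1 := by
        rw [← hrel, h0, h1, h2, mul_pow, inv_pow, mul_pow, zpow_mul, zpow_mul, zpow_mul]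
        simp only [← zpow_natCast, ← zpow_mul, mul_comm (g : ℤ), inv_zpow, mul_inv]
        rw [mul_assoc]
      rcases htor _ g hg0 h5 with h | h
      · left; rwa [mul_inv_eq_one] at h
      · right; rw [mul_inv_eq_iff_eq_mul] at h; rw [h, neg_one_mul]
  have hco : IsCoprime k' (Q : ℤ) := by
    rw [Int.isCoprime_iff_gcd_eq_one]
    by_contra hne
    obtain ⟨ℓ, hℓ, hd⟩ := Nat.exists_prime_and_dvd hne
    have l0 : (ℓ : ℤ) ∣ k' := (Int.natCast_dvd_natCast.2 hd).trans (Int.gcd_dvd_left _ _)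
    have lQ : ℓ ∣ Q := Int.natCast_dvd_natCast.1
      ((Int.natCast_dvd_natCast.2 hd).trans (Int.gcd_dvd_right _ _))
    obtain ⟨m, hm⟩ := l0
    have := hsat ℓ hℓ lQ (u ^ m) a' b' (by
      rwa [← zpow_natCast, ← zpow_mul, mul_comm m, ← hm])
    exact hcop ℓ hℓ ⟨m, hm⟩ this.1 this.2
  obtain ⟨x, y, hxy⟩ := hco
  have hu : u = (u ^ k') ^ x * (u ^ y) ^ Q := by
    rw [← zpow_natCast, ← zpow_mul, ← zpow_mul, ← zpow_add, mul_comm k', hxy, zpow_one]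
  have hQ' : (0 : ℤ) < Q := by exact_mod_cast hQ
  have red (c : ℤ) (e : Rˣ) : e ^ c = e ^ (c % Q).toNat * (e ^ (c / Q)) ^ Q := by
    rw [← zpow_natCast, ← zpow_natCast, ← zpow_mul, ← zpow_add,
      Int.toNat_of_nonneg (Int.emod_nonneg _ hQ'.ne'), mul_comm (c / Q), Int.emod_add_mul_ediv]
  have hlt (c : ℤ) : (c % Q).toNat < Q := by
    have := Int.emod_lt_of_pos c hQ'
    have := Int.emod_nonneg c hQ'.ne'
    omega
  refine ⟨(a' * x % Q).toNat, (b' * x % Q).toNat,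
    e₁ ^ (a' * x / Q) * e₂ ^ (b' * x / Q) * u ^ y, hlt _, hlt _, ?_⟩
  have key : (e₁ ^ a' * e₂ ^ b') ^ x * (u ^ y) ^ Q = e₁ ^ (a' * x % Q).toNat *
      e₂ ^ (b' * x % Q).toNat * (e₁ ^ (a' * x / Q) * e₂ ^ (b' * x / Q) * u ^ y) ^ Q := by
    rw [mul_zpow, ← zpow_mul, ← zpow_mul, red (a' * x), red (b' * x), mul_pow, mul_pow]
    simp only [mul_assoc, mul_left_comm]
  rw [← key]
  rcases hrel with h | h
  · left; rw [← h]; exact hu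
  · rcases Int.even_or_odd x with hx | hx
    · left; rw [← hx.neg_zpow, ← h]; exact hu
    · right; rw [← neg_mul, ← hx.neg_zpow, ← h]; exact hu

lemma one_add_pow_eq {R : Type*} [CommRing R] (y : R) (n : ℕ) :
    ∃ w, (1 + y) ^ n = 1 + n * y + (n.choose 2 : ℕ) * y ^ 2 + y ^ 3 * w := by
  induction n with
  | zero => exact ⟨0, by simp⟩
  | succ n ih =>
    obtain ⟨w, hw⟩ := ih
    refine ⟨(n.choose 2 : ℕ) + w * (1 + y), ?_⟩
    rw [pow_succ, hw, Nat.choose_succ_succ' n 1, Nat.choose_one_right]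
    push_cast
    ring

lemma pow_prime_pow_eq {R : Type*} [CommRing R] {p : ℕ} (hp : Odd p) (a b : R) (n : ℕ) :
    ∃ c, (1 + p * a + p ^ 2 * b) ^ p ^ n = 1 + p ^ (n + 1) * a + p ^ (n + 2) * c := by
  induction n with
  | zero => exact ⟨b, by simp⟩
  | succ n ih =>
    obtain ⟨c, hc⟩ := ih
    obtain ⟨k, hk⟩ := hp
    have hch : p.choose 2 = p * k := by
      rw [Nat.choose_two_right, hk, Nat.add_sub_cancel, ← mul_assoc, mul_right_comm,
        mul_comm _ 2,
        Nat.mul_div_cancel_left _ two_pos]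
    obtain ⟨w, hw⟩ := one_add_pow_eq (p ^ (n + 1) * a + p ^ (n + 2) * c : R) p
    refine ⟨c + k * p ^ n * (a + p * c) ^ 2 + p ^ (2 * n) * (a + p * c) ^ 3 * w, ?_⟩
    rw [pow_succ p n, pow_mul, hc, add_assoc, hw, hch]
    push_cast
    ring

/-- Skolem's argument: a solution `u` of two linear equations, lying in the coset of a solution
`u₀` under a subgroup of units congruent to `1` modulo `p`, equals `± u₀` as soon as the
linearized system is nonsingular modulo `p`. -/
lemma eq_or_eq_neg_of_descent {R : Type*} [CommRing R] {p L : ℕ} (hp : p.Prime) (hodd : Odd p)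
    (f g : R →+ ℤ) (hsep : ∀ x : R, (∀ n : ℕ, (p : R) ^ n ∣ x) → x = 0)
    (u u₀ η₁ η₂ : Rˣ) (A₁ A₂ B₁ B₂ : R) (h₁ : (η₁ : R) = 1 + p * A₁ + p ^ 2 * B₁)
    (h₂ : (η₂ : R) = 1 + p * A₂ + p ^ 2 * B₂)
    (hL : ∀ v : Rˣ, (p : R) ∣ v ^ L - 1)
    (hrep : ∀ v : Rˣ, ∃ (a b : ℕ) (v' : Rˣ), v ^ L = η₁ ^ a * η₂ ^ b * v' ^ (L * p))
    (hdet : ¬ (p : ℤ) ∣ f (u₀ * A₁) * g (u₀ * A₂) - f (u₀ * A₂) * g (u₀ * A₁))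
    (hf₀ : f u₀ = 0) (hg₀ : g u₀ = 0) (hf : f u = 0) (hg : g u = 0)
    (hstart : ∃ (a b : ℕ) (v : Rˣ), u = u₀ * (η₁ ^ a * η₂ ^ b * v ^ (L * p)) ∨
      u = -(u₀ * (η₁ ^ a * η₂ ^ b * v ^ (L * p)))) : u = u₀ ∨ u = -u₀ := by
  have hp0 : (p : ℤ) ≠ 0 := by exact_mod_cast hp.ne_zero
  have expand (a b : ℕ) (v : Rˣ) : ∃ c : R, ((η₁ ^ a * η₂ ^ b * v ^ (L * p) : Rˣ) : R) =
      1 + p * (a * A₁ + b * A₂) + p ^ 2 * c := by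
    have aux (A B : R) (a : ℕ) :
        ∃ c, (1 + p * A + p ^ 2 * B) ^ a = 1 + p * (a * A) + p ^ 2 * c := by
      obtain ⟨w, hw⟩ := one_add_pow_eq (p * A + p ^ 2 * B) a
      exact ⟨a * B + (a.choose 2 : ℕ) * (A + p * B) ^ 2 + p * (A + p * B) ^ 3 * w, by
        rw [add_assoc, hw]; ring⟩
    obtain ⟨c₁, k₁⟩ := aux A₁ B₁ a
    obtain ⟨c₂, k₂⟩ := aux A₂ B₂ b
    obtain ⟨w, hw⟩ := hL v
    obtain ⟨c₃, k₃⟩ := aux w 0 p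
    have k₄ : ((v : R) ^ L) ^ p = 1 + p ^ 2 * (w + c₃) := by
      rw [← sub_add_cancel ((v : R) ^ L) 1, hw,
        show (p : R) * w + 1 = 1 + p * w + p ^ 2 * 0 by ring, k₃]
      ring
    push_cast
    rw [pow_mul, k₄, h₁, h₂, k₁, k₂]
    exact ⟨c₁ + c₂ + (a * A₁ + p * c₁) * (b * A₂ + p * c₂) + (w + c₃) *
      ((1 + p * (a * A₁) + p ^ 2 * c₁) * (1 + p * (b * A₂) + p ^ 2 * c₂)), by ring⟩
  have main (n : ℕ) : ∃ (a b : ℕ) (v : Rˣ),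
      u = u₀ * (η₁ ^ a * η₂ ^ b * v ^ (L * p)) ^ p ^ n ∨
      u = -(u₀ * (η₁ ^ a * η₂ ^ b * v ^ (L * p)) ^ p ^ n) := by
    induction n with
    | zero => simpa using hstart
    | succ n ih =>
      obtain ⟨a, b, v, hu⟩ := ih
      obtain ⟨c, hc⟩ := expand a b v
      obtain ⟨d, hd⟩ := pow_prime_pow_eq hodd (a * A₁ + b * A₂) c n
      rw [← hc] at hd
      have lin (h : R →+ ℤ) (h0 : h u₀ = 0) (hu' : h u = 0) :
          (p : ℤ) ∣ a * h (u₀ * A₁) + b * h (u₀ * A₂) := by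
        have e : h (u₀ * ((η₁ ^ a * η₂ ^ b * v ^ (L * p) : Rˣ) : R) ^ p ^ n) = 0 := by
          rcases hu with hu | hu
          · rw [← hu']; conv_rhs => rw [hu]
            push_cast; rfl
          · rw [← neg_eq_zero, ← map_neg, ← hu']; conv_rhs => rw [hu]
            push_cast; rfl
        rw [hd] at e
        have e2 : (u₀ : R) * (1 + p ^ (n + 1) * (a * A₁ + b * A₂) + p ^ (n + 2) * d) =
            u₀ + p ^ (n + 1) • (a • (u₀ * A₁) + b • (u₀ * A₂) + p • (u₀ * d)) := by
          simp only [nsmul_eq_mul]; push_cast; ring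
        rw [e2, map_add, map_nsmul, map_add, map_add, map_nsmul, map_nsmul, map_nsmul, h0, zero_add,
          smul_eq_zero] at e
        have e3 := e.resolve_left (pow_ne_zero _ hp.ne_zero)
        simp only [nsmul_eq_mul] at e3
        exact ⟨-h (u₀ * d), by linear_combination e3⟩
      have l1 := lin f hf₀ hf
      have l2 := lin g hg₀ hg
      have hpp := Nat.prime_iff_prime_int.1 hp
      have ha : (p : ℤ) ∣ a := by
        refine (hpp.dvd_or_dvd ?_).resolve_right hdet
        have := (l1.mul_right (g (u₀ * A₂))).sub (l2.mul_right (f (u₀ * A₂)))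
        refine this.trans (dvd_of_eq ?_)
        ring
      have hb : (p : ℤ) ∣ b := by
        refine (hpp.dvd_or_dvd ?_).resolve_right hdet
        have := (l2.mul_right (f (u₀ * A₁))).sub (l1.mul_right (g (u₀ * A₁)))
        refine this.trans (dvd_of_eq ?_)
        ring
      obtain ⟨a', rfl⟩ := Int.natCast_dvd_natCast.1 ha
      obtain ⟨b', rfl⟩ := Int.natCast_dvd_natCast.1 hb
      obtain ⟨a₁, b₁, v', hv'⟩ := hrep v
      have key : (η₁ ^ (p * a') * η₂ ^ (p * b') * v ^ (L * p)) ^ p ^ n =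
          (η₁ ^ (a' + a₁) * η₂ ^ (b' + b₁) * v' ^ (L * p)) ^ p ^ (n + 1) := by
        rw [pow_succ' p n, pow_mul (η₁ ^ (a' + a₁) * η₂ ^ (b' + b₁) * v' ^ (L * p)) p]
        congr 1
        rw [pow_mul v, hv', mul_comm p a', mul_comm p b', pow_mul, pow_mul η₂, ← mul_pow, ← mul_pow,
          pow_add, pow_add]
        congr 1
        simp only [mul_assoc, mul_left_comm]
      refine ⟨a' + a₁, b' + b₁, v', ?_⟩
      rwa [← key]
  have near (n : ℕ) : (p : R) ^ n ∣ u - u₀ ∨ (p : R) ^ n ∣ u + u₀ := by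
    obtain ⟨a, b, v, hu⟩ := main n
    obtain ⟨c, hc⟩ := expand a b v
    obtain ⟨d, hd⟩ := pow_prime_pow_eq hodd (a * A₁ + b * A₂) c n
    rw [← hc] at hd
    rcases hu with hu | hu
    · left
      refine ⟨u₀ * (p * (a * A₁ + b * A₂) + p ^ 2 * d), ?_⟩
      rw [hu]; push_cast at hd ⊢; rw [hd]; ring
    · right
      refine ⟨-u₀ * (p * (a * A₁ + b * A₂) + p ^ 2 * d), ?_⟩
      rw [hu]; push_cast at hd ⊢; rw [hd]; ring
  by_contra! hcon
  have c1 : ∃ n : ℕ, ¬ (p : R) ^ n ∣ u - u₀ := by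
    by_contra! h
    exact hcon.1 (Units.ext (sub_eq_zero.1 (hsep _ h)))
  have c2 : ∃ n : ℕ, ¬ (p : R) ^ n ∣ u + u₀ := by
    by_contra! h
    exact hcon.2 (Units.ext (by rw [Units.val_neg]; exact eq_neg_of_add_eq_zero_left (hsep _ h)))
  obtain ⟨n₁, k₁⟩ := c1
  obtain ⟨n₂, k₂⟩ := c2
  rcases near (n₁ + n₂) with h | h
  · exact k₁ ((pow_dvd_pow _ (Nat.le_add_right _ _)).trans h)
  · exact k₂ ((pow_dvd_pow _ (Nat.le_add_left _ _)).trans h)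

namespace QuarticOrder

variable {N Y : ℤ}

lemma coords_intCast_mul (m : ℤ) (x : QuarticOrder N Y) :
    (m * x : QuarticOrder N Y) = ⟨m * x.c0, m * x.c1, m * x.c2, m * x.c3⟩ := by
  rw [← zsmul_eq_mul]
  apply (coords N Y).injective
  rw [map_zsmul]
  ext i
  fin_cases i <;> exact smul_eq_mul _ _

lemma intCast_dvd_iff {m : ℤ} {x : QuarticOrder N Y} :
    (m : QuarticOrder N Y) ∣ x ↔ m ∣ x.c0 ∧ m ∣ x.c1 ∧ m ∣ x.c2 ∧ m ∣ x.c3 := by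
  constructor
  · rintro ⟨y, rfl⟩
    rw [coords_intCast_mul]
    simp
  · rintro ⟨⟨a, ha⟩, ⟨b, hb⟩, ⟨c, hc⟩, ⟨d, hd⟩⟩
    refine ⟨⟨a, b, c, d⟩, ?_⟩
    rw [coords_intCast_mul]
    ext <;> assumption

lemma eq_zero_of_forall_pow_dvd {p : ℕ} (hp : 1 < p) (x : QuarticOrder N Y)
    (h : ∀ n : ℕ, (p : QuarticOrder N Y) ^ n ∣ x) : x = 0 := by
  have key (c : ℤ) (hc : ∀ n : ℕ, (p : ℤ) ^ n ∣ c) : c = 0 := by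
    by_contra h0
    have h1 := Int.natAbs_dvd_natAbs.2 (hc c.natAbs)
    rw [Int.natAbs_pow, Int.natAbs_natCast] at h1
    exact absurd (Nat.le_of_dvd (Int.natAbs_pos.2 h0) h1)
      (not_le.2 (Nat.lt_pow_self hp))
  have h' (n : ℕ) := intCast_dvd_iff.1 (by simpa using h n : (((p : ℤ) ^ n : ℤ) :
    QuarticOrder N Y) ∣ x)
  ext
  · exact key _ fun n => (h' n).1
  · exact key _ fun n => (h' n).2.1
  · exact key _ fun n => (h' n).2.2.1
  · exact key _ fun n => (h' n).2.2.2

/-- Coordinatewise reduction. -/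
def redMod (m : ℤ) (x : QuarticOrder N Y) : QuarticOrder N Y :=
  ⟨x.c0 % m, x.c1 % m, x.c2 % m, x.c3 % m⟩

lemma dvd_redMod_sub (m : ℤ) (x : QuarticOrder N Y) : (m : QuarticOrder N Y) ∣ redMod m x - x := by
  rw [intCast_dvd_iff]
  refine ⟨?_, ?_, ?_, ?_⟩ <;> exact (Int.mod_modEq _ _).symm.dvd

/-- `x ^ p ≡ x` modulo `p` as soon as this holds for the two generators. -/
lemma dvd_pow_prime_sub {p : ℕ} (hp : p.Prime)
    (hα : (p : QuarticOrder N Y) ∣ ⟨0, 1, 0, 0⟩ ^ p - ⟨0, 1, 0, 0⟩)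
    (hδ : (p : QuarticOrder N Y) ∣ ⟨0, 0, 1, 0⟩ ^ p - ⟨0, 0, 1, 0⟩) (x : QuarticOrder N Y) :
    (p : QuarticOrder N Y) ∣ x ^ p - x := by
  have hadd (x y : QuarticOrder N Y) (hx : (p : QuarticOrder N Y) ∣ x ^ p - x)
      (hy : (p : QuarticOrder N Y) ∣ y ^ p - y) :
      (p : QuarticOrder N Y) ∣ (x + y) ^ p - (x + y) := by
    obtain ⟨r, hr⟩ := exists_add_pow_prime_eq hp x y
    rw [hr]
    have := (hx.add hy).add (Dvd.intro (x * y * r) rfl : (p : QuarticOrder N Y) ∣ p * (x * y * r))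
    refine this.trans (dvd_of_eq ?_)
    ring
  have hmul (x y : QuarticOrder N Y) (hx : (p : QuarticOrder N Y) ∣ x ^ p - x)
      (hy : (p : QuarticOrder N Y) ∣ y ^ p - y) :
      (p : QuarticOrder N Y) ∣ (x * y) ^ p - (x * y) := by
    have := (hx.mul_right (y ^ p)).add (hy.mul_left x)
    refine this.trans (dvd_of_eq ?_)
    ring
  have hcast (c : ℤ) : (p : QuarticOrder N Y) ∣ (c : QuarticOrder N Y) ^ p - c := by
    have : Fact p.Prime := ⟨hp⟩
    have h : (p : ℤ) ∣ c ^ p - c := by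
      rw [← ZMod.intCast_zmod_eq_zero_iff_dvd]
      push_cast
      rw [ZMod.pow_card, sub_self]
    obtain ⟨d, hd⟩ := h
    exact ⟨d, by exact_mod_cast congrArg (Int.cast : ℤ → QuarticOrder N Y) hd⟩
  have hx : x = x.c0 + x.c1 * ⟨0, 1, 0, 0⟩ + x.c2 * ⟨0, 0, 1, 0⟩
      + x.c3 * (⟨0, 1, 0, 0⟩ * ⟨0, 0, 1, 0⟩) := by
    have h1 : ((x.c0 : ℤ) : QuarticOrder N Y) = x.c0 * 1 := by simp
    rw [h1]
    simp only [coords_intCast_mul]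
    ext <;> simp [c0_mul, c1_mul, c2_mul, c3_mul]
  rw [hx]
  exact hadd _ _ (hadd _ _ (hadd _ _ (hcast _) (hmul _ _ (hcast _) hα)) (hmul _ _ (hcast _) hδ))
    (hmul _ _ (hcast _) (hmul _ _ hα hδ))

lemma dvd_unit_pow_sub_one {p : ℕ} (hp : p.Prime)
    (hα : (p : QuarticOrder N Y) ∣ ⟨0, 1, 0, 0⟩ ^ p - ⟨0, 1, 0, 0⟩)
    (hδ : (p : QuarticOrder N Y) ∣ ⟨0, 0, 1, 0⟩ ^ p - ⟨0, 0, 1, 0⟩) (v : (QuarticOrder N Y)ˣ) :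
    (p : QuarticOrder N Y) ∣ v ^ (p - 1) - 1 := by
  have h := (dvd_pow_prime_sub hp hα hδ v).mul_right (v⁻¹ : (QuarticOrder N Y)ˣ)
  refine h.trans (dvd_of_eq ?_)
  obtain ⟨n, rfl⟩ := Nat.exists_eq_succ_of_ne_zero hp.ne_zero
  rw [Nat.succ_sub_one, pow_succ, sub_mul, mul_assoc, Units.mul_inv, mul_one]

/-- Evaluation of a natural number before passing it on; this controls sharing when the kernel
reduces the functions below. -/
def force (n : ℕ) (k : ℕ → Bool) : Bool := Nat.rec (k 0) (fun m _ => k (Nat.succ m)) n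

lemma force_eq (n : ℕ) (k : ℕ → Bool) : force n k = k n := by cases n <;> rfl

/-- Four residues. -/
structure Residues where
  r0 : ℕ
  r1 : ℕ
  r2 : ℕ
  r3 : ℕ

namespace Residues

/-- The dot product of two vectors of residues is nonzero modulo `p`. -/
def dotNeZero (p : ℕ) (r x : Residues) : Bool :=
  not (Nat.beq (Nat.mod (Nat.add (Nat.add (Nat.mul x.r0 r.r0) (Nat.mul x.r1 r.r1))
    (Nat.add (Nat.mul x.r2 r.r2) (Nat.mul x.r3 r.r3))) p) 0)

lemma dotNeZero_eq_false {p : ℕ} {r x : Residues}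
    (h : (p : ℤ) ∣ x.r0 * r.r0 + x.r1 * r.r1 + x.r2 * r.r2 + x.r3 * r.r3) :
    dotNeZero p r x = false := by
  have hdvd : p ∣ x.r0 * r.r0 + x.r1 * r.r1 + (x.r2 * r.r2 + x.r3 * r.r3) := by
    zify
    refine h.trans (dvd_of_eq ?_)
    ring
  rw [dotNeZero, Bool.not_eq_false']
  exact Nat.beq_eq.symm ▸ Nat.mod_eq_zero_of_dvd hdvd

/-- The element with the given coordinates. -/
def toOrder (r : Residues) : QuarticOrder N Y :=
  ⟨Int.ofNat r.r0, Int.ofNat r.r1, Int.ofNat r.r2, Int.ofNat r.r3⟩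

/-- Reduction of four integers. -/
def ofInts (p : ℕ) (a b c d : ℤ) : Residues :=
  ⟨(a % p).toNat, (b % p).toNat, (c % p).toNat, (d % p).toNat⟩

/-- Evaluated version of `ofInts`. -/
def forceInts (p : ℕ) (a b c d : ℤ) (k : Residues → Bool) : Bool :=
  force (a % p).toNat fun a => force (b % p).toNat fun b => force (c % p).toNat fun c =>
    force (d % p).toNat fun d => k ⟨a, b, c, d⟩

lemma forceInts_eq (p : ℕ) (a b c d : ℤ) (k : Residues → Bool) :
    forceInts p a b c d k = k (ofInts p a b c d) := by
  simp only [forceInts, force_eq, ofInts]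

end Residues

open Residues

/-- The linear form `c2 (x * ·)` modulo `p`. -/
def form2 (p : ℕ) (x : QuarticOrder N Y) : Residues :=
  ofInts p x.c2 (⟨0, 1, 0, 0⟩ * x).c2 (⟨0, 0, 1, 0⟩ * x).c2 (⟨0, 0, 0, 1⟩ * x).c2

/-- The linear form `c3 (x * ·)` modulo `p`. -/
def form3 (p : ℕ) (x : QuarticOrder N Y) : Residues :=
  ofInts p x.c3 (⟨0, 1, 0, 0⟩ * x).c3 (⟨0, 0, 1, 0⟩ * x).c3 (⟨0, 0, 0, 1⟩ * x).c3

/-- The table of linear forms attached to `x, x * e, …, x * e ^ (n - 1)`. -/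
def forms (p : ℕ) (e : QuarticOrder N Y) : ℕ → ℕ → QuarticOrder N Y →
    List (ℕ × Residues × Residues) → List (ℕ × Residues × Residues)
  | 0, _, _, l => l
  | n + 1, j, x, l => forms p e n (j + 1)
      (ofInts p (x * e).c0 (x * e).c1 (x * e).c2 (x * e).c3).toOrder
      ((j, form2 p x, form3 p x) :: l)

/-- Evaluated version of `forms`. -/
def forceForms (p : ℕ) (e : QuarticOrder N Y) : ℕ → ℕ → QuarticOrder N Y →
    List (ℕ × Residues × Residues) → (List (ℕ × Residues × Residues) → Bool) → Bool
  | 0, _, _, l, k => k l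
  | n + 1, j, x, l, k =>
    forceInts p (x * e).c0 (x * e).c1 (x * e).c2 (x * e).c3 fun y =>
    forceInts p x.c2 (⟨0, 1, 0, 0⟩ * x).c2 (⟨0, 0, 1, 0⟩ * x).c2 (⟨0, 0, 0, 1⟩ * x).c2 fun r =>
    forceInts p x.c3 (⟨0, 1, 0, 0⟩ * x).c3 (⟨0, 0, 1, 0⟩ * x).c3 (⟨0, 0, 0, 1⟩ * x).c3 fun s =>
    forceForms p e n (j + 1) y.toOrder ((j, r, s) :: l) k

lemma forceForms_eq (p : ℕ) (e : QuarticOrder N Y) (n j : ℕ) (x : QuarticOrder N Y)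
    (l : List (ℕ × Residues × Residues)) (k : List (ℕ × Residues × Residues) → Bool) :
    forceForms p e n j x l k = k (forms p e n j x l) := by
  induction n generalizing j x l with
  | zero => rfl
  | succ n ih => simp only [forceForms, forceInts_eq, ih, forms, form2, form3]

/-- Every pair of forms in the table fails to vanish simultaneously at `x`, or is exempt. -/
def rowSieve (p : ℕ) (x : Residues) (T : ℕ → Bool) : List (ℕ × Residues × Residues) → Bool
  | [] => true
  | (j, r, s) :: l => (dotNeZero p r x || (dotNeZero p s x || T j)) && rowSieve p x T l

/-- `rowSieve` for `x, x * e, …, x * e ^ (n - 1)`. -/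
def colSieve (p : ℕ) (e : QuarticOrder N Y) (T : ℕ → ℕ → Bool)
    (l : List (ℕ × Residues × Residues)) : ℕ → ℕ → QuarticOrder N Y → Bool
  | 0, _, _ => true
  | n + 1, i, x => forceInts p x.c0 x.c1 x.c2 x.c3 fun y =>
      rowSieve p y (T i) l && colSieve p e T l n (i + 1) (y.toOrder * e)

/-- The sieve over the products `ρ * e₁ ^ i * e₂ ^ j`, with exemptions `T`. -/
def sieve (p : ℕ) (ρ e₁ e₂ : QuarticOrder N Y) (o₁ o₂ : ℕ) (T : ℕ → ℕ → Bool) : Bool :=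
  forceForms p e₂ o₂ 0 1 [] fun l => colSieve p e₁ T l o₁ 0 ρ

lemma dvd_toOrder_sub (p : ℕ) (hp : 0 < p) (x : QuarticOrder N Y) :
    (p : QuarticOrder N Y) ∣ (ofInts p x.c0 x.c1 x.c2 x.c3).toOrder - x := by
  have hp' : (p : ℤ) ≠ 0 := by exact_mod_cast hp.ne'
  have h := dvd_redMod_sub (p : ℤ) x
  convert h using 1
  · simp
  · congr 1
    ext <;> exact Int.toNat_of_nonneg (Int.emod_nonneg _ hp')

lemma mem_forms_of_mem (p : ℕ) (e : QuarticOrder N Y) (n j : ℕ) (x : QuarticOrder N Y)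
    (l : List (ℕ × Residues × Residues)) (t : ℕ × Residues × Residues) (ht : t ∈ l) :
    t ∈ forms p e n j x l := by
  induction n generalizing j x l with
  | zero => exact ht
  | succ n ih => exact ih _ _ _ (List.mem_cons_of_mem _ ht)

lemma exists_mem_forms (p : ℕ) (hp : 0 < p) (e : QuarticOrder N Y) (n j : ℕ)
    (x : QuarticOrder N Y) (l : List (ℕ × Residues × Residues)) (m : ℕ) (hm : m < n) :
    ∃ x' : QuarticOrder N Y, (p : QuarticOrder N Y) ∣ x' - x * e ^ m ∧
      (j + m, form2 p x', form3 p x') ∈ forms p e n j x l := by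
  induction n generalizing j x l m with
  | zero => omega
  | succ n ih =>
    rcases m with _ | m
    · exact ⟨x, by simp, mem_forms_of_mem p e n _ _ _ _ List.mem_cons_self⟩
    · obtain ⟨x', h1, h2⟩ := ih (j + 1)
        (ofInts p (x * e).c0 (x * e).c1 (x * e).c2 (x * e).c3).toOrder
        ((j, form2 p x, form3 p x) :: l) m (by omega)
      refine ⟨x', ?_, ?_⟩
      · refine (h1.add ((dvd_toOrder_sub p hp (x * e)).mul_right (e ^ m))).trans (dvd_of_eq ?_)
        ring
      · rw [add_right_comm, add_assoc] at h2
        exact h2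

lemma rowSieve_spec {p : ℕ} {x : Residues} {T : ℕ → Bool} {l : List (ℕ × Residues × Residues)}
    (h : rowSieve p x T l = true) {t : ℕ × Residues × Residues} (ht : t ∈ l) :
    dotNeZero p t.2.1 x = true ∨ dotNeZero p t.2.2 x = true ∨ T t.1 = true := by
  induction l with
  | nil => simp at ht
  | cons s l ih =>
    obtain ⟨j, r, s⟩ := s
    rw [rowSieve, Bool.and_eq_true, Bool.or_eq_true, Bool.or_eq_true] at h
    rcases List.mem_cons.1 ht with rfl | ht
    · exact h.1
    · exact ih h.2 ht

lemma colSieve_spec {p : ℕ} (hp : 0 < p) (e : QuarticOrder N Y) (T : ℕ → ℕ → Bool)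
    (l : List (ℕ × Residues × Residues)) (n i : ℕ) (x : QuarticOrder N Y)
    (h : colSieve p e T l n i x = true) (m : ℕ) (hm : m < n) :
    ∃ y : Residues, (p : QuarticOrder N Y) ∣ y.toOrder - x * e ^ m ∧
      rowSieve p y (T (i + m)) l = true := by
  induction n generalizing i x m with
  | zero => omega
  | succ n ih =>
    rw [colSieve, forceInts_eq, Bool.and_eq_true] at h
    have h0 := dvd_toOrder_sub p hp x
    rcases m with _ | m
    · exact ⟨_, by simpa using h0, h.1⟩
    · obtain ⟨y, h1, h2⟩ := ih _ _ h.2 m (by omega)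
      refine ⟨y, ?_, ?_⟩
      · refine (h1.add (h0.mul_right (e ^ (m + 1)))).trans (dvd_of_eq ?_)
        ring
      · rw [add_right_comm, add_assoc] at h2
        exact h2

lemma dotNeZero_ofInts {p : ℕ} (hp : 0 < p) (y : Residues) (a b c d : ℤ)
    (h : (p : ℤ) ∣ y.r0 * a + y.r1 * b + y.r2 * c + y.r3 * d) :
    dotNeZero p (ofInts p a b c d) y = false := by
  apply dotNeZero_eq_false
  have hp' : (p : ℤ) ≠ 0 := by exact_mod_cast hp.ne'
  simp only [ofInts, Int.toNat_of_nonneg (Int.emod_nonneg _ hp')]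
  refine (Int.modEq_zero_iff_dvd).1 (Int.ModEq.trans ?_ (Int.modEq_zero_iff_dvd.2 h))
  have k (r : ℕ) (a : ℤ) : r * (a % p) ≡ r * a [ZMOD p] := (Int.mod_modEq a p).mul_left _
  exact (((k _ a).add (k _ b)).add (k _ c)).add (k _ d)

lemma dotNeZero_form2 {p : ℕ} (hp : 0 < p) (y : Residues) (x : QuarticOrder N Y)
    (h : (p : ℤ) ∣ (y.toOrder * x).c2) : dotNeZero p (form2 p x) y = false := by
  apply dotNeZero_ofInts hp
  refine h.trans (dvd_of_eq ?_)
  simp only [c2_mul, toOrder, Int.ofNat_eq_natCast]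
  ring

lemma dotNeZero_form3 {p : ℕ} (hp : 0 < p) (y : Residues) (x : QuarticOrder N Y)
    (h : (p : ℤ) ∣ (y.toOrder * x).c3) : dotNeZero p (form3 p x) y = false := by
  apply dotNeZero_ofInts hp
  refine h.trans (dvd_of_eq ?_)
  simp only [c3_mul, toOrder, Int.ofNat_eq_natCast]
  ring

lemma sieve_spec {p : ℕ} (hp : 0 < p) {ρ e₁ e₂ : QuarticOrder N Y} {o₁ o₂ : ℕ} {T : ℕ → ℕ → Bool}
    (h : sieve p ρ e₁ e₂ o₁ o₂ T = true) {i j : ℕ} (hi : i < o₁) (hj : j < o₂)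
    (h2 : (p : ℤ) ∣ (ρ * e₁ ^ i * e₂ ^ j).c2) (h3 : (p : ℤ) ∣ (ρ * e₁ ^ i * e₂ ^ j).c3) :
    T i j = true := by
  rw [sieve, forceForms_eq] at h
  obtain ⟨y, hy, hrow⟩ := colSieve_spec hp _ _ _ _ _ _ h i hi
  obtain ⟨x, hx, hmem⟩ := exists_mem_forms p hp e₂ o₂ 0 1 [] j hj
  have hrow' := rowSieve_spec hrow hmem
  rw [zero_add, zero_add] at hrow'
  have key : (p : QuarticOrder N Y) ∣ y.toOrder * x - ρ * e₁ ^ i * e₂ ^ j := by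
    refine ((hy.mul_right x).add (hx.mul_left (ρ * e₁ ^ i))).trans (dvd_of_eq ?_)
    ring
  obtain ⟨-, -, k2, k3⟩ := intCast_dvd_iff.1 (by simpa using key : ((p : ℤ) : QuarticOrder N Y) ∣ _)
  rw [c2_sub, dvd_sub_comm, dvd_sub_right h2] at k2
  rw [c3_sub, dvd_sub_comm, dvd_sub_right h3] at k3
  rw [dotNeZero_form2 hp y x k2, dotNeZero_form3 hp y x k3] at hrow'
  simpa using hrow'

end QuarticOrder

/-- No product of powers of `e₁` and `e₂` is up to sign an `ℓ`-th power, except the obvious ones. -/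
def SaturatedAt {R : Type*} [CommRing R] (e₁ e₂ : Rˣ) (ℓ : ℕ) : Prop :=
  ∀ (v : Rˣ) (a b : ℤ), (v ^ ℓ = e₁ ^ a * e₂ ^ b ∨ v ^ ℓ = -(e₁ ^ a * e₂ ^ b)) →
    (ℓ : ℤ) ∣ a ∧ (ℓ : ℤ) ∣ b

lemma SaturatedAt.of_reduced {R : Type*} [CommRing R] {e₁ e₂ : Rˣ} {ℓ : ℕ} (hℓ : 0 < ℓ)
    (h : ∀ (v : Rˣ) (a b : ℕ), a < ℓ → b < ℓ →
      (v ^ ℓ = e₁ ^ a * e₂ ^ b ∨ v ^ ℓ = -(e₁ ^ a * e₂ ^ b)) → a = 0 ∧ b = 0) :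
    SaturatedAt e₁ e₂ ℓ := by
  intro v a b hv
  have hℓ' : (0 : ℤ) < ℓ := by exact_mod_cast hℓ
  have red (c : ℤ) (e : Rˣ) : e ^ c = e ^ (c % ℓ).toNat * (e ^ (c / ℓ)) ^ ℓ := by
    rw [← zpow_natCast, ← zpow_natCast, ← zpow_mul, ← zpow_add,
      Int.toNat_of_nonneg (Int.emod_nonneg _ hℓ'.ne'), mul_comm (c / ℓ), Int.emod_add_mul_ediv]
  have hlt (c : ℤ) : (c % ℓ).toNat < ℓ := by
    have := Int.emod_lt_of_pos c hℓ'
    have := Int.emod_nonneg c hℓ'.ne'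
    omega
  have hz := h (v * (e₁ ^ (a / ℓ) * e₂ ^ (b / ℓ))⁻¹) (a % ℓ).toNat (b % ℓ).toNat (hlt a) (hlt b) (by
    rw [mul_pow, inv_pow, mul_inv_eq_iff_eq_mul, mul_inv_eq_iff_eq_mul, mul_pow]
    have e : e₁ ^ a * e₂ ^ b = e₁ ^ (a % ℓ).toNat * e₂ ^ (b % ℓ).toNat *
        ((e₁ ^ (a / ℓ)) ^ ℓ * (e₂ ^ (b / ℓ)) ^ ℓ) := by
      rw [red a, red b]
      exact mul_mul_mul_comm _ _ _ _
    rwa [neg_mul, ← e])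
  have k (c : ℤ) (hc : (c % ℓ).toNat = 0) : (ℓ : ℤ) ∣ c := by
    have := Int.emod_nonneg c hℓ'.ne'
    exact Int.dvd_of_emod_eq_zero (by omega)
  exact ⟨k a hz.1, k b hz.2⟩

namespace QuarticOrder

variable {N Y : ℤ}

/-- A ring homomorphism to `ZMod q` given by the images `r`, `d` of the generators, together with
the values at two units of the power residue character it induces. -/
structure ResidueChar where
  q : ℕ
  r : ℤ
  d : ℤ
  x₁ : ℕ
  x₂ : ℕ

/-- Correctness of the data of a `ResidueChar` of order `ℓ`. -/
def ResidueChar.Valid (e₁ e₂ : QuarticOrder N Y) (ℓ : ℕ) (c : ResidueChar) : Prop :=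
  c.q.Prime ∧ ℓ ∣ c.q - 1 ∧ (c.q : ℤ) ∣ c.r ^ 2 - 3 * c.d ∧
  (c.q : ℤ) ∣ c.d ^ 2 - (6 * N * c.d + 4 * Y * c.r + (3 * N ^ 2 - 4)) ∧
  ((e₁.c0 + e₁.c1 * c.r + e₁.c2 * c.d + e₁.c3 * (c.r * c.d)) % c.q).toNat ^ ((c.q - 1) / ℓ) % c.q
    = c.x₁ ∧
  ((e₂.c0 + e₂.c1 * c.r + e₂.c2 * c.d + e₂.c3 * (c.r * c.d)) % c.q).toNat ^ ((c.q - 1) / ℓ) % c.q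
    = c.x₂

instance (e₁ e₂ : QuarticOrder N Y) (ℓ : ℕ) (c : ResidueChar) : Decidable (c.Valid e₁ e₂ ℓ) := by
  unfold ResidueChar.Valid
  infer_instance

lemma ResidueChar.Valid.eq_one {e₁ e₂ v : (QuarticOrder N Y)ˣ} {ℓ a b : ℕ} {c : ResidueChar}
    (h : c.Valid (e₁ : QuarticOrder N Y) (e₂ : QuarticOrder N Y) ℓ) :
    (v ^ ℓ = e₁ ^ a * e₂ ^ b → c.x₁ ^ a * c.x₂ ^ b % c.q = 1) ∧
    (v ^ ℓ = -(e₁ ^ a * e₂ ^ b) →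
      (c.q - 1) ^ ((c.q - 1) / ℓ) * (c.x₁ ^ a * c.x₂ ^ b) % c.q = 1) := by
  obtain ⟨hq, hℓ, h1, h2, k1, k2⟩ := h
  have : Fact c.q.Prime := ⟨hq⟩
  set m := (c.q - 1) / ℓ with hm
  have hmul : ℓ * m = c.q - 1 := Nat.mul_div_cancel' hℓ
  have hq0 : (c.q : ℤ) ≠ 0 := by exact_mod_cast hq.ne_zero
  rw [← ZMod.intCast_zmod_eq_zero_iff_dvd] at h1 h2
  push_cast at h1 h2
  let φ : QuarticOrder N Y →+* ZMod c.q :=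
    lift (c.r : ZMod c.q) c.d (sub_eq_zero.1 h1) (sub_eq_zero.1 h2)
  have hφ (x : QuarticOrder N Y) (y : ℕ) (hy : ((x.c0 + x.c1 * c.r + x.c2 * c.d +
      x.c3 * (c.r * c.d)) % c.q).toNat ^ m % c.q = y) : (φ x) ^ m = (y : ZMod c.q) := by
    rw [← hy, ZMod.natCast_mod]
    push_cast
    congr 1
    have e := Int.toNat_of_nonneg (Int.emod_nonneg (x.c0 + x.c1 * c.r + x.c2 * c.d +
      x.c3 * (c.r * c.d)) hq0)
    rw [← Int.cast_natCast (R := ZMod c.q), e, ZMod.intCast_mod]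
    push_cast
    rfl
  have l1 := hφ _ _ k1
  have l2 := hφ _ _ k2
  have hv : (φ v) ^ (ℓ * m) = 1 := by
    rw [hmul]
    have := ZMod.units_pow_card_sub_one_eq_one c.q (Units.map φ.toMonoidHom v)
    exact congrArg Units.val this
  have fin (n : ℕ) (hn : (n : ZMod c.q) = 1) : n % c.q = 1 := by
    rw [← Nat.cast_one, ZMod.natCast_eq_natCast_iff'] at hn
    rwa [Nat.mod_eq_of_lt hq.one_lt] at hn
  constructor
  · intro h
    apply fin
    have h' := congrArg (fun x : (QuarticOrder N Y)ˣ => (φ x) ^ m) h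
    simp only [Units.val_pow_eq_pow_val, Units.val_mul, map_pow, map_mul] at h'
    rw [← pow_mul, hv] at h'
    push_cast
    rw [h', mul_pow, ← pow_mul, ← pow_mul, mul_comm a, mul_comm b, pow_mul, pow_mul, l1, l2]
  · intro h
    apply fin
    have h' := congrArg (fun x : (QuarticOrder N Y)ˣ => (φ x) ^ m) h
    simp only [Units.val_pow_eq_pow_val, Units.val_mul, Units.val_neg, map_neg, map_pow, map_mul]
      at h'
    rw [← pow_mul, hv] at h'
    rw [neg_pow, mul_pow, ← pow_mul, ← pow_mul, mul_comm a, mul_comm b, pow_mul, pow_mul, l1,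
      l2] at h'
    push_cast [Nat.cast_sub hq.one_lt.le]
    rw [ZMod.natCast_self, zero_sub]
    exact h'.symm

lemma even_c1_c3_sq (x : QuarticOrder N Y) : 2 ∣ (x ^ 2).c1 ∧ 2 ∣ (x ^ 2).c3 := by
  rw [sq]
  constructor
  · exact ⟨x.c0 * x.c1 + 2 * Y * (3 * (x.c1 * x.c3 + x.c3 * x.c1) + x.c2 * x.c2 +
      18 * N * (x.c3 * x.c3)) + (3 * N ^ 2 - 4) * (x.c2 * x.c3), by rw [c1_mul]; ring⟩
  · exact ⟨x.c0 * x.c3 + x.c1 * x.c2 + 6 * N * (x.c2 * x.c3) + 6 * Y * (x.c3 * x.c3), by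
      rw [c3_mul]; ring⟩

/-- The element has an odd coordinate obstructing it from being a square. -/
def OddCoord (x : QuarticOrder N Y) : Prop := ¬ (2 ∣ x.c1 ∧ 2 ∣ x.c3)

instance (x : QuarticOrder N Y) : Decidable (OddCoord x) := by
  unfold OddCoord
  infer_instance

/-- The characters in the list exclude all nontrivial classes modulo `ℓ`-th powers. -/
def Separating (e₁ e₂ : QuarticOrder N Y) (ℓ : ℕ) (l : List ResidueChar) : Prop :=
  ∀ a ∈ List.range ℓ, ∀ b ∈ List.range ℓ, (a = 0 ∧ b = 0) ∨ (ℓ = 2 ∧ a = 1 ∧ b = 0 ∧ OddCoord e₁) ∨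
    (ℓ = 2 ∧ a = 0 ∧ b = 1 ∧ OddCoord e₂) ∨ ((∃ c ∈ l, c.x₁ ^ a * c.x₂ ^ b % c.q ≠ 1) ∧
      ∃ c ∈ l, (c.q - 1) ^ ((c.q - 1) / ℓ) * (c.x₁ ^ a * c.x₂ ^ b) % c.q ≠ 1)

instance (e₁ e₂ : QuarticOrder N Y) (ℓ : ℕ) (l : List ResidueChar) :
    Decidable (Separating e₁ e₂ ℓ l) := by
  unfold Separating
  infer_instance

lemma SaturatedAt.of_separating {e₁ e₂ : (QuarticOrder N Y)ˣ} {ℓ : ℕ} (hℓ : 0 < ℓ)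
    {l : List ResidueChar} (hl : ∀ c ∈ l, c.Valid (e₁ : QuarticOrder N Y) (e₂ : QuarticOrder N Y) ℓ)
    (hsep : Separating (e₁ : QuarticOrder N Y) (e₂ : QuarticOrder N Y) ℓ l) :
    SaturatedAt e₁ e₂ ℓ := by
  refine SaturatedAt.of_reduced hℓ fun v a b ha hb hv => ?_
  have odd (e : (QuarticOrder N Y)ˣ) (he : OddCoord (e : QuarticOrder N Y))
      (h : v ^ 2 = e ∨ v ^ 2 = -e) : False := by
    apply he
    have h2 := even_c1_c3_sq (v : QuarticOrder N Y)
    rcases h with h | h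
    · rw [← h]
      exact h2
    · rw [← neg_eq_iff_eq_neg] at h
      rw [← h]
      simpa using h2
  rcases hsep a (List.mem_range.2 ha) b (List.mem_range.2 hb) with
    h | ⟨rfl, rfl, rfl, h⟩ | ⟨rfl, rfl, rfl, h⟩ | ⟨⟨c, hc, h1⟩, c', hc', h2⟩
  · exact h
  · exact (odd _ h (by simpa using hv)).elim
  · exact (odd _ h (by simpa using hv)).elim
  · rcases hv with hv | hv
    · exact (h1 ((hl c hc).eq_one.1 hv)).elim
    · exact (h2 ((hl c' hc').eq_one.2 hv)).elim

/-- A family of saturation certificates for all prime divisors of `n`. -/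
def SaturationCert (e₁ e₂ : QuarticOrder N Y) (n : ℕ) (l : List (ℕ × List ResidueChar)) : Prop :=
  n ∣ (l.map Prod.fst).prod ^ 8 ∧ ∀ t ∈ l, t.1.Prime ∧ (∀ c ∈ t.2, c.Valid e₁ e₂ t.1) ∧
    Separating e₁ e₂ t.1 t.2

instance (e₁ e₂ : QuarticOrder N Y) (n : ℕ) (l : List (ℕ × List ResidueChar)) :
    Decidable (SaturationCert e₁ e₂ n l) := by
  unfold SaturationCert
  infer_instance

lemma SaturationCert.saturatedAt {e₁ e₂ : (QuarticOrder N Y)ˣ} {n : ℕ}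
    {l : List (ℕ × List ResidueChar)}
    (h : SaturationCert (e₁ : QuarticOrder N Y) (e₂ : QuarticOrder N Y) n l) {ℓ : ℕ}
    (hℓ : ℓ.Prime) (hn : ℓ ∣ n) : SaturatedAt e₁ e₂ ℓ := by
  have h1 := hℓ.prime.dvd_of_dvd_pow (hn.trans h.1)
  obtain ⟨k, hk, hd⟩ := (hℓ.prime.dvd_prod_iff).1 h1
  obtain ⟨t, ht, rfl⟩ := List.mem_map.1 hk
  obtain ⟨hp, hv, hs⟩ := h.2 t ht
  rw [(Nat.prime_dvd_prime_iff_eq hℓ hp).1 hd]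
  exact SaturatedAt.of_separating hp.pos hv hs

end QuarticOrder

lemma pow_eq_or_eq_neg {R : Type*} [CommRing R] (e : Rˣ) (o t i : ℕ) :
    e ^ i = e ^ (i % o) * ((-1) ^ t * e ^ o) ^ (i / o) ∨
    e ^ i = -(e ^ (i % o) * ((-1) ^ t * e ^ o) ^ (i / o)) := by
  have hi : e ^ i = e ^ (i % o) * (e ^ o) ^ (i / o) := by
    rw [← pow_mul, ← pow_add, Nat.mod_add_div]
  rw [mul_pow, ← pow_mul]
  rcases neg_one_pow_eq_or Rˣ (t * (i / o)) with h | h <;> rw [h]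
  · left; rw [one_mul, hi]
  · right; rw [neg_one_mul, mul_neg, neg_neg, hi]

lemma eq_or_eq_neg_trans {R : Type*} [CommRing R] {x x' y y' w z : Rˣ} (hx : x = x' ∨ x = -x')
    (hy : y = y' ∨ y = -y') (hz : z = x * y * w ∨ z = -(x * y * w)) :
    z = x' * y' * w ∨ z = -(x' * y' * w) := by
  rcases hx with rfl | rfl <;> rcases hy with rfl | rfl <;>
    simpa only [neg_mul, mul_neg, neg_neg, or_comm] using hz

namespace QuarticOrder

variable {N Y : ℤ}

instance : DecidableEq (QuarticOrder N Y) := fun x y =>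
  decidable_of_iff (x.c0 = y.c0 ∧ x.c1 = y.c1 ∧ x.c2 = y.c2 ∧ x.c3 = y.c3) QuarticOrder.ext_iff.symm

/-- Evaluated power of `e` modulo `m`, times the initial value. -/
def forcePow (m : ℕ) (e : QuarticOrder N Y) : ℕ → QuarticOrder N Y → (Residues → Bool) → Bool
  | 0, x, k => Residues.forceInts m x.c0 x.c1 x.c2 x.c3 k
  | n + 1, x, k =>
    Residues.forceInts m x.c0 x.c1 x.c2 x.c3 fun y => forcePow m e n (y.toOrder * e) k

/-- Boolean test for `e ^ n ≡ t` modulo `m`. -/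
def powTest (m : ℕ) (e : QuarticOrder N Y) (n : ℕ) (t : QuarticOrder N Y) : Bool :=
  forcePow m e n 1 fun z => decide ((m : ℤ) ∣ z.r0 - t.c0 ∧ (m : ℤ) ∣ z.r1 - t.c1 ∧
    (m : ℤ) ∣ z.r2 - t.c2 ∧ (m : ℤ) ∣ z.r3 - t.c3)

lemma forcePow_spec {m : ℕ} (hm : 0 < m) {e : QuarticOrder N Y} {n : ℕ} {x : QuarticOrder N Y}
    {k : Residues → Bool} (h : forcePow m e n x k = true) :
    ∃ z : Residues, (m : QuarticOrder N Y) ∣ z.toOrder - x * e ^ n ∧ k z = true := by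
  induction n generalizing x with
  | zero =>
    rw [forcePow, Residues.forceInts_eq] at h
    exact ⟨_, by simpa using dvd_toOrder_sub m hm x, h⟩
  | succ n ih =>
    rw [forcePow, Residues.forceInts_eq] at h
    obtain ⟨z, h1, h2⟩ := ih h
    refine ⟨z, (h1.add ((dvd_toOrder_sub m hm x).mul_right (e ^ (n + 1)))).trans (dvd_of_eq ?_), h2⟩
    ring

lemma powTest_spec {m : ℕ} (hm : 0 < m) {e : QuarticOrder N Y} {n : ℕ} {t : QuarticOrder N Y}
    (h : powTest m e n t = true) : (m : QuarticOrder N Y) ∣ e ^ n - t := by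
  obtain ⟨z, h1, h2⟩ := forcePow_spec hm h
  rw [decide_eq_true_iff] at h2
  have h3 : ((m : ℤ) : QuarticOrder N Y) ∣ z.toOrder - t := by
    rw [intCast_dvd_iff]
    exact h2
  rw [one_mul] at h1
  have := (show (m : QuarticOrder N Y) ∣ z.toOrder - t by simpa using h3).sub h1
  refine this.trans (dvd_of_eq ?_)
  ring

/-- Data certifying that two units have small order modulo the totally split prime `p`, and that
they generate the units modulo `(p - 1)`-st powers. -/
structure UnitCert (e₁ e₂ : (QuarticOrder N Y)ˣ) (p o₁ o₂ k₁ k₂ t₁ t₂ : ℕ) : Prop where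
  irr : Irreducible (genPoly N Y)
  nonreal : ∃ z : ℂ, z ^ 4 - 18 * N * z ^ 2 - 36 * Y * z + (36 - 27 * N ^ 2) = 0 ∧ z.im ≠ 0
  neg : 1 - 18 * N - 36 * Y + (36 - 27 * N ^ 2) < 0
  prime : p.Prime
  odd : Odd p
  alpha : powTest p (⟨0, 1, 0, 0⟩ : QuarticOrder N Y) p ⟨0, 1, 0, 0⟩ = true
  delta : powTest p (⟨0, 0, 1, 0⟩ : QuarticOrder N Y) p ⟨0, 0, 1, 0⟩ = true
  order₁ : o₁ * k₁ = p - 1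
  order₂ : o₂ * k₂ = p - 1
  sign₁ : Even (t₁ * k₁)
  sign₂ : Even (t₂ * k₂)
  pow₁ : powTest p (e₁ : QuarticOrder N Y) o₁ ((-1) ^ t₁) = true
  pow₂ : powTest p (e₂ : QuarticOrder N Y) o₂ ((-1) ^ t₂) = true
  sat : ∀ ℓ : ℕ, ℓ.Prime → ℓ ∣ p - 1 → SaturatedAt e₁ e₂ ℓ

namespace UnitCert

variable {e₁ e₂ : (QuarticOrder N Y)ˣ} {p o₁ o₂ k₁ k₂ t₁ t₂ : ℕ}

lemma exists_rep (h : UnitCert e₁ e₂ p o₁ o₂ k₁ k₂ t₁ t₂) {Q : ℕ} (hQ : 0 < Q)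
    (hsat : ∀ ℓ : ℕ, ℓ.Prime → ℓ ∣ Q → SaturatedAt e₁ e₂ ℓ) (u : (QuarticOrder N Y)ˣ) :
    ∃ (i j : ℕ) (v : (QuarticOrder N Y)ˣ), u = e₁ ^ i * e₂ ^ j * v ^ Q ∨
      u = -(e₁ ^ i * e₂ ^ j * v ^ Q) := by
  obtain ⟨i, j, v, -, -, hv⟩ := exists_eq_mul_pow_of_saturated hQ e₁ e₂
    (exists_zpow_eq_one h.irr h.nonreal) (fun x n hn hx => by
      rcases eq_one_or_neg_one_of_pow h.irr h.neg hn (x := (x : QuarticOrder N Y))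
        (by rw [← Units.val_pow_eq_pow_val, hx, Units.val_one]) with h' | h'
      · exact Or.inl (Units.ext h')
      · exact Or.inr (Units.ext h')) hsat u
  exact ⟨i, j, v, hv⟩

lemma dvd_unit_pow (h : UnitCert e₁ e₂ p o₁ o₂ k₁ k₂ t₁ t₂) (v : (QuarticOrder N Y)ˣ) :
    (p : QuarticOrder N Y) ∣ v ^ (p - 1) - 1 :=
  dvd_unit_pow_sub_one h.prime (powTest_spec h.prime.pos h.alpha)
    (powTest_spec h.prime.pos h.delta) v

lemma pow_eta {e : (QuarticOrder N Y)ˣ} {o k t : ℕ} (ho : o * k = p - 1) (ht : Even (t * k)) :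
    ((-1) ^ t * e ^ o) ^ k = e ^ (p - 1) := by
  rw [mul_pow, ← pow_mul, ← pow_mul, ho, ht.neg_one_pow, one_mul]

/-- A unit `u` for which `ρ * u` has two vanishing coordinates is, up to sign, a product of small
powers of `e₁` and `e₂` not excluded by the sieve, and a unit congruent to `1`. -/
lemma exists_decomposition (h : UnitCert e₁ e₂ p o₁ o₂ k₁ k₂ t₁ t₂) {Q : ℕ} (hQ : 0 < Q)
    (hLQ : p - 1 ∣ Q) (hsat : ∀ ℓ : ℕ, ℓ.Prime → ℓ ∣ Q → SaturatedAt e₁ e₂ ℓ)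
    {ρ : QuarticOrder N Y} {T : ℕ → ℕ → Bool} (hT : sieve p ρ e₁ e₂ o₁ o₂ T = true)
    {u : (QuarticOrder N Y)ˣ} (h2 : (ρ * u).c2 = 0) (h3 : (ρ * u).c3 = 0) :
    ∃ (i j a b : ℕ) (v : (QuarticOrder N Y)ˣ), T i j = true ∧
      (u = e₁ ^ i * e₂ ^ j * (((-1) ^ t₁ * e₁ ^ o₁) ^ a * ((-1) ^ t₂ * e₂ ^ o₂) ^ b * v ^ Q) ∨
       u = -(e₁ ^ i * e₂ ^ j *
        (((-1) ^ t₁ * e₁ ^ o₁) ^ a * ((-1) ^ t₂ * e₂ ^ o₂) ^ b * v ^ Q))) := by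
  have hp1 : 0 < p - 1 := Nat.sub_pos_of_lt h.prime.one_lt
  have ho₁ : 0 < o₁ := Nat.pos_of_mul_pos_right (h.order₁ ▸ hp1)
  have ho₂ : 0 < o₂ := Nat.pos_of_mul_pos_right (h.order₂ ▸ hp1)
  obtain ⟨i, j, v, hv⟩ := h.exists_rep hQ hsat u
  set η₁ := (-1) ^ t₁ * e₁ ^ o₁ with hη₁
  set η₂ := (-1) ^ t₂ * e₂ ^ o₂ with hη₂
  have huv : u = e₁ ^ (i % o₁) * e₂ ^ (j % o₂) * (η₁ ^ (i / o₁) * η₂ ^ (j / o₂) * v ^ Q) ∨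
      u = -(e₁ ^ (i % o₁) * e₂ ^ (j % o₂) * (η₁ ^ (i / o₁) * η₂ ^ (j / o₂) * v ^ Q)) := by
    rw [← mul_assoc, mul_mul_mul_comm]
    exact eq_or_eq_neg_trans (pow_eq_or_eq_neg e₁ o₁ t₁ i) (pow_eq_or_eq_neg e₂ o₂ t₂ j) hv
  refine ⟨i % o₁, j % o₂, i / o₁, j / o₂, v, ?_, huv⟩
  let I : Ideal (QuarticOrder N Y) := Ideal.span {(p : QuarticOrder N Y)}
  let π := Ideal.Quotient.mk I
  have hπ (x y : QuarticOrder N Y) (hxy : (p : QuarticOrder N Y) ∣ x - y) : π x = π y :=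
    Ideal.Quotient.eq.2 (Ideal.mem_span_singleton.2 hxy)
  have hη (e : (QuarticOrder N Y)ˣ) (o t : ℕ)
      (ht : powTest p (e : QuarticOrder N Y) o ((-1) ^ t) = true) :
      π (((-1) ^ t * e ^ o : (QuarticOrder N Y)ˣ) : QuarticOrder N Y) = 1 := by
    have := hπ _ _ (powTest_spec h.prime.pos ht)
    push_cast
    rw [map_mul, this, ← map_mul, ← mul_pow]
    simp
  have hvQ : π ((v ^ Q : (QuarticOrder N Y)ˣ) : QuarticOrder N Y) = 1 := by
    obtain ⟨c, rfl⟩ := hLQ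
    have := hπ _ _ (h.dvd_unit_pow v)
    push_cast
    rw [pow_mul, map_pow, this, map_one, one_pow]
  have hu : π u = π (e₁ ^ (i % o₁) * e₂ ^ (j % o₂)) ∨
      π u = -π (e₁ ^ (i % o₁) * e₂ ^ (j % o₂)) := by
    have key : π ((e₁ ^ (i % o₁) * e₂ ^ (j % o₂) * (η₁ ^ (i / o₁) * η₂ ^ (j / o₂) * v ^ Q) :
        (QuarticOrder N Y)ˣ) : QuarticOrder N Y) = π (e₁ ^ (i % o₁) * e₂ ^ (j % o₂)) := by
      rw [Units.val_mul, map_mul, Units.val_mul _ (v ^ Q), map_mul, hvQ, Units.val_mul (η₁ ^ _),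
        map_mul, Units.val_pow_eq_pow_val η₁, map_pow, hη _ _ _ h.pow₁,
        Units.val_pow_eq_pow_val η₂, map_pow, hη _ _ _ h.pow₂]
      push_cast
      simp
    rcases huv with h' | h'
    · left; rw [← key, ← h']
    · right; rw [← key, ← map_neg, ← Units.val_neg, ← h']
  have hdvd : ((p : ℤ) : QuarticOrder N Y) ∣ ρ * u - ρ * (e₁ ^ (i % o₁) * e₂ ^ (j % o₂)) ∨
      ((p : ℤ) : QuarticOrder N Y) ∣ ρ * u + ρ * (e₁ ^ (i % o₁) * e₂ ^ (j % o₂)) := by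
    rw [Int.cast_natCast, ← mul_sub, ← mul_add]
    rcases hu with h' | h'
    · exact Or.inl ((Ideal.mem_span_singleton.1 (Ideal.Quotient.eq.1 h')).mul_left _)
    · rw [← map_neg] at h'
      have := Ideal.mem_span_singleton.1 (Ideal.Quotient.eq.1 h')
      rw [sub_neg_eq_add] at this
      exact Or.inr (this.mul_left _)
  rw [intCast_dvd_iff, intCast_dvd_iff] at hdvd
  simp only [c2_sub, c3_sub, c2_add, c3_add, h2, h3, zero_sub, zero_add, dvd_neg, ← mul_assoc]
    at hdvd
  have hfin : (p : ℤ) ∣ (ρ * e₁ ^ (i % o₁) * e₂ ^ (j % o₂)).c2 ∧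
      (p : ℤ) ∣ (ρ * e₁ ^ (i % o₁) * e₂ ^ (j % o₂)).c3 := by
    rcases hdvd with h' | h' <;> exact ⟨h'.2.2.1, h'.2.2.2⟩
  exact sieve_spec h.prime.pos hT (Nat.mod_lt _ ho₁) (Nat.mod_lt _ ho₂) hfin.1 hfin.2

/-- No unit `u` makes two coordinates of `ρ * u` vanish if nothing survives the sieve. -/
theorem not_c2_c3_eq_zero (h : UnitCert e₁ e₂ p o₁ o₂ k₁ k₂ t₁ t₂) {ρ : QuarticOrder N Y}
    (hT : sieve p ρ e₁ e₂ o₁ o₂ (fun _ _ => false) = true) (u : (QuarticOrder N Y)ˣ) :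
    ¬ ((ρ * u).c2 = 0 ∧ (ρ * u).c3 = 0) := by
  rintro ⟨h2, h3⟩
  obtain ⟨i, j, a, b, v, hf, -⟩ := h.exists_decomposition
    (Nat.sub_pos_of_lt h.prime.one_lt) dvd_rfl h.sat hT h2 h3
  exact absurd hf Bool.false_ne_true

/-- Linear parts of the units that are `1` modulo `p`, and their independence relative to the
allowed solutions. -/
structure Skolem (p : ℕ) (e : (QuarticOrder N Y)ˣ) (o t : ℕ) (A : QuarticOrder N Y) : Prop where
  test : powTest (p ^ 2) (e : QuarticOrder N Y) o ((-1) ^ t * (1 + p * A)) = true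

lemma Skolem.exists_eq (hp : 0 < p) {e : (QuarticOrder N Y)ˣ} {o t : ℕ} {A : QuarticOrder N Y}
    (h : Skolem p e o t A) : ∃ B : QuarticOrder N Y,
      (((-1) ^ t * e ^ o : (QuarticOrder N Y)ˣ) : QuarticOrder N Y) = 1 + p * A + p ^ 2 * B := by
  obtain ⟨B, hB⟩ := powTest_spec (pow_pos hp 2) h.test
  refine ⟨(-1) ^ t * B, ?_⟩
  have h1 : ((-1) ^ t * (-1) ^ t : QuarticOrder N Y) = 1 := by rw [← mul_pow]; simp
  push_cast at hB ⊢
  linear_combination (-1) ^ t * hB + (1 + p * A) * h1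

/-- The Jacobian determinant at `u` relevant for the descent. -/
def skolemDet (u A₁ A₂ : QuarticOrder N Y) : ℤ :=
  (u * A₁).c2 * (u * A₂).c3 - (u * A₂).c2 * (u * A₁).c3

lemma saturatedAt_prime (h : UnitCert e₁ e₂ p o₁ o₂ k₁ k₂ t₁ t₂) {A₁ A₂ : QuarticOrder N Y}
    (hA₁ : Skolem p e₁ o₁ t₁ A₁) (hA₂ : Skolem p e₂ o₂ t₂ A₂)
    (hdet : ¬ (p : ℤ) ∣ skolemDet 1 A₁ A₂) : SaturatedAt e₁ e₂ p := by
  have hp := h.prime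
  have hp1 : 0 < p - 1 := Nat.sub_pos_of_lt hp.one_lt
  refine SaturatedAt.of_reduced hp.pos fun v a b ha hb hv => ?_
  have heven : Even (p - 1) := h.odd.tsub_odd odd_one
  have hv' : v ^ (p * (p - 1)) = ((-1) ^ t₁ * e₁ ^ o₁) ^ (k₁ * a) *
      ((-1) ^ t₂ * e₂ ^ o₂) ^ (k₂ * b) := by
    rw [pow_mul _ k₁, pow_mul _ k₂, pow_eta h.order₁ h.sign₁, pow_eta h.order₂ h.sign₂, pow_mul,
      pow_right_comm e₁, pow_right_comm e₂, ← mul_pow]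
    rcases hv with hv | hv <;> rw [hv]
    exact heven.neg_pow _
  obtain ⟨B₁, hB₁⟩ := hA₁.exists_eq hp.pos
  obtain ⟨B₂, hB₂⟩ := hA₂.exists_eq hp.pos
  obtain ⟨w, hw⟩ := h.dvd_unit_pow v
  have expand (A B : QuarticOrder N Y) (n : ℕ) :
      ∃ c, (1 + p * A + p ^ 2 * B) ^ n = 1 + p * (n * A) + p ^ 2 * c := by
    obtain ⟨w, hw⟩ := one_add_pow_eq (p * A + p ^ 2 * B) n
    refine ⟨n * B + (n.choose 2 : ℕ) * (A + p * B) ^ 2 + p * (A + p * B) ^ 3 * w, ?_⟩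
    rw [add_assoc, hw]
    ring
  obtain ⟨c₁, hc₁⟩ := expand A₁ B₁ (k₁ * a)
  obtain ⟨c₂, hc₂⟩ := expand A₂ B₂ (k₂ * b)
  obtain ⟨c₃, hc₃⟩ := expand w 0 p
  have hval := congrArg Units.val hv'
  rw [Units.val_mul, Units.val_pow_eq_pow_val, Units.val_pow_eq_pow_val _ (k₁ * a),
    Units.val_pow_eq_pow_val _ (k₂ * b), hB₁, hB₂, hc₁, hc₂, mul_comm p, pow_mul,
    sub_eq_iff_eq_add'.1 hw] at hval
  rw [mul_zero, add_zero] at hc₃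
  rw [hc₃] at hval
  have hmul : ((p : ℤ) : QuarticOrder N Y) * (((k₁ * a : ℕ) : ℤ) * A₁ + ((k₂ * b : ℕ) : ℤ) * A₂) =
      ((p : ℤ) : QuarticOrder N Y) * ((p : ℤ) * (w + c₃ - c₁ - c₂ -
        (k₁ * a : ℕ) * A₁ * ((k₂ * b : ℕ) * A₂)
        - p * ((k₁ * a : ℕ) * A₁ * c₂ + (k₂ * b : ℕ) * A₂ * c₁) - p ^ 2 * (c₁ * c₂))) := by
    push_cast at hval ⊢
    linear_combination -hval
  have hcancel (x y : QuarticOrder N Y) (hxy : ((p : ℤ) : QuarticOrder N Y) * x = (p : ℤ) * y) :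
      x = y := by
    have hp0 : (p : ℤ) ≠ 0 := by exact_mod_cast hp.ne_zero
    rw [coords_intCast_mul, coords_intCast_mul, QuarticOrder.mk.injEq] at hxy
    simp only [mul_right_inj' hp0] at hxy
    exact QuarticOrder.ext hxy.1 hxy.2.1 hxy.2.2.1 hxy.2.2.2
  have hdvd := intCast_dvd_iff.1 (Dvd.intro _ (hcancel _ _ hmul).symm)
  simp only [c2_add, c3_add, coords_intCast_mul] at hdvd
  obtain ⟨-, -, d2, d3⟩ := hdvd
  simp only [skolemDet, one_mul] at hdet
  have hpZ : Prime (p : ℤ) := Nat.prime_iff_prime_int.1 hp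
  have k (c : ℤ) (hc : (p : ℤ) ∣ c * (A₁.c2 * A₂.c3 - A₂.c2 * A₁.c3)) : (p : ℤ) ∣ c :=
    (hpZ.dvd_or_dvd hc).resolve_right hdet
  have e1 : (p : ℤ) ∣ ((k₁ * a : ℕ) : ℤ) := k _ (by
    refine ((d2.mul_right A₂.c3).sub (d3.mul_right A₂.c2)).trans (dvd_of_eq ?_)
    ring)
  have e2 : (p : ℤ) ∣ ((k₂ * b : ℕ) : ℤ) := k _ (by
    refine ((d3.mul_right A₁.c2).sub (d2.mul_right A₁.c3)).trans (dvd_of_eq ?_)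
    ring)
  have small (o k a : ℕ) (ho : o * k = p - 1) (ha : a < p) (hd : (p : ℤ) ∣ ((k * a : ℕ) : ℤ)) :
      a = 0 := by
    rcases hp.dvd_mul.1 (Int.natCast_dvd_natCast.1 hd) with h' | h'
    · have h1 : k ∣ p - 1 := Dvd.intro_left o ho
      have := Nat.le_of_dvd hp1 (h'.trans h1)
      omega
    · exact Nat.eq_zero_of_dvd_of_lt h' ha
  exact ⟨small _ _ _ h.order₁ ha e1, small _ _ _ h.order₂ hb e2⟩

/-- The units with two vanishing coordinates are the obvious ones. -/
theorem eq_of_c2_c3_eq_zero (h : UnitCert e₁ e₂ p o₁ o₂ k₁ k₂ t₁ t₂) {A₁ A₂ : QuarticOrder N Y}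
    (hA₁ : Skolem p e₁ o₁ t₁ A₁) (hA₂ : Skolem p e₂ o₂ t₂ A₂)
    (hdet : ¬ (p : ℤ) ∣ skolemDet 1 A₁ A₂) {T : ℕ → ℕ → Bool}
    (hT : sieve p 1 (e₁ : QuarticOrder N Y) e₂ o₁ o₂ T = true)
    (hdetT : ∀ i j, T i j = true →
      ((e₁ ^ i * e₂ ^ j : (QuarticOrder N Y)ˣ) : QuarticOrder N Y).c2 = 0 ∧
      ((e₁ ^ i * e₂ ^ j : (QuarticOrder N Y)ˣ) : QuarticOrder N Y).c3 = 0 ∧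
      ¬ (p : ℤ) ∣ skolemDet ((e₁ ^ i * e₂ ^ j : (QuarticOrder N Y)ˣ) : QuarticOrder N Y) A₁ A₂)
    {u : (QuarticOrder N Y)ˣ} (h2 : (u : QuarticOrder N Y).c2 = 0)
    (h3 : (u : QuarticOrder N Y).c3 = 0) :
    ∃ i j, T i j = true ∧ (u = e₁ ^ i * e₂ ^ j ∨ u = -(e₁ ^ i * e₂ ^ j)) := by
  have hp := h.prime
  have hp1 : 0 < p - 1 := Nat.sub_pos_of_lt hp.one_lt
  have hsat : ∀ ℓ : ℕ, ℓ.Prime → ℓ ∣ (p - 1) * p → SaturatedAt e₁ e₂ ℓ := by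
    intro ℓ hℓ hd
    rcases hℓ.dvd_mul.1 hd with h' | h'
    · exact h.sat ℓ hℓ h'
    · rw [(Nat.prime_dvd_prime_iff_eq hℓ hp).1 h']
      exact h.saturatedAt_prime hA₁ hA₂ hdet
  have hQ := Nat.mul_pos hp1 hp.pos
  obtain ⟨B₁, hB₁⟩ := hA₁.exists_eq hp.pos
  obtain ⟨B₂, hB₂⟩ := hA₂.exists_eq hp.pos
  obtain ⟨i, j, a, b, v, hij, hu⟩ := h.exists_decomposition hQ (dvd_mul_right _ _) hsat hT
    (ρ := 1) (u := u) (by rwa [one_mul]) (by rwa [one_mul])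
  obtain ⟨f0, g0, hd⟩ := hdetT i j hij
  refine ⟨i, j, hij, ?_⟩
  let f : QuarticOrder N Y →+ ℤ := ⟨⟨QuarticOrder.c2, rfl⟩, fun _ _ => rfl⟩
  let g : QuarticOrder N Y →+ ℤ := ⟨⟨QuarticOrder.c3, rfl⟩, fun _ _ => rfl⟩
  refine eq_or_eq_neg_of_descent (L := p - 1) hp h.odd f g
    (eq_zero_of_forall_pow_dvd hp.one_lt) u (e₁ ^ i * e₂ ^ j) _ _ A₁ A₂ B₁ B₂ hB₁ hB₂
    h.dvd_unit_pow (fun v => ?_) hd f0 g0 h2 h3 ⟨a, b, v, hu⟩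
  obtain ⟨i', j', v', hv'⟩ := h.exists_rep hQ hsat v
  refine ⟨k₁ * i', k₂ * j', v' ^ (p - 1), ?_⟩
  rw [pow_mul _ k₁, pow_mul _ k₂, pow_eta h.order₁ h.sign₁, pow_eta h.order₂ h.sign₂,
    pow_right_comm e₁, pow_right_comm e₂, pow_right_comm v', ← mul_pow, ← mul_pow]
  rcases hv' with hv' | hv' <;> rw [hv']
  exact (h.odd.tsub_odd odd_one).neg_pow _

end UnitCert

end QuarticOrder

namespace QuarticOrder

variable {N Y : ℤ}

lemma alpha_sq : (⟨0, 1, 0, 0⟩ : QuarticOrder N Y) ^ 2 = 3 * ⟨0, 0, 1, 0⟩ := by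
  have h : (3 : QuarticOrder N Y) = (3 : ℤ) := by norm_num
  rw [sq, h, coords_intCast_mul]
  ext <;> simp [c0_mul, c1_mul, c2_mul, c3_mul]

lemma mk_eq (a b c d : ℤ) : (⟨a, b, c, d⟩ : QuarticOrder N Y) =
    a + b * ⟨0, 1, 0, 0⟩ + c * ⟨0, 0, 1, 0⟩ + d * ⟨0, 0, 0, 1⟩ := by
  have h1 : (a : QuarticOrder N Y) = a * 1 := by simp
  rw [h1]
  simp only [coords_intCast_mul]
  ext <;> simp

lemma delta_sq : (⟨0, 0, 1, 0⟩ : QuarticOrder N Y) ^ 2 =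
    6 * N * ⟨0, 0, 1, 0⟩ + 4 * Y * ⟨0, 1, 0, 0⟩ + (3 * N ^ 2 - 4) := by
  have h : (⟨0, 0, 1, 0⟩ : QuarticOrder N Y) ^ 2 = ⟨3 * N ^ 2 - 4, 4 * Y, 6 * N, 0⟩ := by
    rw [sq]
    ext <;> simp [c0_mul, c1_mul, c2_mul, c3_mul]
  rw [h, mk_eq]
  push_cast
  ring

/-- The unit attached to a representation of `1` by the quartic form. -/
lemma exists_unit_of_form_eq_one {s t : ℤ}
    (h : s ^ 4 - 18 * N * s ^ 2 * t ^ 2 - 36 * Y * s * t ^ 3 + (36 - 27 * N ^ 2) * t ^ 4 = 1) :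
    ∃ u : (QuarticOrder N Y)ˣ, (u : QuarticOrder N Y) = ⟨s, -t, 0, 0⟩ := by
  have h1 := alpha_sq (N := N) (Y := Y)
  have h2 := delta_sq (N := N) (Y := Y)
  have h3 := congrArg (Int.cast : ℤ → QuarticOrder N Y) h
  push_cast at h3
  set α : QuarticOrder N Y := ⟨0, 1, 0, 0⟩
  set δ : QuarticOrder N Y := ⟨0, 0, 1, 0⟩
  have key : (s - t * α) * (s ^ 3 + s ^ 2 * t * α + (α ^ 2 - 18 * N) * s * t ^ 2 +
      (α ^ 3 - 18 * N * α - 36 * Y) * t ^ 3) = 1 := by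
    linear_combination h3 - t ^ 4 * ((α ^ 2 + 3 * δ - 18 * N) * h1 + 9 * h2)
  refine ⟨Units.mkOfMulEqOne _ _ key, ?_⟩
  rw [Units.val_mkOfMulEqOne, mk_eq]
  push_cast
  ring

/-- The unit attached to a representation of `1` by the companion of the quartic form. -/
lemma exists_unit_of_companion_eq_one {ρ β : QuarticOrder N Y} {ε : (QuarticOrder N Y)ˣ}
    (hρ : ρ * ρ = ((3 : ℤ) : QuarticOrder N Y) * ε)
    (hβ : ((3 : ℤ) : QuarticOrder N Y) * β = ⟨0, 1, 0, 0⟩ * ρ) {s t : ℤ}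
    (h : 9 * s ^ 4 - 18 * N * s ^ 2 * t ^ 2 - 12 * Y * s * t ^ 3 + (4 - 3 * N ^ 2) * t ^ 4 = 1) :
    ∃ x : (QuarticOrder N Y)ˣ, ρ * x = ⟨3 * s, -t, 0, 0⟩ := by
  have h1 := alpha_sq (N := N) (Y := Y)
  have h2 := delta_sq (N := N) (Y := Y)
  have h3 := congrArg (Int.cast : ℤ → QuarticOrder N Y) h
  push_cast at h3 hρ hβ
  have cancel (x y : QuarticOrder N Y) (hxy : 3 * x = 3 * y) : x = y := by
    have e (z : QuarticOrder N Y) : 3 * z = ⟨3 * z.c0, 3 * z.c1, 3 * z.c2, 3 * z.c3⟩ := by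
      rw [← coords_intCast_mul]
      norm_num
    rw [e, e, QuarticOrder.mk.injEq] at hxy
    ext <;> omega
  have hy : (⟨3 * s, -t, 0, 0⟩ : QuarticOrder N Y) = 3 * s - t * ⟨0, 1, 0, 0⟩ := by
    rw [mk_eq]
    push_cast
    ring
  rw [hy]
  set α : QuarticOrder N Y := ⟨0, 1, 0, 0⟩
  set δ : QuarticOrder N Y := ⟨0, 0, 1, 0⟩
  set A : QuarticOrder N Y := 3 * s ^ 3 + s ^ 2 * t * α + (δ - 6 * N) * s * t ^ 2
    - (2 * N * α + 4 * Y) * t ^ 3 with hA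
  have hc : (3 * s - t * α) * (3 * A + α * δ * t ^ 3) = 3 := by
    rw [hA]
    linear_combination 3 * h3 - (3 * s ^ 2 * t ^ 2 + t ^ 4 * (δ - 6 * N)) * h1 - 3 * t ^ 4 * h2
  have hw : 3 * (3 * A ^ 2 + 2 * A * (α * δ * t ^ 3) + δ ^ 3 * t ^ 6) =
      (3 * A + α * δ * t ^ 3) ^ 2 := by
    linear_combination - δ ^ 2 * t ^ 6 * h1
  generalize 3 * A ^ 2 + 2 * A * (α * δ * t ^ 3) + δ ^ 3 * t ^ 6 = w at hw
  generalize 3 * A + α * δ * t ^ 3 = c at hc hw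
  have hx : 3 * (s * ρ - t * β) = (3 * s - t * α) * ρ := by
    linear_combination - t * hβ
  generalize s * ρ - t * β = x at hx
  generalize 3 * s - t * α = y at hc hx
  have hxx : x * (x * w) = ε := by
    apply cancel
    apply cancel
    apply cancel
    linear_combination (3 * x + y * ρ) * 3 * w * hx + y ^ 2 * ρ ^ 2 * hw
      + (y * c + 3) * ρ ^ 2 * hc + 9 * hρ
  have hone : x * (x * w * (ε⁻¹ : (QuarticOrder N Y)ˣ)) = 1 := by
    rw [← mul_assoc, hxx, Units.mul_inv]
  refine ⟨Units.mkOfMulEqOne _ _ hone * ε⁻¹, ?_⟩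
  rw [Units.val_mul, Units.val_mkOfMulEqOne, ← mul_assoc, Units.mul_inv_eq_iff_eq_mul]
  apply cancel
  linear_combination ρ * hx + y * hρ

/-- The value at `(s, t)` of the Hessian covariant of the quartic form attached to `N` and `Y`. -/
def hessian (N Y s t : ℤ) : ℤ :=
  3 * N * s ^ 4 + 18 * Y * s ^ 3 * t + (54 * N ^ 2 - 36) * s ^ 2 * t ^ 2 + 54 * N * Y * s * t ^ 3 +
    (81 * Y ^ 2 + 108 * N - 81 * N ^ 3) * t ^ 4

/-- The element `u` comes from a representation of `1` with prescribed Hessian value, which is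
isolated modulo `p`. -/
def IsIsolatedSolution (p : ℕ) (A₁ A₂ : QuarticOrder N Y) (vals : List ℤ)
    (u : QuarticOrder N Y) : Prop :=
  u.c2 = 0 ∧ u.c3 = 0 ∧ ¬ (p : ℤ) ∣ UnitCert.skolemDet u A₁ A₂ ∧ hessian N Y u.c0 (-u.c1) ∈ vals

instance (p : ℕ) (A₁ A₂ : QuarticOrder N Y) (vals : List ℤ) (u : QuarticOrder N Y) :
    Decidable (IsIsolatedSolution p A₁ A₂ vals u) := by
  unfold IsIsolatedSolution
  infer_instance

/-- The representations of `1` by the quartic form have prescribed Hessian values. -/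
theorem UnitCert.hessian_mem {e₁ e₂ : (QuarticOrder N Y)ˣ} {p o₁ o₂ k₁ k₂ t₁ t₂ : ℕ}
    (h : UnitCert e₁ e₂ p o₁ o₂ k₁ k₂ t₁ t₂) (A₁ A₂ : QuarticOrder N Y) (l : List (ℕ × ℕ))
    (vals : List ℤ) (hA₁ : Skolem p e₁ o₁ t₁ A₁) (hA₂ : Skolem p e₂ o₂ t₂ A₂)
    (hdet : ¬ (p : ℤ) ∣ skolemDet 1 A₁ A₂)
    (hT : sieve p 1 (e₁ : QuarticOrder N Y) e₂ o₁ o₂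
      (fun i j => l.any fun x => Nat.beq i x.1 && Nat.beq j x.2) = true)
    (hl : ∀ x ∈ l, IsIsolatedSolution p A₁ A₂ vals
      ((e₁ : QuarticOrder N Y) ^ x.1 * (e₂ : QuarticOrder N Y) ^ x.2))
    {s t : ℤ}
    (hst : s ^ 4 - 18 * N * s ^ 2 * t ^ 2 - 36 * Y * s * t ^ 3 + (36 - 27 * N ^ 2) * t ^ 4 = 1) :
    hessian N Y s t ∈ vals := by
  obtain ⟨u, hu⟩ := exists_unit_of_form_eq_one hst
  have hmem (i j : ℕ) (hij : (l.any fun x => Nat.beq i x.1 && Nat.beq j x.2) = true) :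
      (i, j) ∈ l := by
    obtain ⟨x, hx, hxij⟩ := List.any_eq_true.1 hij
    rw [Bool.and_eq_true, Nat.beq_eq, Nat.beq_eq] at hxij
    rwa [hxij.1, hxij.2]
  obtain ⟨i, j, hij, hu'⟩ := h.eq_of_c2_c3_eq_zero hA₁ hA₂ hdet hT (fun i j hij => by
      obtain ⟨h2, h3, h4, -⟩ := hl _ (hmem i j hij)
      push_cast
      exact ⟨h2, h3, h4⟩) (by rw [hu]) (by rw [hu]) (u := u)
  obtain ⟨-, -, -, hv⟩ := hl _ (hmem i j hij)
  rw [show (e₁ : QuarticOrder N Y) ^ i * (e₂ : QuarticOrder N Y) ^ j =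
    ((e₁ ^ i * e₂ ^ j : (QuarticOrder N Y)ˣ) : QuarticOrder N Y) by push_cast; rfl] at hv
  rcases hu' with h' | h'
  · rw [← h', hu, neg_neg] at hv
    exact hv
  · rw [eq_comm, neg_eq_iff_eq_neg] at h'
    rw [h', Units.val_neg, hu, c0_neg, c1_neg, neg_neg] at hv
    convert hv using 1
    simp only [hessian]
    ring

/-- The checks needed for a `UnitCert`, in decidable form. -/
theorem UnitCert.of_checks {e₁ e₂ : (QuarticOrder N Y)ˣ} {p o₁ o₂ k₁ k₂ t₁ t₂ : ℕ}
    (q : ℕ) (l : List (ℕ × List ResidueChar)) (hq : q.Prime)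
    (hroot : ∀ x ∈ List.range q, ¬ (q : ℤ) ∣ x ^ 4 - 18 * N * x ^ 2 - 36 * Y * x +
      (36 - 27 * N ^ 2))
    (hquad : ∀ a ∈ List.range q, ∀ b ∈ List.range q,
      ¬ ((q : ℤ) ∣ a * (-18 * N + a ^ 2 - 2 * b) + 36 * Y ∧
        (q : ℤ) ∣ b * (-18 * N + a ^ 2 - b) - (36 - 27 * N ^ 2)))
    (hdisc : 3 * Y ^ 2 = 4 * N ^ 3 - 4 * N + 27 ∨ 3 * Y ^ 2 = 4 * N ^ 3 - 4 * N - 21)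
    (hneg : 1 - 18 * N - 36 * Y + (36 - 27 * N ^ 2) < 0)
    (hp : p.Prime ∧ Odd p ∧ o₁ * k₁ = p - 1 ∧ o₂ * k₂ = p - 1 ∧ Even (t₁ * k₁) ∧ Even (t₂ * k₂))
    (halpha : powTest p (⟨0, 1, 0, 0⟩ : QuarticOrder N Y) p ⟨0, 1, 0, 0⟩ = true)
    (hdelta : powTest p (⟨0, 0, 1, 0⟩ : QuarticOrder N Y) p ⟨0, 0, 1, 0⟩ = true)
    (h₁ : powTest p (e₁ : QuarticOrder N Y) o₁ ((-1) ^ t₁) = true)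
    (h₂ : powTest p (e₂ : QuarticOrder N Y) o₂ ((-1) ^ t₂) = true)
    (hsat : SaturationCert (e₁ : QuarticOrder N Y) (e₂ : QuarticOrder N Y) (p - 1) l) :
    UnitCert e₁ e₂ p o₁ o₂ k₁ k₂ t₁ t₂ where
  irr := by
    have : Fact q.Prime := ⟨hq⟩
    have hz (a : ZMod q) : ∃ x ∈ List.range q, ((x : ℤ) : ZMod q) = a :=
      ⟨a.val, List.mem_range.2 (ZMod.val_lt a), by simp⟩
    refine genPoly_irreducible q (fun x h => ?_) (fun a b h => ?_)
    · obtain ⟨x, hx, rfl⟩ := hz x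
      refine hroot x hx ?_
      rw [← ZMod.intCast_zmod_eq_zero_iff_dvd, ← h]
      push_cast
      ring
    · obtain ⟨a, ha, rfl⟩ := hz a
      obtain ⟨b, hb, rfl⟩ := hz b
      refine hquad a ha b hb ?_
      rw [← ZMod.intCast_zmod_eq_zero_iff_dvd, ← ZMod.intCast_zmod_eq_zero_iff_dvd]
      refine ⟨?_, ?_⟩
      · have := h.1
        push_cast at this ⊢
        linear_combination this
      · have := h.2
        push_cast at this ⊢
        linear_combination this
  nonreal := by
    obtain ⟨z, hz, him⟩ := exists_nonreal_root (-18 * N : ℝ) (-36 * Y) (36 - 27 * N ^ 2) (by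
      have h' : (3 * Y ^ 2 : ℝ) = 4 * N ^ 3 - 4 * N + 27 ∨
        (3 * Y ^ 2 : ℝ) = 4 * N ^ 3 - 4 * N - 21 := by exact_mod_cast hdisc
      rcases h' with h' | h'
      · refine lt_of_eq_of_lt (b := -3661376256) ?_ (by norm_num)
        linear_combination -5038848 * (3 * (Y : ℝ) ^ 2 - 4 * (N ^ 3 - N) + 27) * h'
      · refine lt_of_eq_of_lt (b := -2210188032) ?_ (by norm_num)
        linear_combination -5038848 * (3 * (Y : ℝ) ^ 2 - 4 * (N ^ 3 - N) - 21) * h')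
    exact ⟨z, by push_cast at hz; linear_combination hz, him⟩
  neg := hneg
  prime := hp.1
  odd := hp.2.1
  alpha := halpha
  delta := hdelta
  order₁ := hp.2.2.1
  order₂ := hp.2.2.2.1
  sign₁ := hp.2.2.2.2.1
  sign₂ := hp.2.2.2.2.2
  pow₁ := h₁
  pow₂ := h₂
  sat := fun _ hℓ hd => hsat.saturatedAt hℓ hd

end QuarticOrder

namespace QuarticOrder

/-- A unit of the order. -/
def unit₁_neg2_1 : (QuarticOrder (-2) 1)ˣ :=
  ⟨⟨1, 1, 0, 0⟩, ⟨73, -37, 3, -3⟩, by decide +kernel, by decide +kernel⟩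

/-- A unit of the order. -/
def unit₂_neg2_1 : (QuarticOrder (-2) 1)ˣ :=
  ⟨⟨1731, -937, 176, -80⟩, ⟨1796634243, 1854177077, 264471721, 140706395⟩,
    by decide +kernel, by decide +kernel⟩

lemma unitCert_neg2_1_mod_151 : UnitCert unit₁_neg2_1 unit₂_neg2_1 151 75 75 2 2 0 1 :=
  UnitCert.of_checks 13 [(2, [⟨5, 3, 3, 1, 4⟩]),
    (3, [⟨7, 4, 3, 4, 1⟩, ⟨19, 13, 12, 7, 11⟩]),
    (5, [⟨11, 4, 9, 3, 4⟩, ⟨61, 23, 34, 34, 34⟩])]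
    (by norm_num) (by decide +kernel) (by decide +kernel) (by norm_num) (by norm_num)
    (by refine ⟨by norm_num, by decide, by norm_num, by norm_num, by decide, by decide⟩)
    (by decide +kernel) (by decide +kernel) (by decide +kernel) (by decide +kernel)
    (by decide +kernel)

lemma hessian_mem_neg2_1 {s t : ℤ}
    (h : s ^ 4 - 18 * (-2) * s ^ 2 * t ^ 2 - 36 * 1 * s * t ^ 3 +
      (36 - 27 * (-2) ^ 2) * t ^ 4 = 1) :
    hessian (-2) 1 s t ∈ [(-6 : ℤ), 777] :=
  unitCert_neg2_1_mod_151.hessian_mem ⟨73, 48, -19, -4⟩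
    ⟨-36, -57, 13, 63⟩ [(0, 0), (1, 0)] _
    ⟨by decide +kernel⟩ ⟨by decide +kernel⟩ (by decide +kernel) (by decide +kernel)
    (by decide +kernel) h

lemma companion_ne_one_neg2_1 (s t : ℤ) :
    9 * s ^ 4 - 18 * (-2) * s ^ 2 * t ^ 2 - 12 * 1 * s * t ^ 3 +
    (4 - 3 * (-2) ^ 2) * t ^ 4 ≠ 1 := by
  intro h
  obtain ⟨x, hx⟩ := exists_unit_of_companion_eq_one (ρ := ⟨3, -3, 6, -2⟩) (β := ⟨-16, -7, 21, 2⟩)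
    (ε := (unit₁_neg2_1 * unit₂_neg2_1)) (by decide +kernel) (by decide +kernel) h
  exact unitCert_neg2_1_mod_151.not_c2_c3_eq_zero (ρ := ⟨3, -3, 6, -2⟩) (by decide +kernel) x
    ⟨by rw [hx], by rw [hx]⟩

/-- A unit of the order. -/
def unit₁_neg1_3 : (QuarticOrder (-1) 3)ˣ :=
  ⟨⟨0, 0, 1, 0⟩, ⟨426, -72, -1, -12⟩, by decide +kernel, by decide +kernel⟩

/-- A unit of the order. -/
def unit₂_neg1_3 : (QuarticOrder (-1) 3)ˣ :=
  ⟨⟨19, 168, -156, 2⟩, ⟨-1949597, 22836816, 7923240, 2269150⟩, by decide +kernel, by decide +kernel⟩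

lemma unitCert_neg1_3_mod_191 : UnitCert unit₁_neg1_3 unit₂_neg1_3 191 95 190 2 1 0 0 :=
  UnitCert.of_checks 13 [(2, [⟨5, 1, 2, 4, 1⟩, ⟨7, 2, 6, 6, 6⟩, ⟨17, 2, 7, 16, 16⟩]),
    (5, [⟨11, 4, 9, 4, 9⟩, ⟨31, 12, 17, 8, 8⟩]),
    (19, [⟨191, 8, 85, 125, 154⟩, ⟨191, 97, 144, 107, 121⟩])]
    (by norm_num) (by decide +kernel) (by decide +kernel) (by norm_num) (by norm_num)
    (by refine ⟨by norm_num, by decide, by norm_num, by norm_num, by decide, by decide⟩)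
    (by decide +kernel) (by decide +kernel) (by decide +kernel) (by decide +kernel)
    (by decide +kernel)

lemma hessian_mem_neg1_3 {s t : ℤ}
    (h : s ^ 4 - 18 * (-1) * s ^ 2 * t ^ 2 - 36 * 3 * s * t ^ 3 +
      (36 - 27 * (-1) ^ 2) * t ^ 4 = 1) :
    hessian (-1) 3 s t ∈ [(-3 : ℤ)] :=
  unitCert_neg1_3_mod_191.hessian_mem ⟨83, 71, 12, 69⟩
    ⟨2, 35, -82, -87⟩ [(0, 0)] _
    ⟨by decide +kernel⟩ ⟨by decide +kernel⟩ (by decide +kernel) (by decide +kernel)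
    (by decide +kernel) h

/-- A unit of the order. -/
def unit₁_0_3 : (QuarticOrder 0 3)ˣ :=
  ⟨⟨-1, 3, 0, 0⟩, ⟨2915, -3, -27, -81⟩, by decide +kernel, by decide +kernel⟩

/-- A unit of the order. -/
def unit₂_0_3 : (QuarticOrder 0 3)ˣ :=
  ⟨⟨9, -44, -10, 8⟩, ⟨33705, -93860, -60614, -13048⟩, by decide +kernel, by decide +kernel⟩

lemma unitCert_0_3_mod_71 : UnitCert unit₁_0_3 unit₂_0_3 71 35 35 2 2 0 1 :=
  UnitCert.of_checks 13 [(2, [⟨5, 4, 2, 1, 4⟩]),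
    (5, [⟨11, 5, 1, 9, 3⟩, ⟨31, 24, 6, 8, 8⟩]),
    (7, [⟨29, 20, 27, 1, 25⟩, ⟨29, 28, 10, 24, 25⟩])]
    (by norm_num) (by decide +kernel) (by decide +kernel) (by norm_num) (by norm_num)
    (by refine ⟨by norm_num, by decide, by norm_num, by norm_num, by decide, by decide⟩)
    (by decide +kernel) (by decide +kernel) (by decide +kernel) (by decide +kernel)
    (by decide +kernel)

lemma hessian_mem_0_3 {s t : ℤ}
    (h : s ^ 4 - 18 * 0 * s ^ 2 * t ^ 2 - 36 * 3 * s * t ^ 3 + (36 - 27 * 0 ^ 2) * t ^ 4 = 1) :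
    hessian 0 3 s t ∈ [0, 58887] :=
  unitCert_0_3_mod_71.hessian_mem ⟨-1, -7, -31, -21⟩
    ⟨-4, -19, 22, -13⟩ [(0, 0), (1, 0)] _
    ⟨by decide +kernel⟩ ⟨by decide +kernel⟩ (by decide +kernel) (by decide +kernel)
    (by decide +kernel) h

lemma unitCert_0_3_mod_41 : UnitCert unit₁_0_3 unit₂_0_3 41 10 20 4 2 1 1 :=
  UnitCert.of_checks 13 [(2, [⟨5, 4, 2, 1, 4⟩]),
    (5, [⟨11, 5, 1, 9, 3⟩, ⟨31, 24, 6, 8, 8⟩])]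
    (by norm_num) (by decide +kernel) (by decide +kernel) (by norm_num) (by norm_num)
    (by refine ⟨by norm_num, by decide, by norm_num, by norm_num, by decide, by decide⟩)
    (by decide +kernel) (by decide +kernel) (by decide +kernel) (by decide +kernel)
    (by decide +kernel)

lemma companion_ne_one_0_3 (s t : ℤ) :
    9 * s ^ 4 - 18 * 0 * s ^ 2 * t ^ 2 - 12 * 3 * s * t ^ 3 +
    (4 - 3 * 0 ^ 2) * t ^ 4 ≠ 1 := by
  intro h
  obtain ⟨x, hx⟩ := exists_unit_of_companion_eq_one (ρ := ⟨3, 4, -3, 0⟩) (β := ⟨0, 1, 4, -1⟩)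
    (ε := (-unit₂_0_3)) (by decide +kernel) (by decide +kernel) h
  exact unitCert_0_3_mod_41.not_c2_c3_eq_zero (ρ := ⟨3, 4, -3, 0⟩) (by decide +kernel) x
    ⟨by rw [hx], by rw [hx]⟩

/-- A unit of the order. -/
def unit₁_1_3 : (QuarticOrder 1 3)ˣ :=
  ⟨⟨0, 2, -1, 0⟩, ⟨6, 2, 1, 0⟩, by decide +kernel, by decide +kernel⟩

/-- A unit of the order. -/
def unit₂_1_3 : (QuarticOrder 1 3)ˣ :=
  ⟨⟨-1, 12, 12, 2⟩, ⟨71, 12, 0, -2⟩, by decide +kernel, by decide +kernel⟩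

lemma unitCert_1_3_mod_151 : UnitCert unit₁_1_3 unit₂_1_3 151 75 75 2 2 0 1 :=
  UnitCert.of_checks 19 [(2, [⟨5, 4, 2, 1, 4⟩, ⟨7, 4, 3, 6, 1⟩, ⟨11, 3, 3, 1, 1⟩]),
    (3, [⟨7, 4, 3, 4, 4⟩, ⟨13, 4, 1, 9, 3⟩]),
    (5, [⟨11, 3, 3, 9, 1⟩, ⟨31, 11, 30, 8, 4⟩])]
    (by norm_num) (by decide +kernel) (by decide +kernel) (by norm_num) (by norm_num)
    (by refine ⟨by norm_num, by decide, by norm_num, by norm_num, by decide, by decide⟩)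
    (by decide +kernel) (by decide +kernel) (by decide +kernel) (by decide +kernel)
    (by decide +kernel)

lemma hessian_mem_1_3 {s t : ℤ}
    (h : s ^ 4 - 18 * 1 * s ^ 2 * t ^ 2 - 36 * 3 * s * t ^ 3 + (36 - 27 * 1 ^ 2) * t ^ 4 = 1) :
    hessian 1 3 s t ∈ [3] :=
  unitCert_1_3_mod_151.hessian_mem ⟨64, -12, -27, 23⟩
    ⟨21, -27, 44, -56⟩ [(0, 0)] _
    ⟨by decide +kernel⟩ ⟨by decide +kernel⟩ (by decide +kernel) (by decide +kernel)
    (by decide +kernel) h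

/-- A unit of the order. -/
def unit₁_5_13 : (QuarticOrder 5 13)ˣ :=
  ⟨⟨20, 16, 12, 1⟩, ⟨884, 281, 24, -10⟩, by decide +kernel, by decide +kernel⟩

/-- A unit of the order. -/
def unit₂_5_13 : (QuarticOrder 5 13)ˣ :=
  ⟨⟨-3099, -1280, 74, 28⟩, ⟨32217, 10240, 886, -364⟩, by decide +kernel, by decide +kernel⟩

lemma unitCert_5_13_mod_149 : UnitCert unit₁_5_13 unit₂_5_13 149 37 74 4 2 0 1 :=
  UnitCert.of_checks 29 [(2, [⟨5, 4, 2, 1, 4⟩]),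
    (37, [⟨149, 31, 72, 88, 102⟩, ⟨149, 71, 91, 63, 95⟩])]
    (by norm_num) (by decide +kernel) (by decide +kernel) (by norm_num) (by norm_num)
    (by refine ⟨by norm_num, by decide, by norm_num, by norm_num, by decide, by decide⟩)
    (by decide +kernel) (by decide +kernel) (by decide +kernel) (by decide +kernel)
    (by decide +kernel)

lemma hessian_mem_5_13 {s t : ℤ}
    (h : s ^ 4 - 18 * 5 * s ^ 2 * t ^ 2 - 36 * 13 * s * t ^ 3 + (36 - 27 * 5 ^ 2) * t ^ 4 = 1) :
    hessian 5 13 s t ∈ [15] :=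
  unitCert_5_13_mod_149.hessian_mem ⟨55, 4, -50, -45⟩
    ⟨25, -72, 20, -69⟩ [(0, 0)] _
    ⟨by decide +kernel⟩ ⟨by decide +kernel⟩ (by decide +kernel) (by decide +kernel)
    (by decide +kernel) h

lemma companion_ne_one_5_13 (s t : ℤ) :
    9 * s ^ 4 - 18 * 5 * s ^ 2 * t ^ 2 - 12 * 13 * s * t ^ 3 +
    (4 - 3 * 5 ^ 2) * t ^ 4 ≠ 1 := by
  intro h
  obtain ⟨x, hx⟩ := exists_unit_of_companion_eq_one (ρ := ⟨144, 66, 3, -2⟩) (β := ⟨-142, -56, 6, 1⟩)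
    (ε := unit₂_5_13) (by decide +kernel) (by decide +kernel) h
  exact unitCert_5_13_mod_149.not_c2_c3_eq_zero (ρ := ⟨144, 66, 3, -2⟩) (by decide +kernel) x
    ⟨by rw [hx], by rw [hx]⟩

/-- A unit of the order. -/
def unit₁_6_17 : (QuarticOrder 6 17)ˣ :=
  ⟨⟨3, 2, 1, 0⟩, ⟨867, 266, 23, -8⟩, by decide +kernel, by decide +kernel⟩

/-- A unit of the order. -/
def unit₂_6_17 : (QuarticOrder 6 17)ˣ :=
  ⟨⟨18221, 12062, 7968, 592⟩, ⟨78629, 32722, 2940, -952⟩, by decide +kernel, by decide +kernel⟩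

lemma unitCert_6_17_mod_137 : UnitCert unit₁_6_17 unit₂_6_17 137 68 136 2 1 1 0 :=
  UnitCert.of_checks 19 [(2, [⟨5, 1, 2, 4, 4⟩, ⟨7, 2, 6, 6, 6⟩, ⟨11, 3, 3, 1, 10⟩]),
    (17, [⟨137, 9, 27, 38, 16⟩, ⟨137, 27, 106, 122, 60⟩])]
    (by norm_num) (by decide +kernel) (by decide +kernel) (by norm_num) (by norm_num)
    (by refine ⟨by norm_num, by decide, by norm_num, by norm_num, by decide, by decide⟩)
    (by decide +kernel) (by decide +kernel) (by decide +kernel) (by decide +kernel)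
    (by decide +kernel)

lemma hessian_mem_6_17 {s t : ℤ}
    (h : s ^ 4 - 18 * 6 * s ^ 2 * t ^ 2 - 36 * 17 * s * t ^ 3 + (36 - 27 * 6 ^ 2) * t ^ 4 = 1) :
    hessian 6 17 s t ∈ [18] :=
  unitCert_6_17_mod_137.hessian_mem ⟨17, 37, 18, -47⟩
    ⟨-54, 36, -9, -55⟩ [(0, 0)] _
    ⟨by decide +kernel⟩ ⟨by decide +kernel⟩ (by decide +kernel) (by decide +kernel)
    (by decide +kernel) h

/-- A unit of the order. -/
def unit₁_15_67 : (QuarticOrder 15 67)ˣ :=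
  ⟨⟨12, 4, 1, 0⟩, ⟨1398, 316, 23, -4⟩, by decide +kernel, by decide +kernel⟩

/-- A unit of the order. -/
def unit₂_15_67 : (QuarticOrder 15 67)ˣ :=
  ⟨⟨480515, 116260, 8760, -1474⟩, ⟨17702339, 4023092, 296772, -51086⟩,
    by decide +kernel, by decide +kernel⟩

lemma unitCert_15_67_mod_137 : UnitCert unit₁_15_67 unit₂_15_67 137 68 136 2 1 1 0 :=
  UnitCert.of_checks 19 [(2, [⟨5, 1, 2, 4, 4⟩, ⟨7, 3, 3, 6, 6⟩, ⟨11, 0, 0, 1, 10⟩]),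
    (17, [⟨137, 90, 97, 73, 16⟩, ⟨137, 97, 31, 119, 60⟩])]
    (by norm_num) (by decide +kernel) (by decide +kernel) (by norm_num) (by norm_num)
    (by refine ⟨by norm_num, by decide, by norm_num, by norm_num, by decide, by decide⟩)
    (by decide +kernel) (by decide +kernel) (by decide +kernel) (by decide +kernel)
    (by decide +kernel)

lemma hessian_mem_15_67 {s t : ℤ}
    (h : s ^ 4 - 18 * 15 * s ^ 2 * t ^ 2 - 36 * 67 * s * t ^ 3 + (36 - 27 * 15 ^ 2) * t ^ 4 = 1) :
    hessian 15 67 s t ∈ [45] :=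
  unitCert_15_67_mod_137.hessian_mem ⟨49, 40, 25, 21⟩
    ⟨22, -45, -16, 65⟩ [(0, 0)] _
    ⟨by decide +kernel⟩ ⟨by decide +kernel⟩ (by decide +kernel) (by decide +kernel)
    (by decide +kernel) h

/-- A unit of the order. -/
def unit₁_26_153 : (QuarticOrder 26 153)ˣ :=
  ⟨⟨27, 6, 1, 0⟩, ⟨75, 6, -1, 0⟩, by decide +kernel, by decide +kernel⟩

/-- A unit of the order. -/
def unit₂_26_153 : (QuarticOrder 26 153)ˣ :=
  ⟨⟨93673, 19186, 1560, -156⟩, ⟨6878353753, 1234897454, 75074004, -9221916⟩,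
    by decide +kernel, by decide +kernel⟩

lemma unitCert_26_153_mod_191 : UnitCert unit₁_26_153 unit₂_26_153 191 95 190 2 1 0 0 :=
  UnitCert.of_checks 13 [(2, [⟨5, 4, 2, 4, 1⟩, ⟨7, 3, 3, 6, 6⟩, ⟨17, 1, 6, 16, 16⟩]),
    (5, [⟨11, 0, 0, 3, 9⟩, ⟨31, 30, 21, 4, 8⟩]),
    (19, [⟨191, 57, 128, 36, 125⟩, ⟨191, 63, 177, 136, 154⟩])]
    (by norm_num) (by decide +kernel) (by decide +kernel) (by norm_num) (by norm_num)
    (by refine ⟨by norm_num, by decide, by norm_num, by norm_num, by decide, by decide⟩)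
    (by decide +kernel) (by decide +kernel) (by decide +kernel) (by decide +kernel)
    (by decide +kernel)

lemma hessian_mem_26_153 {s t : ℤ}
    (h : s ^ 4 - 18 * 26 * s ^ 2 * t ^ 2 - 36 * 153 * s * t ^ 3 + (36 - 27 * 26 ^ 2) * t ^ 4 = 1) :
    hessian 26 153 s t ∈ [78] :=
  unitCert_26_153_mod_191.hessian_mem ⟨52, -68, 43, 39⟩
    ⟨-6, 14, -62, 16⟩ [(0, 0)] _
    ⟨by decide +kernel⟩ ⟨by decide +kernel⟩ (by decide +kernel) (by decide +kernel)
    (by decide +kernel) h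

/-- A unit of the order. -/
def unit₁_28_171 : (QuarticOrder 28 171)ˣ :=
  ⟨⟨1479, 276, 19, -2⟩, ⟨1659, 288, 17, -2⟩, by decide +kernel, by decide +kernel⟩

/-- A unit of the order. -/
def unit₂_28_171 : (QuarticOrder 28 171)ˣ :=
  ⟨⟨17, 2, 0, 0⟩, ⟨19889, 3454, 204, -24⟩, by decide +kernel, by decide +kernel⟩

lemma unitCert_28_171_mod_151 : UnitCert unit₁_28_171 unit₂_28_171 151 75 75 2 2 0 1 :=
  UnitCert.of_checks 19 [(2, [⟨5, 3, 3, 1, 4⟩, ⟨7, 4, 3, 6, 1⟩, ⟨11, 3, 3, 1, 1⟩]),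
    (3, [⟨7, 4, 3, 4, 2⟩, ⟨13, 8, 4, 9, 9⟩]),
    (5, [⟨11, 3, 3, 9, 1⟩, ⟨31, 11, 30, 8, 8⟩])]
    (by norm_num) (by decide +kernel) (by decide +kernel) (by norm_num) (by norm_num)
    (by refine ⟨by norm_num, by decide, by norm_num, by norm_num, by decide, by decide⟩)
    (by decide +kernel) (by decide +kernel) (by decide +kernel) (by decide +kernel)
    (by decide +kernel)

lemma hessian_mem_28_171 {s t : ℤ}
    (h : s ^ 4 - 18 * 28 * s ^ 2 * t ^ 2 - 36 * 171 * s * t ^ 3 + (36 - 27 * 28 ^ 2) * t ^ 4 = 1) :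
    hessian 28 171 s t ∈ [84, 1992] :=
  unitCert_28_171_mod_151.hessian_mem ⟨52, 65, -47, 25⟩
    ⟨-25, -24, -11, -61⟩ [(0, 0), (0, 1)] _
    ⟨by decide +kernel⟩ ⟨by decide +kernel⟩ (by decide +kernel) (by decide +kernel)
    (by decide +kernel) h

/-- A unit of the order. -/
def unit₁_2_1 : (QuarticOrder 2 1)ˣ :=
  ⟨⟨81, 13, -5, -1⟩, ⟨1593, 1039, 2864, 436⟩, by decide +kernel, by decide +kernel⟩

/-- A unit of the order. -/
def unit₂_2_1 : (QuarticOrder 2 1)ˣ :=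
  ⟨⟨19, 15, 57, 9⟩, ⟨10099, 3261, 13416, -2376⟩, by decide +kernel, by decide +kernel⟩

lemma unitCert_2_1_mod_373 : UnitCert unit₁_2_1 unit₂_2_1 373 186 186 2 2 0 0 :=
  UnitCert.of_checks 5 [(2, [⟨11, 1, 4, 1, 1⟩, ⟨17, 2, 7, 16, 1⟩]),
    (3, [⟨13, 1, 9, 1, 9⟩, ⟨19, 9, 8, 11, 11⟩]),
    (31, [⟨373, 10, 282, 163, 346⟩, ⟨373, 52, 31, 289, 163⟩])]
    (by norm_num) (by decide +kernel) (by decide +kernel) (by norm_num) (by norm_num)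
    (by refine ⟨by norm_num, by decide, by norm_num, by norm_num, by decide, by decide⟩)
    (by decide +kernel) (by decide +kernel) (by decide +kernel) (by decide +kernel)
    (by decide +kernel)

lemma hessian_mem_2_1 {s t : ℤ}
    (h : s ^ 4 - 18 * 2 * s ^ 2 * t ^ 2 - 36 * 1 * s * t ^ 3 + (36 - 27 * 2 ^ 2) * t ^ 4 = 1) :
    hessian 2 1 s t ∈ [6] :=
  unitCert_2_1_mod_373.hessian_mem ⟨52, 79, 181, -85⟩
    ⟨-84, -128, 82, 79⟩ [(0, 0)] _
    ⟨by decide +kernel⟩ ⟨by decide +kernel⟩ (by decide +kernel) (by decide +kernel)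
    (by decide +kernel) h

lemma companion_ne_one_2_1 (s t : ℤ) :
    9 * s ^ 4 - 18 * 2 * s ^ 2 * t ^ 2 - 12 * 1 * s * t ^ 3 +
    (4 - 3 * 2 ^ 2) * t ^ 4 ≠ 1 := by
  intro h
  obtain ⟨x, hx⟩ := exists_unit_of_companion_eq_one (ρ := ⟨-3, 37, 3, -3⟩) (β := ⟨-24, -13, 1, 1⟩)
    (ε := (unit₁_2_1 * unit₂_2_1)) (by decide +kernel) (by decide +kernel) h
  exact unitCert_2_1_mod_373.not_c2_c3_eq_zero (ρ := ⟨-3, 37, 3, -3⟩) (by decide +kernel) x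
    ⟨by rw [hx], by rw [hx]⟩

/-- A unit of the order. -/
def unit₁_3_5 : (QuarticOrder 3 5)ˣ :=
  ⟨⟨26, 5, 0, 0⟩, ⟨4976, 3370, 1950, -375⟩, by decide +kernel, by decide +kernel⟩

/-- A unit of the order. -/
def unit₂_3_5 : (QuarticOrder 3 5)ˣ :=
  ⟨⟨-2004, -3766, -718, 237⟩, ⟨-139434, -137119, -155948, -17752⟩,
    by decide +kernel, by decide +kernel⟩

lemma unitCert_3_5_mod_107 : UnitCert unit₁_3_5 unit₂_3_5 107 53 53 2 2 0 1 :=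
  UnitCert.of_checks 17 [(2, [⟨5, 1, 2, 1, 4⟩]),
    (53, [⟨107, 7, 52, 83, 56⟩, ⟨107, 12, 48, 13, 23⟩])]
    (by norm_num) (by decide +kernel) (by decide +kernel) (by norm_num) (by norm_num)
    (by refine ⟨by norm_num, by decide, by norm_num, by norm_num, by decide, by decide⟩)
    (by decide +kernel) (by decide +kernel) (by decide +kernel) (by decide +kernel)
    (by decide +kernel)

lemma hessian_mem_3_5 {s t : ℤ}
    (h : s ^ 4 - 18 * 3 * s ^ 2 * t ^ 2 - 36 * 5 * s * t ^ 3 + (36 - 27 * 3 ^ 2) * t ^ 4 = 1) :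
    hessian 3 5 s t ∈ [9, 1277334] :=
  unitCert_3_5_mod_107.hessian_mem ⟨-9, -1, -34, 7⟩
    ⟨-10, 10, 26, -24⟩ [(0, 0), (1, 0)] _
    ⟨by decide +kernel⟩ ⟨by decide +kernel⟩ (by decide +kernel) (by decide +kernel)
    (by decide +kernel) h

/-- A unit of the order. -/
def unit₁_7_21 : (QuarticOrder 7 21)ˣ :=
  ⟨⟨12, 4, 1, 0⟩, ⟨870, 364, 71, -12⟩, by decide +kernel, by decide +kernel⟩

/-- A unit of the order. -/
def unit₂_7_21 : (QuarticOrder 7 21)ˣ :=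
  ⟨⟨86186, 55486, 35664, 2485⟩, ⟨-400696, -194047, -30066, 5756⟩,
    by decide +kernel, by decide +kernel⟩

lemma unitCert_7_21_mod_197 : UnitCert unit₁_7_21 unit₂_7_21 197 98 98 2 2 1 0 :=
  UnitCert.of_checks 5 [(2, [⟨11, 0, 0, 1, 1⟩, ⟨19, 2, 14, 18, 1⟩]),
    (7, [⟨29, 11, 21, 24, 7⟩, ⟨29, 22, 26, 24, 24⟩])]
    (by norm_num) (by decide +kernel) (by decide +kernel) (by norm_num) (by norm_num)
    (by refine ⟨by norm_num, by decide, by norm_num, by norm_num, by decide, by decide⟩)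
    (by decide +kernel) (by decide +kernel) (by decide +kernel) (by decide +kernel)
    (by decide +kernel)

lemma hessian_mem_7_21 {s t : ℤ}
    (h : s ^ 4 - 18 * 7 * s ^ 2 * t ^ 2 - 36 * 21 * s * t ^ 3 + (36 - 27 * 7 ^ 2) * t ^ 4 = 1) :
    hessian 7 21 s t ∈ [21] :=
  unitCert_7_21_mod_197.hessian_mem ⟨37, 4, -14, 91⟩
    ⟨47, 0, -24, 66⟩ [(0, 0)] _
    ⟨by decide +kernel⟩ ⟨by decide +kernel⟩ (by decide +kernel) (by decide +kernel)
    (by decide +kernel) h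

/-- A unit of the order. -/
def unit₁_22_119 : (QuarticOrder 22 119)ˣ :=
  ⟨⟨27, 6, 1, 0⟩, ⟨3915, 846, 71, -8⟩, by decide +kernel, by decide +kernel⟩

/-- A unit of the order. -/
def unit₂_22_119 : (QuarticOrder 22 119)ˣ :=
  ⟨⟨-1312477, -345071, -35853, 3487⟩, ⟨163165043, 35195819, 2940414, -332332⟩,
    by decide +kernel, by decide +kernel⟩

lemma unitCert_22_119_mod_197 : UnitCert unit₁_22_119 unit₂_22_119 197 98 98 2 2 1 0 :=
  UnitCert.of_checks 5 [(2, [⟨11, 8, 3, 1, 1⟩, ⟨19, 8, 15, 18, 1⟩]),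
    (7, [⟨29, 17, 19, 23, 23⟩, ⟨29, 27, 11, 23, 25⟩])]
    (by norm_num) (by decide +kernel) (by decide +kernel) (by norm_num) (by norm_num)
    (by refine ⟨by norm_num, by decide, by norm_num, by norm_num, by decide, by decide⟩)
    (by decide +kernel) (by decide +kernel) (by decide +kernel) (by decide +kernel)
    (by decide +kernel)

lemma hessian_mem_22_119 {s t : ℤ}
    (h : s ^ 4 - 18 * 22 * s ^ 2 * t ^ 2 - 36 * 119 * s * t ^ 3 + (36 - 27 * 22 ^ 2) * t ^ 4 = 1) :
    hessian 22 119 s t ∈ [66] :=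
  unitCert_22_119_mod_197.hessian_mem ⟨61, -32, -83, -63⟩
    ⟨46, -83, 89, -78⟩ [(0, 0)] _
    ⟨by decide +kernel⟩ ⟨by decide +kernel⟩ (by decide +kernel) (by decide +kernel)
    (by decide +kernel) h

end QuarticOrder

/-- The binary quartic form `a x⁴ + 4 b x³ y + 6 c x² y² + 4 d x y³ + e y⁴`. -/
@[ext]
structure BinaryQuartic where
  a : ℤ
  b : ℤ
  c : ℤ
  d : ℤ
  e : ℤ
  deriving DecidableEq

namespace BinaryQuartic

open QuarticOrder (force force_eq)

/-- The value of a form. -/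
def eval (f : BinaryQuartic) (x y : ℤ) : ℤ :=
  f.a * x ^ 4 + 4 * f.b * x ^ 3 * y + 6 * f.c * x ^ 2 * y ^ 2 + 4 * f.d * x * y ^ 3 + f.e * y ^ 4

/-- The value of the Hessian covariant of a form. -/
def hess (f : BinaryQuartic) (x y : ℤ) : ℤ :=
  (f.b ^ 2 - f.a * f.c) * x ^ 4 + 2 * (f.b * f.c - f.a * f.d) * x ^ 3 * y +
    (3 * f.c ^ 2 - 2 * f.b * f.d - f.a * f.e) * x ^ 2 * y ^ 2 +
    2 * (f.c * f.d - f.b * f.e) * x * y ^ 3 + (f.d ^ 2 - f.c * f.e) * y ^ 4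

/-- The quadratic invariant. -/
def inv₂ (f : BinaryQuartic) : ℤ := f.a * f.e - 4 * f.b * f.d + 3 * f.c ^ 2

/-- The cubic invariant. -/
def inv₃ (f : BinaryQuartic) : ℤ :=
  f.a * f.c * f.e + 2 * f.b * f.c * f.d - f.a * f.d ^ 2 - f.e * f.b ^ 2 - f.c ^ 3

/-- The form `f (p x + q y, r x + s y)`. -/
def comp (f : BinaryQuartic) (p q r s : ℤ) : BinaryQuartic where
  a := f.a * p ^ 4 + 4 * f.b * p ^ 3 * r + 6 * f.c * p ^ 2 * r ^ 2 + 4 * f.d * p * r ^ 3 +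
    f.e * r ^ 4
  b := f.a * p ^ 3 * q + f.b * (p ^ 3 * s + 3 * p ^ 2 * q * r) +
    3 * f.c * (p ^ 2 * r * s + p * q * r ^ 2) + f.d * (3 * p * r ^ 2 * s + q * r ^ 3) +
    f.e * r ^ 3 * s
  c := f.a * p ^ 2 * q ^ 2 + 2 * f.b * (p ^ 2 * q * s + p * q ^ 2 * r) +
    f.c * (p ^ 2 * s ^ 2 + 4 * p * q * r * s + q ^ 2 * r ^ 2) +
    2 * f.d * (p * r * s ^ 2 + q * r ^ 2 * s) + f.e * r ^ 2 * s ^ 2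
  d := f.a * p * q ^ 3 + f.b * (3 * p * q ^ 2 * s + q ^ 3 * r) +
    3 * f.c * (p * q * s ^ 2 + q ^ 2 * r * s) + f.d * (p * s ^ 3 + 3 * q * r * s ^ 2) +
    f.e * r * s ^ 3
  e := f.a * q ^ 4 + 4 * f.b * q ^ 3 * s + 6 * f.c * q ^ 2 * s ^ 2 + 4 * f.d * q * s ^ 3 +
    f.e * s ^ 4

variable (f : BinaryQuartic) (p q r s : ℤ)

lemma eval_comp (x y : ℤ) : (f.comp p q r s).eval x y = f.eval (p * x + q * y) (r * x + s * y) := by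
  simp only [eval, comp]
  ring

lemma hess_comp (x y : ℤ) : (f.comp p q r s).hess x y =
    (p * s - q * r) ^ 2 * f.hess (p * x + q * y) (r * x + s * y) := by
  simp only [hess, comp]
  ring

lemma inv₂_comp : (f.comp p q r s).inv₂ = (p * s - q * r) ^ 4 * f.inv₂ := by
  simp only [inv₂, comp]
  ring

lemma inv₃_comp : (f.comp p q r s).inv₃ = (p * s - q * r) ^ 6 * f.inv₃ := by
  simp only [inv₃, comp]
  ring

/-- The form takes the value `1` at a point where the Hessian covariant takes the value `n`. -/
def Represents (n : ℤ) : Prop := ∃ x y, f.eval x y = 1 ∧ f.hess x y = n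

variable {f p q r s} {n : ℤ}

lemma Represents.of_comp (h : (f.comp p q r s).Represents n) (hdet : (p * s - q * r) ^ 2 = 1) :
    f.Represents n := by
  obtain ⟨x, y, h1, h2⟩ := h
  rw [eval_comp] at h1
  rw [hess_comp, hdet, one_mul] at h2
  exact ⟨_, _, h1, h2⟩

lemma Represents.comp (h : f.Represents n) (hdet : (p * s - q * r) ^ 2 = 1) :
    (f.comp p q r s).Represents n := by
  obtain ⟨x, y, h1, h2⟩ := h
  have hx : p * ((p * s - q * r) * (s * x - q * y)) + q * ((p * s - q * r) * (p * y - r * x)) =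
    x := by linear_combination x * hdet
  have hy : r * ((p * s - q * r) * (s * x - q * y)) + s * ((p * s - q * r) * (p * y - r * x)) =
    y := by linear_combination y * hdet
  refine ⟨(p * s - q * r) * (s * x - q * y), (p * s - q * r) * (p * y - r * x), ?_, ?_⟩
  · rw [eval_comp, hx, hy, h1]
  · rw [hess_comp, hx, hy, hdet, one_mul, h2]

/-- A form without representations of `1` modulo `m`. -/
def LocallyObstructed (m : ℕ) (f : BinaryQuartic) : Prop :=
  ∀ x ∈ List.range m, ∀ y ∈ List.range m,
    ¬ ((m : ℤ) ∣ f.eval x y - 1 ∧ ((m : ℤ) ∣ 3 → (m : ℤ) ∣ f.hess x y))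

instance (m : ℕ) (f : BinaryQuartic) : Decidable (LocallyObstructed m f) := by
  unfold LocallyObstructed
  infer_instance

lemma LocallyObstructed.not_represents {m : ℕ} (hm : 0 < m) (hf : f.LocallyObstructed m)
    (h : f.Represents n) (hn : 3 ∣ n) : False := by
  obtain ⟨x, y, h1, h2⟩ := h
  have hm' : (0 : ℤ) < m := by exact_mod_cast hm
  have red (z : ℤ) : ∃ k ∈ List.range m, ((k : ℕ) : ℤ) ≡ z [ZMOD m] := by
    refine ⟨(z % m).toNat, ?_, ?_⟩
    · have := Int.emod_lt_of_pos z hm'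
      have := Int.emod_nonneg z hm'.ne'
      rw [List.mem_range]
      omega
    · rw [Int.toNat_of_nonneg (Int.emod_nonneg z hm'.ne')]
      exact Int.mod_modEq z m
  obtain ⟨x', hx', hx⟩ := red x
  obtain ⟨y', hy', hy⟩ := red y
  refine hf x' hx' y' hy' ⟨?_, fun h3 => ?_⟩
  · rw [← h1]
    refine Int.ModEq.dvd (Int.ModEq.symm ?_)
    unfold eval
    gcongr
  · rw [← Int.modEq_zero_iff_dvd]
    refine Int.ModEq.trans ?_ (Int.modEq_zero_iff_dvd.2 (h3.trans (h2 ▸ hn)))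
    unfold hess
    gcongr

/-- The syzygy between the covariants, at the leading coefficients. -/
lemma syzygy (f : BinaryQuartic) :
    (f.a ^ 2 * f.d - 3 * f.a * f.b * f.c + 2 * f.b ^ 3) ^ 2 =
      4 * (f.b ^ 2 - f.a * f.c) ^ 3 - f.inv₂ * f.a ^ 2 * (f.b ^ 2 - f.a * f.c)
        - f.inv₃ * f.a ^ 3 := by
  simp only [inv₂, inv₃]
  ring

/-- Application of `k` to the evaluated integer `z`. -/
def forceInt (z : ℤ) (k : ℤ → Bool) : Bool :=
  match z with
  | Int.ofNat n => force n fun m => k (Int.ofNat m)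
  | Int.negSucc n => force n fun m => k (Int.negSucc m)

lemma forceInt_eq (z : ℤ) (k : ℤ → Bool) : forceInt z k = k z := by
  cases z <;> simp only [forceInt, force_eq]

/-- Evaluates `f` at the integer square root of `n`, as computed by Newton's iteration. -/
def newtonSqrt (n : ℕ) (f : ℕ → Bool) : ℕ → ℕ → Bool
  | 0, x => f x
  | k + 1, x => force ((x + n / x) / 2) fun y => bif Nat.ble x y then f x else newtonSqrt n f k y

lemma exists_of_newtonSqrt {n : ℕ} {f : ℕ → Bool} {k x : ℕ} (h : newtonSqrt n f k x = true) :
    ∃ s, f s = true := by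
  induction k generalizing x with
  | zero => exact ⟨x, h⟩
  | succ k ih =>
    rw [newtonSqrt, force_eq, Bool.cond_eq_ite] at h
    split_ifs at h
    · exact ⟨x, h⟩
    · exact ih h

/-- No form outside `l` has quadratic invariant `36`, first coefficients `a ≠ 0`, `b`, `c` and
syzygy covariant `g`. -/
def checkRoot (l : List BinaryQuartic) (a b c g : ℤ) : Bool :=
  let d := (g + 3 * a * b * c - 2 * b ^ 3) / a ^ 2
  let e := (36 + 4 * b * d - 3 * c ^ 2) / a
  !(decide (d * a ^ 2 = g + 3 * a * b * c - 2 * b ^ 3) &&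
    decide (e * a = 36 + 4 * b * d - 3 * c ^ 2)) || l.any fun f => decide (f = ⟨a, b, c, d, e⟩)

/-- No form outside `l` with Hessian coefficient bounded by `B` has invariants `36` and `j` and
first coefficients `a ≠ 0`, `b`, `c`. -/
def checkTriple (j : ℤ) (B : ℕ) (l : List BinaryQuartic) (a b c : ℤ) : Bool :=
  forceInt a fun a => forceInt b fun b => forceInt c fun c =>
  forceInt (b * b - a * c) fun H => Nat.blt B H.natAbs ||
    forceInt (H * (4 * (H * H) - 36 * (a * a)) - j * (a * (a * a))) fun K =>
      decide (K < 0) || force K.toNat fun n => newtonSqrt n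
        (fun s => (Nat.ble (s * s + 1) n && Nat.ble (n + 1) ((s + 1) * (s + 1))) ||
          (Nat.beq (s * s) n && checkRoot l a b c s && checkRoot l a b c (-s))) 40 20000

/-- No form outside `l` has invariants `36` and `j` and first coefficients `0`, `b ≠ 0`, `c`. -/
def checkPair (j : ℤ) (l : List BinaryQuartic) (b c : ℤ) : Bool :=
  let d := (3 * c ^ 2 - 36) / (4 * b)
  let e := (2 * b * c * d - c ^ 3 - j) / b ^ 2
  !(decide (d * (4 * b) = 3 * c ^ 2 - 36) && decide (e * b ^ 2 = 2 * b * c * d - c ^ 3 - j)) ||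
    l.any fun f => decide (f = ⟨0, b, c, d, e⟩)

lemma mem_of_checkRoot {l : List BinaryQuartic} {g : ℤ} (ha : f.a ≠ 0) (h36 : f.inv₂ = 36)
    (hg : f.a ^ 2 * f.d - 3 * f.a * f.b * f.c + 2 * f.b ^ 3 = g)
    (h : checkRoot l f.a f.b f.c g = true) : f ∈ l := by
  have hd : (g + 3 * f.a * f.b * f.c - 2 * f.b ^ 3) / f.a ^ 2 = f.d :=
    Int.ediv_eq_of_eq_mul_left (pow_ne_zero 2 ha) (by linear_combination -hg)
  unfold inv₂ at h36
  have he : (36 + 4 * f.b * f.d - 3 * f.c ^ 2) / f.a = f.e :=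
    Int.ediv_eq_of_eq_mul_left ha (by linear_combination -h36)
  simp only [checkRoot, hd, he, Bool.or_eq_true, Bool.not_eq_true', Bool.and_eq_false_iff,
    decide_eq_false_iff_not, List.any_eq_true, decide_eq_true_eq] at h
  rcases h with (h | h) | ⟨x, hx, rfl⟩
  · exact absurd (by linear_combination hg) h
  · exact absurd (by linear_combination h36) h
  · exact hx

lemma mem_of_checkTriple {j : ℤ} {B : ℕ} {l : List BinaryQuartic} (ha : f.a ≠ 0) (h36 : f.inv₂ = 36)
    (hj : f.inv₃ = j) (hB : |f.b ^ 2 - f.a * f.c| ≤ B)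
    (h : checkTriple j B l f.a f.b f.c = true) : f ∈ l := by
  have hs := f.syzygy
  rw [h36, hj] at hs
  set g := f.a ^ 2 * f.d - 3 * f.a * f.b * f.c + 2 * f.b ^ 3 with hg
  have hs' : (f.b * f.b - f.a * f.c) * (4 * ((f.b * f.b - f.a * f.c) * (f.b * f.b - f.a * f.c)) -
    36 * (f.a * f.a)) - j * (f.a * (f.a * f.a)) = g ^ 2 := by linear_combination -hs
  simp only [checkTriple, forceInt_eq] at h
  rw [hs', ← sq] at h
  simp only [Bool.or_eq_true, decide_eq_true_eq, force_eq, Nat.blt_eq] at h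
  rw [Int.abs_eq_natAbs, Int.ofNat_le] at hB
  rcases h with h | h | h
  · exact absurd hB (not_le.2 h)
  · exact absurd h (not_lt.2 (sq_nonneg g))
  obtain ⟨s, h⟩ := exists_of_newtonSqrt h
  have hn : ((g ^ 2).toNat : ℤ) = g ^ 2 := Int.toNat_of_nonneg (sq_nonneg g)
  generalize (g ^ 2).toNat = n at h hn
  simp only [Bool.or_eq_true, Bool.and_eq_true, Nat.ble_eq, Nat.beq_eq] at h
  zify at h
  rw [hn] at h
  rcases h with ⟨h1, h2⟩ | ⟨⟨h1, h2⟩, h3⟩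
  · replace h1 : (s : ℤ) ^ 2 < g ^ 2 := by linarith
    replace h2 : g ^ 2 < (s + 1 : ℤ) ^ 2 := by linarith
    rw [sq_lt_sq, Nat.abs_cast] at h1
    rw [sq_lt_sq, abs_of_nonneg (a := (s + 1 : ℤ)) (by positivity)] at h2
    omega
  · rcases sq_eq_sq_iff_eq_or_eq_neg.1 ((sq (s : ℤ)).trans h1) with h | h
    · exact mem_of_checkRoot ha h36 h.symm h2
    · exact mem_of_checkRoot ha h36 (by rw [h, neg_neg]) h3

lemma mem_of_checkPair {j : ℤ} {l : List BinaryQuartic} (ha : f.a = 0) (hb : f.b ≠ 0)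
    (h36 : f.inv₂ = 36) (hj : f.inv₃ = j) (h : checkPair j l f.b f.c = true) : f ∈ l := by
  unfold inv₂ at h36
  unfold inv₃ at hj
  rw [ha] at h36 hj
  have hd : (3 * f.c ^ 2 - 36) / (4 * f.b) = f.d :=
    Int.ediv_eq_of_eq_mul_left (by simpa using hb) (by linear_combination h36)
  have he : (2 * f.b * f.c * f.d - f.c ^ 3 - j) / f.b ^ 2 = f.e :=
    Int.ediv_eq_of_eq_mul_left (pow_ne_zero 2 hb) (by linear_combination hj)
  simp only [checkPair, hd, he, Bool.or_eq_true, Bool.not_eq_true', Bool.and_eq_false_iff,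
    decide_eq_false_iff_not, List.any_eq_true, decide_eq_true_eq] at h
  rcases h with (h | h) | ⟨x, hx, rfl⟩
  · exact absurd (by linear_combination -h36) h
  · exact absurd (by linear_combination -hj) h
  · rwa [← ha] at hx

/-- The integers of absolute value at most `n`. -/
def intRange (n : ℕ) : List ℤ := (List.range (2 * n + 1)).map fun k : ℕ => (k : ℤ) - n

lemma mem_intRange {n : ℕ} {z : ℤ} (h : |z| ≤ n) : z ∈ intRange n := by
  rw [abs_le] at h
  rw [intRange, List.mem_map]
  refine ⟨(z + n).toNat, List.mem_range.2 ?_, ?_⟩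
  · omega
  · omega

/-- The list `l` contains all forms with invariants `36` and `j` that are reduced: the first
coefficient is at most `A`, and the first coefficient of the Hessian covariant is at most `B` in
absolute value, and the second coefficient is minimal under translations. -/
def checkReduced (j : ℤ) (A B : ℕ) (l : List BinaryQuartic) : Bool :=
  ((intRange A).all fun a => decide (a = 0) || (List.range (a.natAbs / 2 + 1)).all fun b =>
    (intRange ((B + b * b) / a.natAbs)).all fun c => checkTriple j B l a b c) &&
  (List.range (B + 1)).all fun b => decide (B < b * b) || decide (b = 0) ||
    (intRange b).all fun c => checkPair j l b c

lemma exists_two_mul_abs_le (a b : ℤ) (ha : a ≠ 0) : ∃ k, 2 * |b + k * a| ≤ |a| := by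
  have hm : 0 < |a| := abs_pos.2 ha
  have h0 := Int.emod_nonneg (b + |a| / 2) hm.ne'
  have h1 := Int.emod_lt_of_pos (b + |a| / 2) hm
  have hd : a ∣ (b + |a| / 2) % |a| - |a| / 2 - b := by
    rw [← abs_dvd, show (b + |a| / 2) % |a| - |a| / 2 - b = (b + |a| / 2) % |a| - (b + |a| / 2)
      by ring]
    exact Int.ModEq.dvd (Int.mod_modEq _ _).symm
  obtain ⟨k, hk⟩ := hd
  refine ⟨k, ?_⟩
  rw [show b + k * a = (b + |a| / 2) % |a| - |a| / 2 by linear_combination -hk]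
  generalize |a| = m at *
  have : |(b + m / 2) % m - m / 2| ≤ m / 2 := abs_le.2 ⟨by omega, by omega⟩
  omega

/-- Translation composed with a reflection, normalizing the sign of the second coefficient. -/
lemma exists_comp_nonneg (f : BinaryQuartic) (k : ℤ) : ∃ q s : ℤ, (1 * s - q * 0) ^ 2 = 1 ∧
    (f.comp 1 q 0 s).a = f.a ∧ (f.comp 1 q 0 s).b = |f.b + k * f.a| ∧
    (f.comp 1 q 0 s).c = f.c + 2 * k * f.b + k ^ 2 * f.a := by
  rcases abs_cases (f.b + k * f.a) with h | h
  · refine ⟨k, 1, by norm_num, ?_, ?_, ?_⟩ <;> simp only [comp, h.1] <;> ring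
  · refine ⟨-k, -1, by norm_num, ?_, ?_, ?_⟩ <;> simp only [comp, h.1] <;> ring

/-- A form with small first coefficients is equivalent to one of the reduced forms. -/
theorem exists_represents_of_checkReduced {j : ℤ} {A B : ℕ} {l : List BinaryQuartic}
    (h : checkReduced j A B l = true) (h36 : f.inv₂ = 36) (hj : f.inv₃ = j) (ha : |f.a| ≤ A)
    (hB : |f.b ^ 2 - f.a * f.c| ≤ B) (hf : f.Represents n) : ∃ g ∈ l, g.Represents n := by
  rw [checkReduced, Bool.and_eq_true, List.all_eq_true, List.all_eq_true] at h
  obtain ⟨h1, h2⟩ := h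
  by_cases ha0 : f.a = 0
  · have hb0 : f.b ≠ 0 := by
      intro hb
      have h12 : f.c ^ 2 = 12 := by
        rw [inv₂, ha0, hb] at h36
        linarith
      have : |f.c| < 4 := abs_lt_of_sq_lt_sq (by rw [h12]; norm_num) (by norm_num)
      rw [abs_lt] at this
      obtain ⟨h3, h4⟩ := this
      interval_cases f.c <;> omega
    obtain ⟨k, hk⟩ := exists_two_mul_abs_le (2 * f.b) f.c (by omega)
    obtain ⟨q, s, hdet, e1, e2, e3⟩ := f.exists_comp_nonneg k
    rw [ha0, mul_zero, add_zero] at e2 e3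
    refine ⟨_, mem_of_checkPair (f := f.comp 1 q 0 s) (j := j) (e1.trans ha0) ?_ ?_ ?_ ?_,
      hf.comp hdet⟩
    · rw [e2]
      exact abs_ne_zero.2 hb0
    · rw [inv₂_comp, h36, show ∀ z : ℤ, z ^ 4 = (z ^ 2) ^ 2 by intro z; ring, hdet]
      norm_num
    · rw [inv₃_comp, hj, show ∀ z : ℤ, z ^ 6 = (z ^ 2) ^ 3 by intro z; ring, hdet]
      norm_num
    · have hbB : f.b.natAbs * f.b.natAbs ≤ B := by
        rw [ha0, zero_mul, sub_zero, abs_of_nonneg (sq_nonneg _), sq,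
          ← Int.natAbs_mul_self' f.b] at hB
        exact_mod_cast hB
      have hlt : f.b.natAbs < B + 1 := by nlinarith [Nat.le_mul_self f.b.natAbs]
      have := h2 f.b.natAbs (List.mem_range.2 hlt)
      simp only [Bool.or_eq_true, decide_eq_true_eq, List.all_eq_true] at this
      rcases this with (h' | h') | h'
      · omega
      · omega
      · rw [e2, e3, Int.abs_eq_natAbs]
        refine h' _ (mem_intRange ?_)
        rw [abs_mul, show k * (2 * f.b) = 2 * k * f.b by ring, abs_two] at hk
        rw [← Int.abs_eq_natAbs]
        linarith
  · obtain ⟨k, hk⟩ := exists_two_mul_abs_le f.a f.b ha0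
    obtain ⟨q, s, hdet, e1, e2, e3⟩ := f.exists_comp_nonneg k
    refine ⟨_, mem_of_checkTriple (f := f.comp 1 q 0 s) (j := j) (B := B) (by rwa [e1]) ?_ ?_ ?_ ?_,
      hf.comp hdet⟩
    · rw [inv₂_comp, h36, show ∀ z : ℤ, z ^ 4 = (z ^ 2) ^ 2 by intro z; ring, hdet]
      norm_num
    · rw [inv₃_comp, hj, show ∀ z : ℤ, z ^ 6 = (z ^ 2) ^ 3 by intro z; ring, hdet]
      norm_num
    · rw [e1, e2, e3, sq_abs]
      convert hB using 2
      ring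
    · have := h1 f.a (mem_intRange ha)
      simp only [Bool.or_eq_true, decide_eq_true_eq, List.all_eq_true, ha0, false_or] at this
      rw [e1, e2, e3, Int.abs_eq_natAbs]
      rw [Int.abs_eq_natAbs, Int.abs_eq_natAbs] at hk
      refine this _ (List.mem_range.2 (by omega)) _ (mem_intRange ?_)
      have key : |f.a| * |f.c + 2 * k * f.b + k ^ 2 * f.a| ≤
          B + |f.b + k * f.a| * |f.b + k * f.a| := by
        rw [← abs_mul, abs_mul_abs_self, abs_le]
        rw [abs_le] at hB
        constructor <;> nlinarith [hB.1, hB.2, sq_nonneg (f.b + k * f.a)]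
      simp only [Int.abs_eq_natAbs] at key ⊢
      norm_cast at key ⊢
      rw [Nat.le_div_iff_mul_le (by omega), mul_comm]
      exact key

end BinaryQuartic

/-- A positive definite binary quadratic form over the reals takes a small value at a primitive
integral vector. -/
lemma exists_primitive_sq_le {A B C : ℝ} (hA : 0 < A) (hE : 0 < A * C - B ^ 2) :
    ∃ p q r s : ℤ, p * s - q * r = 1 ∧
      0 < A * p ^ 2 + 2 * B * p * r + C * r ^ 2 ∧
      3 * (A * p ^ 2 + 2 * B * p * r + C * r ^ 2) ^ 2 ≤ 4 * (A * C - B ^ 2) := by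
  have hs : 0 < √(A * C - B ^ 2) := Real.sqrt_pos.2 hE
  have hs2 : √(A * C - B ^ 2) ^ 2 = A * C - B ^ 2 := Real.sq_sqrt hE.le
  set z : UpperHalfPlane := ⟨⟨B / A, √(A * C - B ^ 2) / A⟩, div_pos hs hA⟩ with hz
  obtain ⟨g, hg⟩ := ModularGroup.exists_smul_mem_fd z
  have h3 := ModularGroup.three_le_four_mul_im_sq_of_mem_fd hg
  have hdet := g.det_coe
  rw [Matrix.det_fin_two] at hdet
  rw [ModularGroup.im_smul_eq_div_normSq] at h3
  have hn : Complex.normSq (UpperHalfPlane.denom g z) = (A * (g 1 1 : ℤ) ^ 2 +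
      2 * B * (g 1 1 : ℤ) * (g 1 0 : ℤ) + C * (g 1 0 : ℤ) ^ 2) / A := by
    rw [ModularGroup.denom_apply, Complex.normSq_apply]
    simp only [hz, Complex.add_re, Complex.mul_re, Complex.add_im, Complex.mul_im,
      Complex.intCast_re, Complex.intCast_im]
    field_simp
    linear_combination ((g 1 0 : ℤ) : ℝ) ^ 2 * hs2
  have hpos := UpperHalfPlane.normSq_denom_pos g z.im_ne_zero
  refine ⟨g 1 1, g 0 1, g 1 0, g 0 0, by linarith, ?_, ?_⟩
  · rw [hn] at hpos
    exact (div_pos_iff_of_pos_right hA).1 hpos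
  · rw [hn] at h3 hpos
    replace hpos := (div_pos_iff_of_pos_right hA).1 hpos
    set q := A * (g 1 1 : ℤ) ^ 2 + 2 * B * (g 1 1 : ℤ) * (g 1 0 : ℤ) + C * (g 1 0 : ℤ) ^ 2
    have hq : z.im / (q / A) = √(A * C - B ^ 2) / q := by
      rw [hz]
      simp only [UpperHalfPlane.mk_im]
      field_simp
    rw [hq, div_pow, hs2, ← mul_div_assoc, le_div_iff₀ (by positivity)] at h3
    exact h3

namespace BinaryQuartic

/-- The value of a form at a real point. -/
def evalReal (f : BinaryQuartic) (x y : ℝ) : ℝ :=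
  f.a * x ^ 4 + 4 * f.b * x ^ 3 * y + 6 * f.c * x ^ 2 * y ^ 2 + 4 * f.d * x * y ^ 3 + f.e * y ^ 4

lemma evalReal_comp (f : BinaryQuartic) (p q r s : ℤ) (x y : ℝ) :
    (f.comp p q r s).evalReal x y = f.evalReal (p * x + q * y) (r * x + s * y) := by
  simp only [evalReal, comp]
  push_cast
  ring

/-- A real quartic dominated by `M (x ^ 2 + 1) ^ 2` has small coefficients. -/
lemma abs_sq_sub_mul_le {α β γ δ ε M : ℝ} (h : ∀ x : ℝ,
    |α * x ^ 4 + 4 * β * x ^ 3 + 6 * γ * x ^ 2 + 4 * δ * x + ε| ≤ M * (x ^ 2 + 1) ^ 2)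
    (hα : |α| ≤ M) : |β ^ 2 - α * γ| ≤ 2.0001 * M ^ 2 := by
  have h0 := abs_le.1 (h 0)
  have h1 := abs_le.1 (h 1)
  have h2 := abs_le.1 (h (-1))
  have h3 := abs_le.1 (h (12 / 5))
  have h4 := abs_le.1 (h (-12 / 5))
  have h5 := abs_le.1 (h (5 / 12))
  have h6 := abs_le.1 (h (-5 / 12))
  norm_num at h0 h1 h2 h3 h4 h5 h6
  have hM : 0 ≤ M := (abs_nonneg _).trans hα
  have hγ : |γ| ≤ M := by
    rw [abs_le] at hα ⊢
    constructor <;> linarith [h0.1, h0.2, h1.1, h1.2, h2.1, h2.2]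
  have hβ : |β| ≤ 1.00004 * M := by
    rw [abs_le]
    constructor <;> linarith [h3.1, h3.2, h4.1, h4.2, h5.1, h5.2, h6.1, h6.2]
  have h7 : β ^ 2 ≤ (1.00004 * M) ^ 2 := sq_le_sq' (abs_le.1 hβ).1 (abs_le.1 hβ).2
  have h8 : |α * γ| ≤ M * M := by
    rw [abs_mul]
    gcongr
  rw [abs_le] at h8 ⊢
  constructor <;> nlinarith [sq_nonneg β, sq_nonneg M, h8.1, h8.2]

/-- A form dominated by the square of a positive definite quadratic form of discriminant `-4 E` is
equivalent to a form with small first coefficients. -/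
theorem exists_comp_abs_le (f : BinaryQuartic) {A B C : ℝ} (hA : 0 < A) (hE : 0 < A * C - B ^ 2)
    (h : ∀ x y, |f.evalReal x y| * (A * C - B ^ 2) ≤
      10.65 * (A * x ^ 2 + 2 * B * x * y + C * y ^ 2) ^ 2) :
    ∃ p q r s : ℤ, (p * s - q * r) ^ 2 = 1 ∧ |(f.comp p q r s).a| ≤ 14 ∧
      |(f.comp p q r s).b ^ 2 - (f.comp p q r s).a * (f.comp p q r s).c| ≤ 302 := by
  obtain ⟨p, q, r, s, hdet, hpos, hle⟩ := exists_primitive_sq_le hA hE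
  refine ⟨p, q, r, s, by rw [hdet, one_pow], ?_⟩
  set A' := A * p ^ 2 + 2 * B * p * r + C * r ^ 2 with hA'
  set B' := A * p * q + B * (p * s + q * r) + C * r * s with hB'
  set C' := A * q ^ 2 + 2 * B * q * s + C * s ^ 2 with hC'
  have hdetR : (p * s - q * r : ℝ) = 1 := by exact_mod_cast hdet
  have hE' : A' * C' - B' ^ 2 = A * C - B ^ 2 := by
    linear_combination (A * C - B ^ 2) * (p * s - q * r + 1) * hdetR
  replace h (x y : ℝ) : |(f.comp p q r s).evalReal x y| * (A' * C' - B' ^ 2) ≤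
      10.65 * (A' * x ^ 2 + 2 * B' * x * y + C' * y ^ 2) ^ 2 := by
    rw [evalReal_comp, hE']
    convert h (p * x + q * y) (r * x + s * y) using 3
    ring
  rw [← hE'] at hle hE
  generalize f.comp p q r s = g at *
  generalize A' = A' at *
  clear_value B' C'
  set k := √(A' * C' - B' ^ 2) / A' with hk
  have hk0 : 0 < k := by positivity
  have hk2 : A' * C' - B' ^ 2 = A' ^ 2 * k ^ 2 := by
    rw [hk, div_pow, Real.sq_sqrt hE.le]
    field_simp
  have hk3 : 3 ≤ 4 * k ^ 2 := by
    rw [hk2] at hle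
    have : 0 < A' ^ 2 := by positivity
    nlinarith
  set u := B' / A' with hu
  have hB : B' = u * A' := by rw [hu]; field_simp
  have hα : |(g.a : ℝ)| * k ^ 2 ≤ 10.65 := by
    have := h 1 0
    rw [hk2] at this
    simp only [evalReal] at this
    norm_num at this
    have h4 : 0 < A' ^ 2 := by positivity
    nlinarith
  have hcoef := abs_sq_sub_mul_le (α := g.a * k ^ 2) (β := (g.b - g.a * u) * k)
    (γ := g.a * u ^ 2 - 2 * g.b * u + g.c)
    (δ := (g.d - 3 * g.c * u + 3 * g.b * u ^ 2 - g.a * u ^ 3) / k)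
    (ε := (g.e - 4 * g.d * u + 6 * g.c * u ^ 2 - 4 * g.b * u ^ 3 + g.a * u ^ 4) / k ^ 2)
    (M := 10.65) ?_ (by rwa [abs_mul, abs_of_pos (a := k ^ 2) (by positivity)])
  · constructor
    · have : |(g.a : ℝ)| < 15 := by nlinarith [abs_nonneg (g.a : ℝ)]
      have h5 : |g.a| < 15 := by exact_mod_cast this
      omega
    · rw [show ((g.b - g.a * u) * k) ^ 2 - g.a * k ^ 2 * (g.a * u ^ 2 - 2 * g.b * u + g.c) =
        (g.b ^ 2 - g.a * g.c) * k ^ 2 by ring, abs_mul, abs_of_pos (a := k ^ 2) (by positivity)]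
        at hcoef
      have : |(g.b ^ 2 - g.a * g.c : ℝ)| < 303 := by
        nlinarith [abs_nonneg (g.b ^ 2 - g.a * g.c : ℝ)]
      have h5 : |g.b ^ 2 - g.a * g.c| < 303 := by exact_mod_cast this
      omega
  · intro x
    have := h (k * x - u) 1
    have hC : A' * C' = A' * (A' * (k ^ 2 + u ^ 2)) := by
      linear_combination hk2 + hB * (B' + u * A')
    replace hC := mul_left_cancel₀ hpos.ne' hC
    have hg : g.evalReal (k * x - u) 1 = (g.a * k ^ 2 * x ^ 4 + 4 * ((g.b - g.a * u) * k) * x ^ 3 +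
        6 * (g.a * u ^ 2 - 2 * g.b * u + g.c) * x ^ 2 +
        4 * ((g.d - 3 * g.c * u + 3 * g.b * u ^ 2 - g.a * u ^ 3) / k) * x +
        (g.e - 4 * g.d * u + 6 * g.c * u ^ 2 - 4 * g.b * u ^ 3 + g.a * u ^ 4) / k ^ 2) *
        k ^ 2 := by
      rw [evalReal]
      field_simp
      ring
    have hQ : A' * (k * x - u) ^ 2 + 2 * (u * A') * (k * x - u) * 1 +
        A' * (k ^ 2 + u ^ 2) * 1 ^ 2 = A' * k ^ 2 * (x ^ 2 + 1) := by ring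
    rw [hk2, hB, hC, hQ, hg, abs_mul, abs_of_pos (a := k ^ 2) (by positivity)] at this
    refine le_of_mul_le_mul_right ?_ (a := A' ^ 2 * k ^ 4) (by positivity)
    linarith

end BinaryQuartic

lemma exists_cube_sub_eq {b : ℝ} (h : b ∈ Set.Icc (134 : ℝ) 182.5) :
    ∃ ε ∈ Set.Icc (5.7 : ℝ) 6.2, ε ^ 3 - 9 * ε = b := by
  have hc : ContinuousOn (fun ε : ℝ => ε ^ 3 - 9 * ε) (Set.Icc 5.7 6.2) := by fun_prop
  refine intermediate_value_Icc (by norm_num) hc ⟨?_, ?_⟩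
  · norm_num
    linarith [h.1]
  · norm_num
    linarith [h.2]

namespace BinaryQuartic

/-- The product of two quadratic forms is dominated by the square of a definite form, when the
factors are related by the given identity. -/
lemma abs_mul_mul_le {ε σ K κ P D T : ℝ} (hσ : σ ^ 2 = 1) (hε : ε ∈ Set.Icc (5.7 : ℝ) 6.2)
    (hK : K = 3 * ε ^ 2 - 36) (hκ : 0 ≤ κ)
    (hT : K * D ^ 2 + 6 * (σ * ε) * P * D - P ^ 2 = 4 * κ * T ^ 2) :
    |P * D| * (144 + 72 * ε - K) ≤ 10.65 * (σ * P + 12 * D) ^ 2 := by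
  obtain ⟨h1, h2⟩ := hε
  have h3 : 0 ≤ K * D ^ 2 + 6 * (σ * ε) * P * D - P ^ 2 := hT ▸ by positivity
  have h4 : 48 * |P * D| ≤ (σ * P + 12 * D) ^ 2 := by
    have h5 : |P * D| = |σ * P * D| := by
      rw [mul_assoc, abs_mul σ, ← Real.sqrt_sq_eq_abs σ, hσ,
        Real.sqrt_one, one_mul]
    have h6 : P ^ 2 = (σ * P) ^ 2 := by rw [mul_pow, hσ, one_mul]
    rw [h6] at h3
    rw [h5]
    have h7 : 0 ≤ K * D ^ 2 + 6 * ε * (σ * P * D) - (σ * P) ^ 2 := by linarith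
    generalize σ * P = R at h7 ⊢
    rcases abs_cases (R * D) with h | h
    · rw [h.1]
      linarith [sq_nonneg (R - 12 * D)]
    · have h8 : 0 ≤ 4 * 2.6 * (201.6 - 4.8 * ε ^ 2) - (72 - 9.6 * ε) ^ 2 := by nlinarith
      have h9 : 0 ≤ 4 * 2.6 *
          (2.6 * R ^ 2 + (72 - 9.6 * ε) * (R * D) + (201.6 - 4.8 * ε ^ 2) * D ^ 2) := by
        nlinarith [sq_nonneg (2 * 2.6 * R + (72 - 9.6 * ε) * D), mul_nonneg h8 (sq_nonneg D)]
      rw [h.1]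
      rw [hK] at h7
      linarith
  have h5 : 144 + 72 * ε - K ≤ 48 * 10.65 := by nlinarith
  nlinarith [abs_nonneg (P * D)]

/-- The form attached to a point of large height on the curve `3 y ^ 2 = 4 x ^ 3 - 4 x + c` is
equivalent to a form with small first coefficients. -/
theorem exists_comp_abs_le_of_curve {N Y : ℤ} {σ b : ℝ} (hσ : σ = 1 ∨ σ = -1)
    (hb : b ∈ Set.Icc (134 : ℝ) 182.5) (hN : 3 ≤ N) (hY : 0 < Y)
    (h : 27 * (3 * Y ^ 2 - 4 * N ^ 3 + 4 * N : ℝ) = 4 * σ * b) (f : BinaryQuartic)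
    (hf : f = ⟨1, 0, -3 * N, -9 * Y, 36 - 27 * N ^ 2⟩) :
    ∃ p q r s : ℤ, (p * s - q * r) ^ 2 = 1 ∧ |(f.comp p q r s).a| ≤ 14 ∧
      |(f.comp p q r s).b ^ 2 - (f.comp p q r s).a * (f.comp p q r s).c| ≤ 302 := by
  obtain ⟨ε, hε, rfl⟩ := exists_cube_sub_eq hb
  have hσ2 : σ ^ 2 = 1 := by rcases hσ with rfl | rfl <;> norm_num
  have hNR : (3 : ℝ) ≤ N := by exact_mod_cast hN
  have hYR : (0 : ℝ) < Y := by exact_mod_cast hY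
  obtain ⟨h1, h2⟩ := id hε
  have hx : 0 < 3 * N + σ * ε := by rcases hσ with rfl | rfl <;> linarith
  set τ := √(3 * N + σ * ε) with hτ
  have hτ0 : 0 < τ := Real.sqrt_pos.2 hx
  have hτ2 : τ ^ 2 = 3 * N + σ * ε := Real.sq_sqrt hx.le
  obtain ⟨v, hv⟩ : ∃ v, v * τ = 9 / 2 * Y := ⟨9 / 2 * Y / τ, by field_simp⟩
  have hv0 : 0 < v := by
    have : 0 < v * τ := by rw [hv]; positivity
    exact (pos_iff_pos_of_mul_pos this).2 hτ0
  clear_value τ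
  have hN' : (N : ℝ) = (τ ^ 2 - σ * ε) / 3 := by linarith
  have hv2 : v ^ 2 = τ ^ 4 - 3 * σ * ε * τ ^ 2 + 3 * ε ^ 2 - 9 := by
    refine mul_right_cancel₀ (pow_ne_zero 2 hτ0.ne') ?_
    rw [← mul_pow, hv]
    rw [hN'] at h
    linear_combination h / 4 + (3 * τ ^ 2 * ε ^ 2 - σ * ε ^ 3) * hσ2
  set κ := 2 * v - 2 * τ ^ 2 + 3 * σ * ε with hκ
  set κ' := 2 * v + 2 * τ ^ 2 - 3 * σ * ε with hκ'
  have hprod : κ * κ' = 3 * ε ^ 2 - 36 := by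
    linear_combination 4 * hv2 - 9 * ε ^ 2 * hσ2
  have hpos : 0 < κ * κ' := by nlinarith
  have hκ0 : 0 < κ := by
    rcases mul_pos_iff.1 hpos with h | h
    · exact h.1
    · linarith
  have hδ : 0 < 144 + 72 * ε - (3 * ε ^ 2 - 36) := by nlinarith
  set l := -τ ^ 2 + 3 * σ * ε + 2 * v with hl
  set m := -τ ^ 2 + 3 * σ * ε - 2 * v with hm
  have hE : (σ * κ + 12) * (12 * l + σ * κ * m) - (τ * (12 - σ * κ)) ^ 2 =
      (144 + 72 * ε - (3 * ε ^ 2 - 36)) * κ := by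
    linear_combination κ ^ 2 * (m - τ ^ 2) * hσ2 - κ * hprod + 72 * ε * κ * hσ2
  refine exists_comp_abs_le f (A := σ * κ + 12) (B := τ * (12 - σ * κ))
    (C := 12 * l + σ * κ * m) ?_ ?_ fun x y => ?_
  · rcases hσ with rfl | rfl
    · linarith
    · have : κ' * κ < κ' * 12 := by nlinarith
      have := lt_of_mul_lt_mul_left this (by nlinarith)
      linarith
  · rw [hE]
    positivity
  · have hF : f.evalReal x y = (x ^ 2 + 2 * τ * x * y + l * y ^ 2) *
        (x ^ 2 - 2 * τ * x * y + m * y ^ 2) := by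
      rw [hf, evalReal]
      push_cast
      have : (Y : ℝ) = 2 / 9 * (v * τ) := by linarith
      rw [this, hN']
      linear_combination y ^ 4 * (4 * hv2 - 12 * ε ^ 2 * hσ2)
    have key := abs_mul_mul_le (P := κ * (x ^ 2 - 2 * τ * x * y + m * y ^ 2))
      (D := x ^ 2 + 2 * τ * x * y + l * y ^ 2)
      (T := τ * x ^ 2 + 2 * v * x * y + τ * (τ ^ 2 - 3 * σ * ε) * y ^ 2) hσ2 hε rfl hκ0.le ?_
    · rw [hE, hF]
      convert key using 1
      · rw [abs_mul, abs_mul, abs_mul, abs_of_pos hκ0]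
        ring
      · ring
    · linear_combination -(x ^ 2 + 2 * τ * x * y + l * y ^ 2) ^ 2 * hprod

/-- The quartic form attached to the point `(N, Y)`. -/
def curveForm (N Y : ℤ) : BinaryQuartic := ⟨1, 0, -3 * N, -9 * Y, 36 - 27 * N ^ 2⟩

/-- A form with the same resolvent cubic as `curveForm N Y`, not equivalent to it. -/
def companionForm (N Y : ℤ) : BinaryQuartic := ⟨9, 0, -3 * N, -3 * Y, 4 - 3 * N ^ 2⟩

lemma inv₂_curveForm (N Y : ℤ) : (curveForm N Y).inv₂ = 36 := by
  simp only [inv₂, curveForm]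
  ring

lemma inv₃_curveForm (N Y : ℤ) :
    (curveForm N Y).inv₃ = -27 * (3 * Y ^ 2 - 4 * N ^ 3 + 4 * N) := by
  simp only [inv₃, curveForm]
  ring

lemma represents_curveForm (N Y : ℤ) : (curveForm N Y).Represents (3 * N) := by
  refine ⟨1, 0, ?_, ?_⟩ <;> simp [eval, hess, curveForm]

lemma Represents.exists_hessian {N Y n : ℤ} (h : (curveForm N Y).Represents n) :
    ∃ s t, s ^ 4 - 18 * N * s ^ 2 * t ^ 2 - 36 * Y * s * t ^ 3 + (36 - 27 * N ^ 2) * t ^ 4 = 1 ∧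
      QuarticOrder.hessian N Y s t = n := by
  obtain ⟨s, t, h1, h2⟩ := h
  simp only [eval, hess, curveForm, QuarticOrder.hessian] at h1 h2 ⊢
  exact ⟨s, t, by linear_combination h1, by linear_combination h2⟩

lemma not_represents_companionForm {N Y : ℤ} (n : ℤ)
    (h : ∀ s t, 9 * s ^ 4 - 18 * N * s ^ 2 * t ^ 2 - 12 * Y * s * t ^ 3 +
      (4 - 3 * N ^ 2) * t ^ 4 ≠ 1) : ¬ (companionForm N Y).Represents n := by
  rintro ⟨s, t, h1, -⟩
  simp only [eval, companionForm] at h1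
  exact h s t (by linear_combination h1)

/-- Every form in `l` has a local obstruction, or is obtained from a form in `l'` by one of the
substitutions in `mats`. -/
def checkCovering (l l' : List BinaryQuartic) (mats : List (ℤ × ℤ × ℤ × ℤ)) : Bool :=
  l.all fun f => decide (f.LocallyObstructed 3) || decide (f.LocallyObstructed 5) ||
    l'.any fun g => mats.any fun m => decide ((m.1 * m.2.2.2 - m.2.1 * m.2.2.1) ^ 2 = 1) &&
      decide (g.comp m.1 m.2.1 m.2.2.1 m.2.2.2 = f)

lemma exists_represents_of_checkCovering {l l' : List BinaryQuartic}
    {mats : List (ℤ × ℤ × ℤ × ℤ)} (h : checkCovering l l' mats = true) {f : BinaryQuartic}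
    (hf : f ∈ l) {n : ℤ} (hn : 3 ∣ n) (hr : f.Represents n) : ∃ g ∈ l', g.Represents n := by
  simp only [checkCovering, List.all_eq_true, Bool.or_eq_true, decide_eq_true_eq,
    List.any_eq_true, Bool.and_eq_true] at h
  rcases h f hf with (h | h) | ⟨g, hg, m, -, hdet, rfl⟩
  · exact (h.not_represents (by norm_num) hr hn).elim
  · exact (h.not_represents (by norm_num) hr hn).elim
  · exact ⟨g, hg, hr.of_comp hdet⟩

/-- The reduced forms with quadratic invariant `36` and cubic invariant `-729`. -/
def reducedForms₁ : List BinaryQuartic :=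
  [
    ⟨-8, 1, 22, 64, 145⟩, ⟨-8, 3, 6, 0, 9⟩, ⟨-7, 3, 22, -113, 396⟩, ⟨-4, 1, 6, -7, 25⟩,
    ⟨0, 1, 0, -9, 729⟩, ⟨0, 3, 0, -3, 81⟩, ⟨0, 9, -6, 2, 9⟩, ⟨0, 9, 0, -1, 9⟩, ⟨0, 9, 6, 2, 9⟩,
    ⟨1, 0, -133, -3067, -53031⟩, ⟨1, 0, -133, 3067, -53031⟩, ⟨1, 0, -84, -1539, -21132⟩,
    ⟨1, 0, -84, 1539, -21132⟩, ⟨1, 0, -78, -1377, -18216⟩, ⟨1, 0, -78, 1377, -18216⟩,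
    ⟨1, 0, -45, -603, -6039⟩, ⟨1, 0, -45, 603, -6039⟩, ⟨1, 0, -18, -153, -936⟩,
    ⟨1, 0, -18, 153, -936⟩, ⟨1, 0, -15, -117, -639⟩, ⟨1, 0, -15, 117, -639⟩, ⟨1, 0, -7, -43, -111⟩,
    ⟨1, 0, -7, 43, -111⟩, ⟨1, 0, -4, -29, -12⟩, ⟨1, 0, -4, 29, -12⟩, ⟨1, 0, -3, -27, 9⟩,
    ⟨1, 0, -3, 27, 9⟩, ⟨1, 0, 0, -27, 36⟩, ⟨1, 0, 0, 27, 36⟩, ⟨1, 0, 3, -27, 9⟩, ⟨1, 0, 3, 27, 9⟩,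
    ⟨1, 0, 6, -9, -72⟩, ⟨1, 0, 6, 9, -72⟩, ⟨4, 1, -20, 76, -215⟩, ⟨4, 1, -8, -32, -71⟩,
    ⟨4, 1, 6, 11, -7⟩, ⟨9, 0, -18, -51, -104⟩, ⟨9, 0, -18, 51, -104⟩, ⟨9, 0, -15, -39, -71⟩,
    ⟨9, 0, -15, 39, -71⟩, ⟨9, 0, -3, -9, 1⟩, ⟨9, 0, -3, 9, 1⟩, ⟨9, 0, 0, -9, 4⟩, ⟨9, 0, 0, 9, 4⟩,
    ⟨9, 0, 3, -9, 1⟩, ⟨9, 0, 3, 9, 1⟩, ⟨9, 0, 6, -3, -8⟩, ⟨9, 0, 6, 3, -8⟩, ⟨9, 1, 0, -9, 0⟩,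
    ⟨9, 2, -6, 9, 0⟩, ⟨9, 2, 6, 9, 0⟩, ⟨9, 3, -6, -21, -36⟩, ⟨9, 3, -3, 6, 9⟩]

/-- Representatives of the locally soluble reduced forms with cubic invariant `-729`. -/
def representatives₁ : List BinaryQuartic :=
  [
    curveForm (-2) 1, curveForm (-1) 3, curveForm 0 3, curveForm 1 3, curveForm 5 13,
    curveForm 6 17, curveForm 15 67, curveForm 26 153, curveForm 28 171, companionForm (-2) 1,
    companionForm 0 3, companionForm 5 13]

lemma checkReduced₁ : checkReduced (-729) 14 302 reducedForms₁ = true := by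
  decide +kernel

lemma checkCovering₁ : checkCovering reducedForms₁ representatives₁
    [
      (-9, -1, 1, 0), (-9, 1, 1, 0), (-8, -17, 1, 2), (-6, 5, 1, -1), (-1, 0, 0, 1), (-1, 0, 1, 1),
      (0, -1, 1, -2), (0, -1, 1, 0), (1, 0, 0, -1), (1, 0, 0, 1), (6, 5, -1, -1)] = true := by
  decide +kernel

/-- The reduced forms with quadratic invariant `36` and cubic invariant `567`. -/
def reducedForms₂ : List BinaryQuartic :=
  [
    ⟨-8, 1, -2, -8, 1⟩, ⟨-8, 3, -6, 0, 9⟩, ⟨-8, 3, 0, -9, 9⟩, ⟨-7, 1, 0, -9, 0⟩, ⟨-7, 2, -6, 9, 0⟩,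
    ⟨-7, 2, 6, 9, 0⟩, ⟨0, 1, 0, -9, -567⟩, ⟨0, 3, 0, -3, -63⟩, ⟨0, 9, -6, 2, -7⟩,
    ⟨0, 9, 0, -1, -7⟩, ⟨0, 9, 6, 2, -7⟩, ⟨1, 0, -109, -2275, -35607⟩, ⟨1, 0, -109, 2275, -35607⟩,
    ⟨1, 0, -66, -1071, -13032⟩, ⟨1, 0, -66, 1071, -13032⟩, ⟨1, 0, -21, -189, -1287⟩,
    ⟨1, 0, -21, 189, -1287⟩, ⟨1, 0, -9, -45, -207⟩, ⟨1, 0, -9, 45, -207⟩, ⟨1, 0, -6, -9, -72⟩,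
    ⟨1, 0, -6, 9, -72⟩, ⟨9, 0, -21, -63, -143⟩, ⟨9, 0, -21, 63, -143⟩, ⟨9, 0, -9, -15, -23⟩,
    ⟨9, 0, -9, 15, -23⟩, ⟨9, 0, -6, -3, -8⟩, ⟨9, 0, -6, 3, -8⟩]

/-- Representatives of the locally soluble reduced forms with cubic invariant `567`. -/
def representatives₂ : List BinaryQuartic :=
  [
    curveForm 2 1, curveForm 3 5, curveForm 7 21, curveForm 22 119, companionForm 2 1]

lemma checkReduced₂ : checkReduced (567) 14 302 reducedForms₂ = true := by
  decide +kernel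

lemma checkCovering₂ : checkCovering reducedForms₂ representatives₂
    [
      (-8, 1, 1, 0), (-1, 0, 0, 1), (0, -1, 1, 0), (1, 0, 0, -1), (1, 0, 0, 1), (9, -17, -1, 2),
      (9, 17, -1, -2)] = true := by
  decide +kernel

lemma mem_of_curve₁ {N Y : ℤ} (hN : 3 ≤ N) (hY : 0 < Y)
    (h : 3 * Y ^ 2 = 4 * N ^ 3 - 4 * N + 27) :
    N ∈ [-2, 259, -1, 0, 19629, 1, 5, 6, 15, 26, 28, 664] := by
  have hR : (3 * Y ^ 2 : ℝ) = 4 * N ^ 3 - 4 * N + 27 := by exact_mod_cast h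
  obtain ⟨p, q, r, s, hdet, ha, hB⟩ := exists_comp_abs_le_of_curve (σ := 1) (b := 729 / 4)
    (by norm_num) (by norm_num) hN hY (by linear_combination 27 * hR) (curveForm N Y) rfl
  obtain ⟨f, hf, hr⟩ := exists_represents_of_checkReduced checkReduced₁
    (by rw [inv₂_comp, inv₂_curveForm, show ∀ z : ℤ, z ^ 4 = (z ^ 2) ^ 2 by intro z; ring, hdet,
      one_pow, one_mul])
    (by rw [inv₃_comp, inv₃_curveForm, show ∀ z : ℤ, z ^ 6 = (z ^ 2) ^ 3 by intro z; ring, hdet,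
      one_pow, one_mul, h]; ring)
    ha hB ((represents_curveForm N Y).comp hdet)
  obtain ⟨g, hg, hr'⟩ := exists_represents_of_checkCovering checkCovering₁ hf
    (dvd_mul_right 3 N) hr
  clear hr hf hdet ha hB
  simp only [representatives₁, List.mem_cons, List.not_mem_nil, or_false] at hg
  rcases hg with rfl | rfl | rfl | rfl | rfl | rfl | rfl | rfl | rfl | rfl | rfl | rfl
  · obtain ⟨s, t, h1, h2⟩ := hr'.exists_hessian
    have h3 := QuarticOrder.hessian_mem_neg2_1 h1
    rw [h2] at h3
    simp only [List.mem_cons, List.not_mem_nil, or_false] at h3 ⊢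
    omega
  · obtain ⟨s, t, h1, h2⟩ := hr'.exists_hessian
    have h3 := QuarticOrder.hessian_mem_neg1_3 h1
    rw [h2] at h3
    simp only [List.mem_cons, List.not_mem_nil, or_false] at h3 ⊢
    omega
  · obtain ⟨s, t, h1, h2⟩ := hr'.exists_hessian
    have h3 := QuarticOrder.hessian_mem_0_3 h1
    rw [h2] at h3
    simp only [List.mem_cons, List.not_mem_nil, or_false] at h3 ⊢
    omega
  · obtain ⟨s, t, h1, h2⟩ := hr'.exists_hessian
    have h3 := QuarticOrder.hessian_mem_1_3 h1
    rw [h2] at h3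
    simp only [List.mem_cons, List.not_mem_nil, or_false] at h3 ⊢
    omega
  · obtain ⟨s, t, h1, h2⟩ := hr'.exists_hessian
    have h3 := QuarticOrder.hessian_mem_5_13 h1
    rw [h2] at h3
    simp only [List.mem_cons, List.not_mem_nil, or_false] at h3 ⊢
    omega
  · obtain ⟨s, t, h1, h2⟩ := hr'.exists_hessian
    have h3 := QuarticOrder.hessian_mem_6_17 h1
    rw [h2] at h3
    simp only [List.mem_cons, List.not_mem_nil, or_false] at h3 ⊢
    omega
  · obtain ⟨s, t, h1, h2⟩ := hr'.exists_hessian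
    have h3 := QuarticOrder.hessian_mem_15_67 h1
    rw [h2] at h3
    simp only [List.mem_cons, List.not_mem_nil, or_false] at h3 ⊢
    omega
  · obtain ⟨s, t, h1, h2⟩ := hr'.exists_hessian
    have h3 := QuarticOrder.hessian_mem_26_153 h1
    rw [h2] at h3
    simp only [List.mem_cons, List.not_mem_nil, or_false] at h3 ⊢
    omega
  · obtain ⟨s, t, h1, h2⟩ := hr'.exists_hessian
    have h3 := QuarticOrder.hessian_mem_28_171 h1
    rw [h2] at h3
    simp only [List.mem_cons, List.not_mem_nil, or_false] at h3 ⊢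
    omega
  · exact (not_represents_companionForm _ QuarticOrder.companion_ne_one_neg2_1 hr').elim
  · exact (not_represents_companionForm _ QuarticOrder.companion_ne_one_0_3 hr').elim
  · exact (not_represents_companionForm _ QuarticOrder.companion_ne_one_5_13 hr').elim

lemma mem_of_curve₂ {N Y : ℤ} (hN : 3 ≤ N) (hY : 0 < Y)
    (h : 3 * Y ^ 2 = 4 * N ^ 3 - 4 * N - 21) :
    N ∈ [2, 3, 425778, 7, 22] := by
  have hR : (3 * Y ^ 2 : ℝ) = 4 * N ^ 3 - 4 * N - 21 := by exact_mod_cast h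
  obtain ⟨p, q, r, s, hdet, ha, hB⟩ := exists_comp_abs_le_of_curve (σ := -1) (b := 567 / 4)
    (by norm_num) (by norm_num) hN hY (by linear_combination 27 * hR) (curveForm N Y) rfl
  obtain ⟨f, hf, hr⟩ := exists_represents_of_checkReduced checkReduced₂
    (by rw [inv₂_comp, inv₂_curveForm, show ∀ z : ℤ, z ^ 4 = (z ^ 2) ^ 2 by intro z; ring, hdet,
      one_pow, one_mul])
    (by rw [inv₃_comp, inv₃_curveForm, show ∀ z : ℤ, z ^ 6 = (z ^ 2) ^ 3 by intro z; ring, hdet,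
      one_pow, one_mul, h]; ring)
    ha hB ((represents_curveForm N Y).comp hdet)
  obtain ⟨g, hg, hr'⟩ := exists_represents_of_checkCovering checkCovering₂ hf
    (dvd_mul_right 3 N) hr
  clear hr hf hdet ha hB
  simp only [representatives₂, List.mem_cons, List.not_mem_nil, or_false] at hg
  rcases hg with rfl | rfl | rfl | rfl | rfl
  · obtain ⟨s, t, h1, h2⟩ := hr'.exists_hessian
    have h3 := QuarticOrder.hessian_mem_2_1 h1
    rw [h2] at h3
    simp only [List.mem_cons, List.not_mem_nil, or_false] at h3 ⊢
    omega
  · obtain ⟨s, t, h1, h2⟩ := hr'.exists_hessian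
    have h3 := QuarticOrder.hessian_mem_3_5 h1
    rw [h2] at h3
    simp only [List.mem_cons, List.not_mem_nil, or_false] at h3 ⊢
    omega
  · obtain ⟨s, t, h1, h2⟩ := hr'.exists_hessian
    have h3 := QuarticOrder.hessian_mem_7_21 h1
    rw [h2] at h3
    simp only [List.mem_cons, List.not_mem_nil, or_false] at h3 ⊢
    omega
  · obtain ⟨s, t, h1, h2⟩ := hr'.exists_hessian
    have h3 := QuarticOrder.hessian_mem_22_119 h1
    rw [h2] at h3
    simp only [List.mem_cons, List.not_mem_nil, or_false] at h3 ⊢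
    omega
  · exact (not_represents_companionForm _ QuarticOrder.companion_ne_one_2_1 hr').elim

end BinaryQuartic

lemma two_mul_choose_two (n : ℕ) : 2 * (n.choose 2 : ℤ) = n * (n - 1) := by
  have h := Nat.descFactorial_eq_factorial_mul_choose n 2
  rcases n with - | n
  · simp
  · simp only [Nat.descFactorial] at h
    zify at h
    push_cast at h ⊢
    norm_num [Nat.factorial] at h
    linarith

lemma six_mul_choose_three (n : ℕ) : 6 * (n.choose 3 : ℤ) = n * (n - 1) * (n - 2) := by
  have h := Nat.descFactorial_eq_factorial_mul_choose n 3
  rcases n with - | - | n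
  · simp
  · simp [Nat.choose]
  · simp only [Nat.descFactorial] at h
    zify at h
    push_cast at h ⊢
    norm_num [Nat.factorial] at h
    linarith

lemma choose_two_eq_choose_three_add_one_iff (n m : ℕ) :
    m.choose 2 = n.choose 3 + 1 ↔
      3 * (2 * m - 1 : ℤ) ^ 2 = 4 * (n - 1 : ℤ) ^ 3 - 4 * (n - 1 : ℤ) + 27 := by
  have h1 := two_mul_choose_two m
  have h2 := six_mul_choose_three n
  zify
  constructor <;> intro h <;> linarith

lemma choose_three_eq_choose_two_add_one_iff (n m : ℕ) :
    m.choose 3 = n.choose 2 + 1 ↔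
      3 * (2 * n - 1 : ℤ) ^ 2 = 4 * (m - 1 : ℤ) ^ 3 - 4 * (m - 1 : ℤ) - 21 := by
  have h1 := two_mul_choose_two n
  have h2 := six_mul_choose_three m
  zify
  constructor <;> intro h <;> linarith

lemma eq_of_sq_eq {m k : ℕ} {c : ℤ} (hm : 1 ≤ m) (h : 3 * (2 * m - 1 : ℤ) ^ 2 = c) (hk : 1 ≤ k)
    (hc : 3 * (2 * k - 1 : ℤ) ^ 2 = c) : m = k := by
  have : (2 * m - 1 : ℤ) = 2 * k - 1 := by
    rw [← sq_eq_sq₀ (by omega) (by omega)]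
    linarith
  omega

theorem near_collisions_diff_one_23 :
    (∀ n m : ℕ, 6 ≤ n → 4 ≤ m →
      (Nat.choose m 2 = Nat.choose n 3 + 1 ↔
        (n, m) = (6, 7) ∨ (n, m) = (7, 9) ∨ (n, m) = (16, 34) ∨
        (n, m) = (27, 77) ∨ (n, m) = (29, 86) ∨ (n, m) = (260, 2407) ∨
        (n, m) = (665, 9879) ∨ (n, m) = (19630, 1587767))) ∧
    (∀ n m : ℕ, 4 ≤ n → 6 ≤ m →
      (Nat.choose m 3 = Nat.choose n 2 + 1 ↔
        (n, m) = (11, 8) ∨ (n, m) = (60, 23) ∨ (n, m) = (160403633, 425779))) := by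
  constructor
  · intro n m hn hm
    rw [choose_two_eq_choose_three_add_one_iff]
    constructor
    · intro h
      have hN := BinaryQuartic.mem_of_curve₁ (by omega) (by omega) h
      simp only [List.mem_cons, List.not_mem_nil, or_false] at hN
      have key (k l : ℕ) (hk : (n : ℤ) - 1 = k - 1) (hl : 1 ≤ l)
          (hc : 3 * (2 * l - 1 : ℤ) ^ 2 = 4 * (k - 1) ^ 3 - 4 * (k - 1) + 27) : n = k ∧ m = l :=
        ⟨by omega, eq_of_sq_eq (by omega) h hl (by rw [hk]; linarith)⟩
      rcases hN with hN | hN | hN | hN | hN | hN | hN | hN | hN | hN | hN | hN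
      · omega
      · obtain ⟨rfl, rfl⟩ := key 260 2407 (by omega) (by norm_num) (by norm_num)
        simp
      · omega
      · omega
      · obtain ⟨rfl, rfl⟩ := key 19630 1587767 (by omega) (by norm_num) (by norm_num)
        simp
      · omega
      · obtain ⟨rfl, rfl⟩ := key 6 7 (by omega) (by norm_num) (by norm_num)
        simp
      · obtain ⟨rfl, rfl⟩ := key 7 9 (by omega) (by norm_num) (by norm_num)
        simp
      · obtain ⟨rfl, rfl⟩ := key 16 34 (by omega) (by norm_num) (by norm_num)
        simp
      · obtain ⟨rfl, rfl⟩ := key 27 77 (by omega) (by norm_num) (by norm_num)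
        simp
      · obtain ⟨rfl, rfl⟩ := key 29 86 (by omega) (by norm_num) (by norm_num)
        simp
      · obtain ⟨rfl, rfl⟩ := key 665 9879 (by omega) (by norm_num) (by norm_num)
        simp
    · simp only [Prod.mk.injEq]
      rintro (⟨rfl, rfl⟩ | ⟨rfl, rfl⟩ | ⟨rfl, rfl⟩ | ⟨rfl, rfl⟩ | ⟨rfl, rfl⟩ | ⟨rfl, rfl⟩ |
          ⟨rfl, rfl⟩ | ⟨rfl, rfl⟩) <;> norm_num
  · intro n m hn hm
    rw [choose_three_eq_choose_two_add_one_iff]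
    constructor
    · intro h
      have hN := BinaryQuartic.mem_of_curve₂ (by omega) (by omega) h
      simp only [List.mem_cons, List.not_mem_nil, or_false] at hN
      have key (k l : ℕ) (hk : (m : ℤ) - 1 = k - 1) (hl : 1 ≤ l)
          (hc : 3 * (2 * l - 1 : ℤ) ^ 2 = 4 * (k - 1) ^ 3 - 4 * (k - 1) - 21) : n = l ∧ m = k :=
        ⟨eq_of_sq_eq (by omega) h hl (by rw [hk]; linarith), by omega⟩
      rcases hN with hN | hN | hN | hN | hN
      · omega
      · omega
      · obtain ⟨rfl, rfl⟩ := key 425779 160403633 (by omega) (by norm_num) (by norm_num)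
        simp
      · obtain ⟨rfl, rfl⟩ := key 8 11 (by omega) (by norm_num) (by norm_num)
        simp
      · obtain ⟨rfl, rfl⟩ := key 23 60 (by omega) (by norm_num) (by norm_num)
        simp
    · simp only [Prod.mk.injEq]
      rintro (⟨rfl, rfl⟩ | ⟨rfl, rfl⟩ | ⟨rfl, rfl⟩) <;> norm_num
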